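/- Let T ⊆ ℝ² be the convex hull of three points at pairwise distance 1 (a closed unit equilateral triangle, of area √3/4). For m ≥ 1, call a family U₁, …, Uₘ of pairwise disjoint sets, each open in the subspace topology of T and each of two-dimensional Lebesgue measure (√3/4)/m, an m-part equal-area division of T, and call μH¹((T \ (U₁ ∪ ⋯ ∪ Uₘ)) ∩ interior T) its dividing length. Then the infimum of the dividing lengths over all 3-part equal-area divisions of T equals √3/2. -/

import Mathlib

open MeasureTheory
open Set Filter Topology

/-- number of points of a set, in `ℝ≥0∞` -/
noncomputable def cnt (S : Set ℝ) : ENNReal := (S.encard : ENNReal)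

lemma cnt_mono {S T : Set ℝ} (h : S ⊆ T) : cnt S ≤ cnt T := by
  unfold cnt; exact_mod_cast Set.encard_le_encard h

noncomputable def gcnt (n : ℕ) (S : Set ℝ) : ENNReal :=
  (((fun u : ℝ => ⌊(n:ℝ) * u⌋) '' S).encard : ENNReal)

lemma gcnt_le (n : ℕ) (S : Set ℝ) : gcnt n S ≤ cnt S := by
  unfold gcnt cnt; exact_mod_cast Set.encard_image_le _ _

lemma finset_le_gcnt (F : Finset ℝ) : ∀ᶠ n : ℕ in atTop,
    Set.InjOn (fun u : ℝ => ⌊(n:ℝ) * u⌋) (F : Set ℝ) := by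
  have : ∀ p ∈ F ×ˢ F, ∀ᶠ n : ℕ in atTop, ⌊(n:ℝ) * p.1⌋ = ⌊(n:ℝ) * p.2⌋ → p.1 = p.2 := by
    rintro ⟨u, v⟩ -
    by_cases huv : u = v
    · simp [huv]
    have hpos : 0 < |u - v| := abs_pos.mpr (sub_ne_zero.mpr huv)
    obtain ⟨N, hN⟩ := exists_nat_gt (1 / |u - v|)
    filter_upwards [eventually_ge_atTop N] with n hn h
    exfalso
    have h1 := Int.abs_sub_lt_one_of_floor_eq_floor h
    have h2 : (N:ℝ) ≤ n := by exact_mod_cast hn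
    rw [← mul_sub, abs_mul, abs_of_nonneg (by positivity)] at h1
    rw [div_lt_iff₀ hpos] at hN
    nlinarith
  have := (Filter.eventually_all_finset (F ×ˢ F)).mpr this
  filter_upwards [this] with n hn u hu v hv h
  exact hn (u, v) (Finset.mk_mem_product hu hv) h

lemma cnt_le_liminf (S : Set ℝ) : cnt S ≤ liminf (fun n => gcnt n S) atTop := by
  have key : ∀ F : Finset ℝ, (F : Set ℝ) ⊆ S → (F.card : ENNReal) ≤ liminf (fun n => gcnt n S) atTop := by
    intro F hF
    refine le_liminf_of_le (by isBoundedDefault) ?_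
    filter_upwards [finset_le_gcnt F] with n hn
    have h1 := hn.encard_image
    have h2 : ((fun u : ℝ => ⌊(n:ℝ) * u⌋) '' (F : Set ℝ)).encard ≤
      ((fun u : ℝ => ⌊(n:ℝ) * u⌋) '' S).encard := Set.encard_le_encard (image_mono hF)
    rw [h1, Set.encard_coe_eq_coe_finsetCard] at h2
    unfold gcnt
    calc (F.card : ENNReal) = (((F.card : ℕ∞)) : ENNReal) := by simp
      _ ≤ _ := by exact_mod_cast h2
  by_cases hS : S.Finite
  · have := key hS.toFinset (by simp)
    unfold cnt
    rw [hS.encard_eq_coe_toFinset_card]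
    simpa using this
  · have h : ∀ n : ℕ, (n : ENNReal) ≤ liminf (fun n => gcnt n S) atTop := by
      intro n
      obtain ⟨F, hF, hc⟩ := Set.Infinite.exists_subset_card_eq hS n
      rw [← hc]; exact key F hF
    have : liminf (fun n => gcnt n S) atTop = ⊤ := by
      apply ENNReal.eq_top_of_forall_nnreal_le
      intro r
      obtain ⟨n, hn⟩ := exists_nat_ge r
      refine le_trans ?_ (h n)
      exact_mod_cast hn
    rw [this]; exact le_top

lemma cnt_eq_liminf (S : Set ℝ) : cnt S = liminf (fun n => gcnt n S) atTop := by
  apply le_antisymm (cnt_le_liminf S)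
  calc _ ≤ liminf (fun _ : ℕ => cnt S) atTop :=
        liminf_le_liminf (Eventually.of_forall fun n => gcnt_le n S)
    _ = _ := by simp

/-- the cell -/
def cell (n : ℕ) (j : ℤ) : Set (ℝ × ℝ) := {z | ⌊(n:ℝ) * z.2⌋ = j}

lemma measurableSet_cell (n j) : MeasurableSet (cell n j) := by
  have : Measurable (fun z : ℝ × ℝ => ⌊(n:ℝ) * z.2⌋) := by fun_prop
  exact this (measurableSet_singleton j)

lemma gcnt_eq_tsum (n : ℕ) (B : Set (ℝ × ℝ)) (c : ℝ) :
    gcnt n {u | (c, u) ∈ B} = ∑' j : ℤ, (Prod.fst '' (B ∩ cell n j)).indicator (fun _ => (1:ENNReal)) c := by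
  unfold gcnt
  rw [← ENNReal.tsum_set_one, tsum_subtype _ (fun _ => (1:ENNReal))]
  congr 1
  ext j
  simp only [indicator]
  congr 1
  apply propext
  simp [cell]

lemma cell_inter_sigma (n : ℕ) (j : ℤ) (B : Set (ℝ × ℝ)) (hB : IsCompact B) :
    ∃ A : ℕ → Set (ℝ × ℝ), (∀ m, IsCompact (A m)) ∧ Monotone A ∧ B ∩ cell n j = ⋃ m, A m := by
  refine ⟨fun m => B ∩ {z | (j:ℝ) ≤ n * z.2 ∧ n * z.2 ≤ j + 1 - 1 / ((m:ℝ)+1)}, ?_, ?_, ?_⟩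
  · intro m
    refine hB.inter_right ?_
    have h1 : IsClosed {z : ℝ × ℝ | (j:ℝ) ≤ n * z.2} := isClosed_le (by fun_prop) (by fun_prop)
    have h2 : IsClosed {z : ℝ × ℝ | n * z.2 ≤ (j:ℝ) + 1 - 1 / ((m:ℝ)+1)} :=
      isClosed_le (by fun_prop) (by fun_prop)
    exact h1.inter h2
  · intro m m' h z hz
    refine ⟨hz.1, hz.2.1, hz.2.2.trans ?_⟩
    have : 1 / ((m':ℝ)+1) ≤ 1 / ((m:ℝ)+1) := by
      apply one_div_le_one_div_of_le (by positivity)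
      have : (m:ℝ) ≤ m' := by exact_mod_cast h
      linarith
    linarith
  · ext z
    simp only [cell, mem_inter_iff, mem_ofPred_eq, mem_iUnion, Int.floor_eq_iff]
    constructor
    · rintro ⟨h1, h2, h3⟩
      obtain ⟨m, hm⟩ := exists_nat_one_div_lt (sub_pos.mpr h3)
      exact ⟨m, h1, h2, by linarith⟩
    · rintro ⟨m, h1, h2, h3⟩
      have : 0 < 1 / ((m:ℝ)+1) := by positivity
      exact ⟨h1, h2, by linarith⟩

lemma meas_fst_cell (n : ℕ) (j : ℤ) (B : Set (ℝ × ℝ)) (hB : IsCompact B) :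
    MeasurableSet (Prod.fst '' (B ∩ cell n j)) := by
  obtain ⟨A, hA, -, hU⟩ := cell_inter_sigma n j B hB
  rw [hU, image_iUnion]
  exact MeasurableSet.iUnion fun m => ((hA m).image continuous_fst).measurableSet

lemma vol_fst_cell (n : ℕ) (j : ℤ) (B : Set (ℝ × ℝ)) (hB : IsCompact B) (ν : Measure (ℝ × ℝ))
    (hν : ∀ A ⊆ B, IsCompact A → volume (Prod.fst '' A) ≤ ν A) :
    volume (Prod.fst '' (B ∩ cell n j)) ≤ ν (B ∩ cell n j) := by
  obtain ⟨A, hA, hm, hU⟩ := cell_inter_sigma n j B hB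
  have hsub : ∀ m, A m ⊆ B ∩ cell n j := fun m => hU ▸ subset_iUnion A m
  conv_lhs => rw [hU, image_iUnion]
  rw [Monotone.measure_iUnion (fun a b h => image_mono (hm h))]
  exact iSup_le fun m => (hν _ ((hsub m).trans inter_subset_left) (hA m)).trans (measure_mono (hsub m))

lemma measurable_gcnt (n : ℕ) (B : Set (ℝ × ℝ)) (hB : IsCompact B) :
    Measurable (fun c => gcnt n {u | (c, u) ∈ B}) := by
  simp_rw [gcnt_eq_tsum]
  exact Measurable.tsum fun j => measurable_const.indicator (meas_fst_cell n j B hB)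

lemma measurable_cnt (B : Set (ℝ × ℝ)) (hB : IsCompact B) :
    Measurable (fun c => cnt {u | (c, u) ∈ B}) := by
  simp_rw [cnt_eq_liminf]
  exact Measurable.liminf fun n => measurable_gcnt n B hB

lemma lintegral_cnt_le (B : Set (ℝ × ℝ)) (hB : IsCompact B) (ν : Measure (ℝ × ℝ))
    (hν : ∀ A ⊆ B, IsCompact A → volume (Prod.fst '' A) ≤ ν A) :
    ∫⁻ c, cnt {u | (c, u) ∈ B} ≤ ν B := by
  simp_rw [cnt_eq_liminf]
  refine (lintegral_liminf_le fun n => measurable_gcnt n B hB).trans ?_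
  refine (liminf_le_liminf (v := fun _ => ν B) (Eventually.of_forall fun n => ?_)).trans (by simp)
  simp_rw [gcnt_eq_tsum]
  rw [lintegral_tsum fun j => (measurable_const.indicator (meas_fst_cell n j B hB)).aemeasurable]
  calc _ ≤ ∑' j : ℤ, ν (B ∩ cell n j) := by
        refine ENNReal.tsum_le_tsum fun j => ?_
        rw [lintegral_indicator (meas_fst_cell n j B hB)]
        simpa using vol_fst_cell n j B hB ν hν
    _ = ν (⋃ j, B ∩ cell n j) := by
        rw [measure_iUnion]
        · intro i j hij
          refine Set.disjoint_left.mpr fun z h1 h2 => hij ?_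
          exact h1.2.symm.trans h2.2
        · exact fun j => hB.measurableSet.inter (measurableSet_cell n j)
    _ ≤ ν B := measure_mono (iUnion_subset fun j => inter_subset_left)

open Classical in
noncomputable def kap (K : Set (ℝ × ℝ)) (c : ℝ) : Measure (ℝ × ℝ) :=
  if cnt {u | (c, u) ∈ K} = ⊤ then 0 else (Measure.count.restrict {u | (c, u) ∈ K}).map (Prod.mk c)

lemma cnt_eq_top {S : Set ℝ} : cnt S = ⊤ ↔ ¬ S.Finite := by
  unfold cnt
  rw [ENat.toENNReal_eq_top, Set.encard_eq_top_iff]; rfl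

lemma kap_apply (K : Set (ℝ × ℝ)) (c : ℝ) (h : {u | (c, u) ∈ K}.Finite) (B : Set (ℝ × ℝ))
    (hB : MeasurableSet B) : kap K c B = cnt {u | (c, u) ∈ K ∩ B} := by
  have h1 : ¬ (cnt {u | (c, u) ∈ K} = ⊤) := by rw [cnt_eq_top]; simpa using h
  unfold kap
  rw [if_neg h1, Measure.map_apply measurable_prodMk_left hB,
    Measure.restrict_apply (measurable_prodMk_left hB)]
  have hf : (Prod.mk c ⁻¹' B ∩ {u | (c, u) ∈ K}).Finite := h.subset inter_subset_right
  rw [Measure.count_apply hf.measurableSet]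
  unfold cnt
  congr 2
  ext u; simp [and_comm]

lemma kap_finite (K : Set (ℝ × ℝ)) (c : ℝ) : IsFiniteMeasure (kap K c) := by
  by_cases h : {u | (c, u) ∈ K}.Finite
  · constructor
    rw [kap_apply K c h _ MeasurableSet.univ]
    simp only [inter_univ]
    rw [lt_top_iff_ne_top]
    rw [ne_eq, cnt_eq_top]; simpa using h
  · have h1 : (cnt {u | (c, u) ∈ K} = ⊤) := by rw [cnt_eq_top]; simpa using h
    unfold kap
    rw [if_pos h1]; infer_instance

lemma kap_measurable (K : Set (ℝ × ℝ)) (hK : IsCompact K) : Measurable (kap K) := by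
  have := kap_finite K
  have hKm := measurable_cnt K hK
  have hbad : MeasurableSet {c | cnt {u | (c, u) ∈ K} = ⊤} := hKm (measurableSet_singleton _)
  have hcl : ∀ F : Set (ℝ × ℝ), IsClosed F → Measurable fun c => kap K c F := by
    intro F hF
    have : (fun c => kap K c F) = fun c => {c | cnt {u | (c, u) ∈ K} = ⊤}ᶜ.indicator
        (fun c => cnt {u | (c, u) ∈ K ∩ F}) c := by
      ext c
      by_cases h : {u | (c, u) ∈ K}.Finite
      · rw [kap_apply K c h F hF.measurableSet, indicator_of_mem]
        simp only [mem_compl_iff, mem_ofPred_eq, cnt_eq_top]; simpa using h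
      · have h1 : (cnt {u | (c, u) ∈ K} = ⊤) := by rw [cnt_eq_top]; simpa using h
        rw [indicator_of_notMem (by simpa using h1)]
        unfold kap; rw [if_pos h1]; simp
    rw [this]
    exact (measurable_cnt _ (hK.inter_right hF)).indicator hbad.compl
  refine Measurable.measure_of_isPiSystem (S := {F | IsClosed F}) ?_ isPiSystem_isClosed ?_ ?_
  · rw [← borel_eq_generateFrom_isClosed]; exact BorelSpace.measurable_eq
  · intro F hF; exact hcl F hF
  · exact hcl _ isClosed_univ

theorem slice (K : Set (ℝ × ℝ)) (hK : IsCompact K) (ν : Measure (ℝ × ℝ)) [IsFiniteMeasure ν]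
    (hν : ∀ A ⊆ K, IsCompact A → volume (Prod.fst '' A) ≤ ν A) :
    ∃ μ : Measure (ℝ × ℝ), (∀ B, MeasurableSet B → μ B ≤ ν B) ∧ (∀ᵐ c, {u | (c, u) ∈ K}.Finite) ∧
      ∀ B, MeasurableSet B → AEMeasurable (fun c => cnt {u | (c, u) ∈ K ∩ B}) ∧
        μ B = ∫⁻ c, cnt {u | (c, u) ∈ K ∩ B} := by
  have hfin : ∀ᵐ c, {u | (c, u) ∈ K}.Finite := by
    have h1 := lintegral_cnt_le K hK ν hν
    have h2 := ae_lt_top (measurable_cnt K hK) (h1.trans_lt (measure_lt_top ν K)).ne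
    filter_upwards [h2] with c hc
    by_contra h
    exact hc.ne (cnt_eq_top.mpr h)
  have hm := kap_measurable K hK
  have hae : ∀ B, MeasurableSet B → (fun c => kap K c B) =ᵐ[volume] (fun c => cnt {u | (c, u) ∈ K ∩ B}) := by
    intro B hB
    filter_upwards [hfin] with c hc
    exact kap_apply K c hc B hB
  have happ : ∀ B, MeasurableSet B → (volume.bind (kap K)) B = ∫⁻ c, cnt {u | (c, u) ∈ K ∩ B} := by
    intro B hB
    rw [Measure.bind_apply hB hm.aemeasurable]
    exact lintegral_congr_ae (hae B hB)
  have hcl : ∀ F, IsClosed F → (volume.bind (kap K)) F ≤ ν F := by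
    intro F hF
    rw [happ F hF.measurableSet]
    refine (lintegral_cnt_le (K ∩ F) (hK.inter_right hF) ν fun A hA hc => ?_).trans (measure_mono inter_subset_right)
    exact hν A (hA.trans inter_subset_left) hc
  have : IsFiniteMeasure (volume.bind (kap K)) := ⟨(hcl _ isClosed_univ).trans_lt (measure_lt_top ν _)⟩
  refine ⟨volume.bind (kap K), ?_, hfin, fun B hB => ⟨?_, happ B hB⟩⟩
  · intro B hB
    rw [hB.measure_eq_iSup_isClosed_of_ne_top (measure_ne_top _ _)]
    exact iSup₂_le fun F hF => iSup_le fun hc => (hcl F hc).trans (measure_mono hF)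
  · exact ⟨_, (Measure.measurable_coe hB).comp hm, (hae B hB).symm⟩

/-! ### one-dimensional telescoping -/

def jr (X : Set ℝ) (u : ℝ) : Prop := ∀ᶠ n : ℕ in atTop, u + 1 / ((n:ℝ) + 1) ∈ X
def jl (X : Set ℝ) (u : ℝ) : Prop := ∀ᶠ n : ℕ in atTop, u - 1 / ((n:ℝ) + 1) ∈ X

def LC (S X : Set ℝ) : Prop := ∀ u ∉ S, (∀ᶠ v in 𝓝 u, v ∈ X) ∨ (∀ᶠ v in 𝓝 u, v ∉ X)

lemma LC.const {S X : Set ℝ} (h : LC S X) {p q : ℝ} (hpq : p ≤ q)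
    (hS : ∀ u ∈ Icc p q, u ∉ S) : p ∈ X ↔ q ∈ X := by
  refine (isPreconnected_Icc (a := p) (b := q)).induction₂ (fun a b => a ∈ X ↔ b ∈ X) ?_ ?_ ?_
    (left_mem_Icc.mpr hpq) (right_mem_Icc.mpr hpq)
  · intro u hu
    apply mem_nhdsWithin_of_mem_nhds
    rcases h u (hS u hu) with h1 | h1
    · filter_upwards [h1] with v hv
      simp [hv, h1.self_of_nhds]
    · filter_upwards [h1] with v hv
      simp [hv, h1.self_of_nhds]
  · intro a b c _ _ _ h1 h2; exact h1.trans h2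
  · intro a b _ _ h1; exact h1.symm

lemma LC.jr_iff {S X : Set ℝ} (h : LC S X) {u q : ℝ} (hq : u < q)
    (hS : ∀ v ∈ Ioc u q, v ∉ S) : jr X u ↔ q ∈ X := by
  have key : ∀ᶠ n : ℕ in atTop, (u + 1 / ((n:ℝ) + 1) ∈ X ↔ q ∈ X) := by
    have h1 : ∀ᶠ n : ℕ in atTop, 1 / ((n:ℝ) + 1) < q - u :=
      (tendsto_one_div_add_atTop_nhds_zero_nat (𝕜 := ℝ)).eventually_lt_const (by linarith)
    filter_upwards [h1] with n hn
    have : 0 < 1 / ((n:ℝ) + 1) := by positivity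
    apply h.const (by linarith)
    intro v hv
    exact hS v ⟨by linarith [hv.1], hv.2⟩
  unfold jr
  rw [eventually_congr key, eventually_const]

lemma LC.jl_iff {S X : Set ℝ} (h : LC S X) {u p : ℝ} (hq : p < u)
    (hS : ∀ v ∈ Ico p u, v ∉ S) : jl X u ↔ p ∈ X := by
  have key : ∀ᶠ n : ℕ in atTop, (u - 1 / ((n:ℝ) + 1) ∈ X ↔ p ∈ X) := by
    have h1 : ∀ᶠ n : ℕ in atTop, 1 / ((n:ℝ) + 1) < u - p :=
      (tendsto_one_div_add_atTop_nhds_zero_nat (𝕜 := ℝ)).eventually_lt_const (by linarith)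
    filter_upwards [h1] with n hn
    have : 0 < 1 / ((n:ℝ) + 1) := by positivity
    symm
    apply h.const (by linarith)
    intro v hv
    exact hS v ⟨hv.1, by linarith [hv.2]⟩
  unfold jl
  rw [eventually_congr key, eventually_const]

lemma exists_gap_right {S : Set ℝ} (hS : S.Finite) (u : ℝ) {b : ℝ} (hb : u < b) :
    ∃ q, u < q ∧ q < b ∧ ∀ v ∈ Ioc u q, v ∉ S := by
  have h1 : ∀ᶠ v in 𝓝[>] u, v ∉ S := by
    have : (S \ {u})ᶜ ∈ 𝓝 u := (hS.subset sdiff_subset).isClosed.isOpen_compl.mem_nhds (by simp)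
    filter_upwards [mem_nhdsWithin_of_mem_nhds this, self_mem_nhdsWithin] with v hv hv2 hvS
    exact hv ⟨hvS, ne_of_gt hv2⟩
  obtain ⟨q, hq, hq2⟩ := (mem_nhdsGT_iff_exists_Ioc_subset).mp h1
  obtain ⟨r, hr⟩ := exists_between (lt_min hq hb)
  exact ⟨r, hr.1, hr.2.trans_le (min_le_right _ _), fun v hv => hq2 ⟨hv.1, hv.2.trans (hr.2.le.trans (min_le_left _ _))⟩⟩

lemma exists_gap_left {S : Set ℝ} (hS : S.Finite) (u : ℝ) {a : ℝ} (ha : a < u) :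
    ∃ p, a < p ∧ p < u ∧ ∀ v ∈ Ico p u, v ∉ S := by
  have h1 : ∀ᶠ v in 𝓝[<] u, v ∉ S := by
    have : (S \ {u})ᶜ ∈ 𝓝 u := (hS.subset sdiff_subset).isClosed.isOpen_compl.mem_nhds (by simp)
    filter_upwards [mem_nhdsWithin_of_mem_nhds this, self_mem_nhdsWithin] with v hv hv2 hvS
    exact hv ⟨hvS, ne_of_lt hv2⟩
  obtain ⟨q, hq, hq2⟩ := (mem_nhdsLT_iff_exists_Ico_subset).mp h1
  obtain ⟨r, hr⟩ := exists_between (max_lt hq ha)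
  exact ⟨r, (le_max_right _ _).trans_lt hr.1, hr.2, fun v hv => hq2 ⟨(le_max_left _ _).trans (hr.1.le.trans hv.1), hv.2⟩⟩

open Classical in
lemma LC.tele_aux {S X : Set ℝ} (h : LC S X) (hS : S.Finite) (p : ℝ) (hp : p ∉ S) :
    ∀ (n : ℕ) (q : ℝ), p < q → q ∉ S → (hS.toFinset.filter fun u => p < u ∧ u < q).card = n →
      ((hS.toFinset.filter fun u => p < u ∧ u < q).filter (jr X)).card + (if p ∈ X then 1 else 0) =
      ((hS.toFinset.filter fun u => p < u ∧ u < q).filter (jl X)).card + (if q ∈ X then 1 else 0) := by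
  intro n
  induction n with
  | zero =>
    intro q hpq hq hc
    rw [Finset.card_eq_zero] at hc
    rw [hc]
    have : p ∈ X ↔ q ∈ X := by
      apply h.const hpq.le
      intro u hu hus
      rcases eq_or_lt_of_le hu.1 with h1 | h1
      · exact hp (h1 ▸ hus)
      rcases eq_or_lt_of_le hu.2 with h2 | h2
      · exact hq (h2 ▸ hus)
      have : u ∈ (hS.toFinset.filter fun u => p < u ∧ u < q) := by simp [hus, h1, h2]
      rw [hc] at this; simp at this
    simp [this]
  | succ n ih =>
    intro q hpq hq hc
    set F := hS.toFinset.filter fun u => p < u ∧ u < q with hF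
    have hne : F.Nonempty := by rw [← Finset.card_pos]; omega
    set u := F.max' hne with hu
    have huF : u ∈ F := F.max'_mem hne
    have huF2 := huF
    rw [hF, Finset.mem_filter] at huF2
    obtain ⟨p', hp1, hp2, hp3⟩ := exists_gap_left hS u huF2.2.1
    have hF' : F = insert u (hS.toFinset.filter fun u => p < u ∧ u < p') := by
      ext v
      simp only [Finset.mem_insert]
      constructor
      · intro hv
        have hv2 := hv
        rw [hF, Finset.mem_filter] at hv2
        rcases eq_or_lt_of_le (F.le_max' v hv) with h1 | h1
        · left; exact h1
        · right
          rw [Finset.mem_filter]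
          refine ⟨hv2.1, hv2.2.1, ?_⟩
          by_contra h2
          exact hp3 v ⟨not_lt.mp h2, h1⟩ (by simpa using hv2.1)
      · rintro (rfl | hv)
        · exact huF
        · rw [Finset.mem_filter] at hv
          rw [hF, Finset.mem_filter]
          exact ⟨hv.1, hv.2.1, by linarith [huF2.2.2, hv.2.2]⟩
    have hnot : u ∉ (hS.toFinset.filter fun u => p < u ∧ u < p') := by
      simp only [Finset.mem_filter, not_and, not_lt]; intro _ _; exact hp2.le
    have hp'S : p' ∉ S := hp3 p' ⟨le_rfl, hp2⟩
    have hcard : (hS.toFinset.filter fun u => p < u ∧ u < p').card = n := by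
      rw [hF', Finset.card_insert_of_notMem hnot] at hc; omega
    have ih' := ih p' hp1 hp'S hcard
    have e1 : jl X u ↔ p' ∈ X := h.jl_iff hp2 hp3
    have e2 : jr X u ↔ q ∈ X := by
      apply h.jr_iff huF2.2.2
      intro v hv hvS
      rcases eq_or_lt_of_le hv.2 with h2 | h2
      · exact hq (h2 ▸ hvS)
      have : v ∈ F := by
        rw [hF, Finset.mem_filter]; exact ⟨by simpa using hvS, huF2.2.1.trans hv.1, h2⟩
      exact absurd (F.le_max' v this) (not_le.mpr hv.1)
    rw [hF', Finset.filter_insert, Finset.filter_insert]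
    have n1 : u ∉ (hS.toFinset.filter fun u => p < u ∧ u < p').filter (jr X) := fun hh => hnot (Finset.mem_filter.mp hh).1
    have n2 : u ∉ (hS.toFinset.filter fun u => p < u ∧ u < p').filter (jl X) := fun hh => hnot (Finset.mem_filter.mp hh).1
    by_cases c1 : p' ∈ X <;> by_cases c2 : q ∈ X <;> 
      simp only [e1, e2, c1, c2, if_true, if_false, Finset.card_insert_of_notMem n1, Finset.card_insert_of_notMem n2] at ih' ⊢ <;> omega

open Classical in
/-- indicator of a proposition -/
noncomputable def ind (p : Prop) : ENNReal := if p then 1 else 0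

lemma LC.tele {S X : Set ℝ} (h : LC S X) (hS : S.Finite) {p q : ℝ} (hpq : p < q) (hp : p ∉ S) (hq : q ∉ S) :
    cnt {u | u ∈ S ∧ (p < u ∧ u < q) ∧ jr X u} + ind (p ∈ X) =
    cnt {u | u ∈ S ∧ (p < u ∧ u < q) ∧ jl X u} + ind (q ∈ X) := by
  classical
  have := h.tele_aux hS p hp _ q hpq hq rfl
  have e : ∀ P : ℝ → Prop, cnt {u | u ∈ S ∧ (p < u ∧ u < q) ∧ P u} = 
      (((hS.toFinset.filter fun u => p < u ∧ u < q).filter P).card : ENNReal) := by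
    intro P
    unfold cnt
    have : {u | u ∈ S ∧ (p < u ∧ u < q) ∧ P u} = (((hS.toFinset.filter fun u => p < u ∧ u < q).filter P : Finset ℝ) : Set ℝ) := by
      ext u; simp [and_assoc]
    rw [this, Set.encard_coe_eq_coe_finsetCard]; simp
  rw [e, e]
  unfold ind
  have h2 := congrArg (fun n : ℕ => (n : ENNReal)) this
  push_cast at h2
  convert h2 using 2

lemma LC.tele_low {S X : Set ℝ} (h : LC S X) (hS : S.Finite) (hX : ∃ m, ∀ u < m, u ∉ X)
    {q : ℝ} (hq : q ∉ S) :
    cnt {u | u ∈ S ∧ u < q ∧ jr X u} = cnt {u | u ∈ S ∧ u < q ∧ jl X u} + ind (q ∈ X) := by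
  obtain ⟨m, hm⟩ := hX
  obtain ⟨b, hb⟩ := hS.bddBelow
  set p := min (min m b) q - 1 with hp
  have h1 : p < m := by have := min_le_left (min m b) q; have := min_le_left m b; linarith
  have h2 : p < b := by have := min_le_left (min m b) q; have := min_le_right m b; linarith
  have h3 : p < q := by have := min_le_right (min m b) q; linarith
  have := h.tele hS h3 (fun hh => absurd (hb hh) (by linarith)) hq
  have e : ∀ P : ℝ → Prop, {u | u ∈ S ∧ (p < u ∧ u < q) ∧ P u} = {u | u ∈ S ∧ u < q ∧ P u} := by
    intro P; ext u
    constructor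
    · rintro ⟨a, b, c⟩; exact ⟨a, b.2, c⟩
    · rintro ⟨a, b, c⟩; exact ⟨a, ⟨lt_of_lt_of_le h2 (hb a), b⟩, c⟩
  rw [e, e] at this
  rw [← this, ind, if_neg (hm p h1), add_zero]

lemma LC.tele_high {S X : Set ℝ} (h : LC S X) (hS : S.Finite) (hX : ∃ m, ∀ u, m < u → u ∉ X)
    {p : ℝ} (hp : p ∉ S) :
    cnt {u | u ∈ S ∧ p < u ∧ jr X u} + ind (p ∈ X) = cnt {u | u ∈ S ∧ p < u ∧ jl X u} := by
  obtain ⟨m, hm⟩ := hX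
  obtain ⟨b, hb⟩ := hS.bddAbove
  set q := max (max m b) p + 1 with hq
  have h1 : m < q := by have := le_max_left (max m b) p; have := le_max_left m b; linarith
  have h2 : b < q := by have := le_max_left (max m b) p; have := le_max_right m b; linarith
  have h3 : p < q := by have := le_max_right (max m b) p; linarith
  have := h.tele hS h3 hp (fun hh => absurd (hb hh) (by linarith))
  have e : ∀ P : ℝ → Prop, {u | u ∈ S ∧ (p < u ∧ u < q) ∧ P u} = {u | u ∈ S ∧ p < u ∧ P u} := by
    intro P; ext u
    constructor
    · rintro ⟨a, b, c⟩; exact ⟨a, b.1, c⟩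
    · rintro ⟨a, b, c⟩; exact ⟨a, ⟨b, lt_of_le_of_lt (hb a) h2⟩, c⟩
  rw [e, e] at this
  rw [this, ind, if_neg (hm q h1), add_zero]

def pt (k : Fin 3) (c u : ℝ) : ℝ × ℝ := ![(c, u), (1 - c - u, c), (u, 1 - c - u)] k
def pd (c u : ℝ) : ℝ × ℝ := (u, u + c)
def ed (k : Fin 3) : ℝ × ℝ := ![(0, 1), (-1, 0), (1, -1)] k
def ed3 : ℝ × ℝ := (1, 1)
def JR (e : ℝ × ℝ) (G : Set (ℝ × ℝ)) : Set (ℝ × ℝ) :=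
  {z | ∀ᶠ n : ℕ in atTop, z + (1 / ((n:ℝ) + 1)) • e ∈ G}
def JL (e : ℝ × ℝ) (G : Set (ℝ × ℝ)) : Set (ℝ × ℝ) :=
  {z | ∀ᶠ n : ℕ in atTop, z - (1 / ((n:ℝ) + 1)) • e ∈ G}

lemma measurableSet_JR (e : ℝ × ℝ) {G : Set (ℝ × ℝ)} (hG : MeasurableSet G) : MeasurableSet (JR e G) := by
  have : JR e G = ⋃ N : ℕ, ⋂ n : ℕ, ⋂ _ : N ≤ n, (fun z => z + (1 / ((n:ℝ) + 1)) • e) ⁻¹' G := by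
    ext z; simp [JR, eventually_atTop]
  rw [this]
  exact MeasurableSet.iUnion fun N => MeasurableSet.iInter fun n => MeasurableSet.iInter fun _ =>
    (measurable_add_const _) hG

lemma measurableSet_JL (e : ℝ × ℝ) {G : Set (ℝ × ℝ)} (hG : MeasurableSet G) : MeasurableSet (JL e G) := by
  have : JL e G = ⋃ N : ℕ, ⋂ n : ℕ, ⋂ _ : N ≤ n, (fun z => z - (1 / ((n:ℝ) + 1)) • e) ⁻¹' G := by
    ext z; simp [JL, eventually_atTop]
  rw [this]
  exact MeasurableSet.iUnion fun N => MeasurableSet.iInter fun n => MeasurableSet.iInter fun _ =>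
    (measurable_sub_const _) hG

structure IsDir (L : ℝ → ℝ → ℝ × ℝ) (e : ℝ × ℝ) : Prop where
  lin : ∀ c u s, L c (u + s) = L c u + s • e
  cont : ∀ c, Continuous (L c)

lemma isDir_pt (k : Fin 3) : IsDir (pt k) (ed k) := by
  constructor
  · intro c u s; fin_cases k <;> simp [pt, ed] <;> ring
  · intro c; fin_cases k
    · exact (by fun_prop : Continuous fun u : ℝ => (c, u))
    · exact (by fun_prop : Continuous fun u : ℝ => (1 - c - u, c))
    · exact (by fun_prop : Continuous fun u : ℝ => (u, 1 - c - u))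

lemma isDir_pd : IsDir pd ed3 := by
  constructor
  · intro c u s; simp [pd, ed3]; ring
  · intro c; unfold pd; fun_prop

lemma IsDir.JR_iff {L e} (h : IsDir L e) (c u : ℝ) (G : Set (ℝ × ℝ)) :
    L c u ∈ JR e G ↔ jr {v | L c v ∈ G} u := by
  simp [JR, jr, h.lin]

lemma IsDir.JL_iff {L e} (h : IsDir L e) (c u : ℝ) (G : Set (ℝ × ℝ)) :
    L c u ∈ JL e G ↔ jl {v | L c v ∈ G} u := by
  have : ∀ s, L c (u - s) = L c u - s • e := by
    intro s; rw [sub_eq_add_neg, h.lin]; simp [sub_eq_add_neg]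
  simp only [JL, jl, mem_ofPred_eq, this]

structure SliceM (L : ℝ → ℝ → ℝ × ℝ) (K : Set (ℝ × ℝ)) (M : Measure (ℝ × ℝ)) : Prop where
  fin : IsFiniteMeasure M
  ae_fin : ∀ᵐ c, {u | L c u ∈ K}.Finite
  meas : ∀ B, MeasurableSet B → AEMeasurable (fun c => cnt {u | L c u ∈ K ∩ B})
  app : ∀ B, MeasurableSet B → M B = ∫⁻ c, cnt {u | L c u ∈ K ∩ B}

lemma lc_line {L e} (h : IsDir L e) {K G : Set (ℝ × ℝ)} (hG : IsOpen G) (hf : frontier G ⊆ K) (c : ℝ) :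
    LC {u | L c u ∈ K} {u | L c u ∈ G} := by
  intro u hu
  by_cases h1 : L c u ∈ G
  · left
    exact (h.cont c).continuousAt (hG.mem_nhds h1)
  · right
    have h2 : L c u ∉ closure G := by
      intro h3
      apply hu; apply hf
      rw [frontier, hG.interior_eq]; exact ⟨h3, h1⟩
    have : (closure G)ᶜ ∈ 𝓝 (L c u) := isClosed_closure.isOpen_compl.mem_nhds h2
    filter_upwards [(h.cont c).continuousAt this] with v hv hv2
    exact hv (subset_closure hv2)

lemma SliceM.integ {L e K M} (h : IsDir L e) (hM : SliceM L K M) {G Q : Set (ℝ × ℝ)} (hG : IsOpen G)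
    (hQ : MeasurableSet Q) (α β : ℝ → ENNReal) (hα : Measurable α) (hβ : Measurable β)
    (hc : ∀ᵐ c, cnt {u | L c u ∈ K ∧ L c u ∈ Q ∧ jr {v | L c v ∈ G} u} + α c =
      cnt {u | L c u ∈ K ∧ L c u ∈ Q ∧ jl {v | L c v ∈ G} u} + β c) :
    M (Q ∩ JR e G) + ∫⁻ c, α c = M (Q ∩ JL e G) + ∫⁻ c, β c := by
  rw [hM.app _ (hQ.inter (measurableSet_JR e hG.measurableSet)),
    hM.app _ (hQ.inter (measurableSet_JL e hG.measurableSet)), ← lintegral_add_right _ hα,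
    ← lintegral_add_right _ hβ]
  apply lintegral_congr_ae
  filter_upwards [hc] with c hc
  have e1 : {u | L c u ∈ K ∩ (Q ∩ JR e G)} = {u | L c u ∈ K ∧ L c u ∈ Q ∧ jr {v | L c v ∈ G} u} := by
    ext u; simp [h.JR_iff]
  have e2 : {u | L c u ∈ K ∩ (Q ∩ JL e G)} = {u | L c u ∈ K ∧ L c u ∈ Q ∧ jl {v | L c v ∈ G} u} := by
    ext u; simp [h.JL_iff]
  rw [e1, e2, hc]

lemma cnt_empty : cnt ∅ = 0 := by simp [cnt]

lemma ind_eq_indicator (S : Set ℝ) (c : ℝ) : ind (c ∈ S) = S.indicator (fun _ => 1) c := by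
  simp [ind, indicator]

lemma measurable_ind {S : Set ℝ} (hS : MeasurableSet S) : Measurable fun c => ind (c ∈ S) := by
  simp_rw [ind_eq_indicator]; exact measurable_const.indicator hS

lemma lintegral_ind {S : Set ℝ} (hS : MeasurableSet S) : ∫⁻ c, ind (c ∈ S) = volume S := by
  simp_rw [ind_eq_indicator]; rw [lintegral_indicator hS]; simp

lemma vol_sub_preimage (S : Set ℝ) (a : ℝ) : volume ((fun c => a - c) ⁻¹' S) = volume S :=
  MeasurePreserving.measure_preimage_equiv (f := MeasurableEquiv.subLeft a)
    (Measure.measurePreserving_sub_left volume a) S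

def quad (a b : ℝ) : Set (ℝ × ℝ) := Iio a ×ˢ Iio b
def Hs (G : Set (ℝ × ℝ)) (a b : ℝ) : Set ℝ := {x | x < a ∧ (x, b) ∈ G}
def Vs (G : Set (ℝ × ℝ)) (a b : ℝ) : Set ℝ := {y | y < b ∧ (a, y) ∈ G}

lemma measurableSet_Hs {G : Set (ℝ × ℝ)} (hG : IsOpen G) (a b) : MeasurableSet (Hs G a b) :=
  (measurableSet_Iio).inter ((hG.preimage (by fun_prop : Continuous fun x : ℝ => (x, b))).measurableSet)
lemma measurableSet_Vs {G : Set (ℝ × ℝ)} (hG : IsOpen G) (a b) : MeasurableSet (Vs G a b) :=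
  (measurableSet_Iio).inter ((hG.preimage (by fun_prop : Continuous fun x : ℝ => (a, x))).measurableSet)
lemma measurableSet_quad (a b) : MeasurableSet (quad a b) := measurableSet_Iio.prod measurableSet_Iio

section GG
variable {K G : Set (ℝ × ℝ)} {M : Fin 3 → Measure (ℝ × ℝ)} {M3 : Measure (ℝ × ℝ)} {R a b : ℝ}

lemma ae_notMem_finite {S : Set ℝ} (hS : S.Finite) : ∀ᵐ c, c ∉ S :=
  measure_eq_zero_iff_ae_notMem.mp (hS.measure_zero volume)

lemma gg0 (hM : SliceM (pt 0) K (M 0)) (hG : IsOpen G) (hf : frontier G ⊆ K)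
    (hR : ∀ z ∈ G, |z.1| ≤ R ∧ |z.2| ≤ R) (hb : {x | (x, b) ∈ K}.Finite) :
    M 0 (quad a b ∩ JR (ed 0) G) = M 0 (quad a b ∩ JL (ed 0) G) + volume (Hs G a b) := by
  have := hM.integ (isDir_pt 0) hG (measurableSet_quad a b) (fun _ => 0) (fun c => ind (c ∈ Hs G a b))
    measurable_const (measurable_ind (measurableSet_Hs hG a b)) ?_
  · rw [lintegral_ind (measurableSet_Hs hG a b)] at this
    simpa using this
  filter_upwards [hM.ae_fin, ae_notMem_finite hb] with c hc hcb
  by_cases hca : c < a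
  · have := (lc_line (isDir_pt 0) hG hf c).tele_low hc ⟨-R, fun u hu hu2 => by
      have := (abs_le.mp (hR _ hu2).2).1; simp [pt] at this; linarith⟩ (q := b) (by simpa [pt] using hcb)
    simpa [pt, quad, hca, Hs] using this
  · simp [pt, quad, hca, Hs, ind, cnt_empty]

lemma gg1 (hM : SliceM (pt 1) K (M 1)) (hG : IsOpen G) (hf : frontier G ⊆ K)
    (hR : ∀ z ∈ G, |z.1| ≤ R ∧ |z.2| ≤ R) (ha : {y | (a, y) ∈ K}.Finite) :
    M 1 (quad a b ∩ JR (ed 1) G) + volume (Vs G a b) = M 1 (quad a b ∩ JL (ed 1) G) := by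
  have := hM.integ (isDir_pt 1) hG (measurableSet_quad a b) (fun c => ind (c ∈ Vs G a b)) (fun _ => 0)
    (measurable_ind (measurableSet_Vs hG a b)) measurable_const ?_
  · rw [lintegral_ind (measurableSet_Vs hG a b)] at this
    simpa using this
  filter_upwards [hM.ae_fin, ae_notMem_finite ha] with c hc hca
  by_cases hcb : c < b
  · have := (lc_line (isDir_pt 1) hG hf c).tele_high hc ⟨R + 1 - c, fun u hu hu2 => by
      have := (abs_le.mp (hR _ hu2).1).1; simp [pt] at this; linarith⟩ (p := 1 - c - a)
        (by simpa [pt] using hca)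
    have e : ∀ u : ℝ, (1 - c - a < u) ↔ (1 - c - u < a) := fun u => by constructor <;> intro h <;> linarith
    simpa [pt, quad, hcb, Vs, e] using this
  · simp [pt, quad, hcb, Vs, ind, cnt_empty]

lemma gg2 (hM : SliceM (pt 2) K (M 2)) (hG : IsOpen G) (hf : frontier G ⊆ K)
    (ha : {y | (a, y) ∈ K}.Finite) (hb : {x | (x, b) ∈ K}.Finite) :
    M 2 (quad a b ∩ JR (ed 2) G) + volume (Hs G a b) =
      M 2 (quad a b ∩ JL (ed 2) G) + volume (Vs G a b) := by
  have hm1 : MeasurableSet ((fun c => (1 - b) - c) ⁻¹' Hs G a b) :=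
    (measurable_const.sub measurable_id) (measurableSet_Hs hG a b)
  have hm2 : MeasurableSet ((fun c => (1 - a) - c) ⁻¹' Vs G a b) :=
    (measurable_const.sub measurable_id) (measurableSet_Vs hG a b)
  have := hM.integ (isDir_pt 2) hG (measurableSet_quad a b)
    (fun c => ind (c ∈ (fun c => (1 - b) - c) ⁻¹' Hs G a b))
    (fun c => ind (c ∈ (fun c => (1 - a) - c) ⁻¹' Vs G a b)) (measurable_ind hm1) (measurable_ind hm2) ?_
  · rwa [lintegral_ind hm1, lintegral_ind hm2, vol_sub_preimage, vol_sub_preimage] at this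
  have ha' : ((fun c => (1 - a) - c) ⁻¹' {y | (a, y) ∈ K}).Finite :=
    ha.preimage (fun x _ y _ h => by simpa using h)
  have hb' : ((fun c => (1 - b) - c) ⁻¹' {y | (y, b) ∈ K}).Finite :=
    hb.preimage (fun x _ y _ h => by simpa using h)
  filter_upwards [hM.ae_fin, ae_notMem_finite ha', ae_notMem_finite hb'] with c hc hca hcb
  have e1 : 1 - b - c = 1 - c - b := by ring
  have e2 : 1 - a - c = 1 - c - a := by ring
  simp only [mem_preimage, e1, e2, mem_ofPred_eq] at hca hcb ⊢
  by_cases h : 1 - c - b < a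
  · have := (lc_line (isDir_pt 2) hG hf c).tele hc h (by simpa [pt] using hcb) (by simpa [pt] using hca)
    have h' : 1 - c - a < b := by linarith
    have e : ∀ u : ℝ, (1 - c - b < u) ↔ (1 - c - u < b) := fun u => by constructor <;> intro h <;> linarith
    simpa [pt, quad, Vs, Hs, e, h, h', and_comm, and_left_comm, and_assoc] using this
  · have h' : ¬ (1 - c - a < b) := by intro h2; apply h; linarith
    have e : ∀ u : ℝ, ¬ (u < a ∧ 1 - c - u < b) := fun u h2 => by apply h; linarith [h2.1, h2.2]
    simp [pt, quad, Vs, Hs, e, h, h', ind]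

lemma gg3 (hM : SliceM pd K M3) (hG : IsOpen G) (hf : frontier G ⊆ K)
    (hR : ∀ z ∈ G, |z.1| ≤ R ∧ |z.2| ≤ R)
    (ha : {y | (a, y) ∈ K}.Finite) (hb : {x | (x, b) ∈ K}.Finite) :
    M3 (quad a b ∩ JR ed3 G) =
      M3 (quad a b ∩ JL ed3 G) + (volume (Hs G a b) + volume (Vs G a b)) := by
  have hm1 : MeasurableSet ((fun c => b - c) ⁻¹' Hs G a b) :=
    (measurable_const.sub measurable_id) (measurableSet_Hs hG a b)
  have hm2 : MeasurableSet ((fun c => a + c) ⁻¹' Vs G a b) :=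
    (measurable_const.add measurable_id) (measurableSet_Vs hG a b)
  have := hM.integ isDir_pd hG (measurableSet_quad a b) (fun c => 0)
    (fun c => ind (c ∈ (fun c => b - c) ⁻¹' Hs G a b) + ind (c ∈ (fun c => a + c) ⁻¹' Vs G a b))
     measurable_const ((measurable_ind hm1).add (measurable_ind hm2)) ?_
  · rw [lintegral_add_right _ (measurable_ind hm2), lintegral_ind hm1, lintegral_ind hm2, vol_sub_preimage,
      measure_preimage_add] at this
    simpa using this
  have ha' : ((fun c => a + c) ⁻¹' {y | (a, y) ∈ K}).Finite :=
    ha.preimage (fun x _ y _ h => by simpa using h)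
  have hb' : ((fun c => b - c) ⁻¹' {y | (y, b) ∈ K}).Finite :=
    hb.preimage (fun x _ y _ h => by simpa using h)
  filter_upwards [hM.ae_fin, ae_notMem_finite ha', ae_notMem_finite hb',
    ae_notMem_finite (finite_singleton (b - a))] with c hc hca hcb hne
  simp only [mem_preimage, mem_ofPred_eq] at hca hcb ⊢
  have hl : ∃ m, ∀ u < m, u ∉ {u | pd c u ∈ G} := ⟨-R, fun u hu hu2 => by
      have := (abs_le.mp (hR _ hu2).1).1; simp [pd] at this; linarith⟩
  rcases lt_trichotomy (b - c) a with h | h | h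
  · have := (lc_line isDir_pd hG hf c).tele_low hc hl (q := b - c) (by simpa [pd] using hcb)
    have h' : ¬ (a + c < b) := by linarith
    have e : ∀ u : ℝ, (u < b - c) ↔ (u < a ∧ u + c < b) := fun u => by
      constructor
      · intro h; constructor <;> linarith
      · intro h; linarith
    have ez : ind False = 0 := by simp [ind]
    simpa [pd, quad, Vs, Hs, e, h, h', ez] using this
  · exact absurd (by simp; linarith) hne
  · have := (lc_line isDir_pd hG hf c).tele_low hc hl (q := a) (by simpa [pd] using hca)
    have h' : a + c < b := by linarith
    have h'' : ¬ (b - c < a) := by linarith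
    have e : ∀ u : ℝ, (u < a) ↔ (u < a ∧ u + c < b) := fun u => by
      constructor
      · intro h; constructor <;> linarith
      · intro h; linarith
    have ez : ind False = 0 := by simp [ind]
    have e3 : ∀ P : ℝ → Prop, {u | pd c u ∈ K ∧ pd c u ∈ quad a b ∧ P u} = {u | pd c u ∈ K ∧ u < a ∧ P u} := by
      intro P; ext u; simp only [mem_ofPred_eq]; rw [e u]; simp [pd, quad]
    rw [e3, e3]
    simpa [pd, Vs, Hs, h, h', h'', ez] using this

lemma ext_quad (μ ν : Measure (ℝ × ℝ)) [IsFiniteMeasure μ] [IsFiniteMeasure ν] {Ga Gb : Set ℝ}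
    (hGa : ∀ᵐ a, a ∈ Ga) (hGb : ∀ᵐ b, b ∈ Gb)
    (h : ∀ a ∈ Ga, ∀ b ∈ Gb, μ (quad a b) = ν (quad a b)) : μ = ν := by
  have hda : Dense Ga := Measure.dense_of_ae hGa
  have hdb : Dense Gb := Measure.dense_of_ae hGb
  have seqa : ∀ a : ℝ, ∃ s : ℕ → ℝ, Monotone s ∧ (∀ n, s n ∈ Ga) ∧ Iio a = ⋃ n, Iio (s n) := by
    intro a
    obtain ⟨s, h1, h2, h3⟩ := hda.exists_seq_strictMono_tendsto a
    refine ⟨s, h1.monotone, fun n => (h2 n).2, ?_⟩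
    ext x
    simp only [mem_Iio, mem_iUnion]
    constructor
    · intro hx
      exact ((h3.eventually_const_lt hx)).exists
    · rintro ⟨n, hn⟩; exact hn.trans (h2 n).1
  have seqb : ∀ a : ℝ, ∃ s : ℕ → ℝ, Monotone s ∧ (∀ n, s n ∈ Gb) ∧ Iio a = ⋃ n, Iio (s n) := by
    intro a
    obtain ⟨s, h1, h2, h3⟩ := hdb.exists_seq_strictMono_tendsto a
    refine ⟨s, h1.monotone, fun n => (h2 n).2, ?_⟩
    ext x
    simp only [mem_Iio, mem_iUnion]
    constructor
    · intro hx
      exact ((h3.eventually_const_lt hx)).exists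
    · rintro ⟨n, hn⟩; exact hn.trans (h2 n).1
  have hall : ∀ a b, μ (quad a b) = ν (quad a b) := by
    intro a b
    obtain ⟨s, s1, s2, s3⟩ := seqa a
    obtain ⟨t, t1, t2, t3⟩ := seqb b
    have : quad a b = ⋃ n, quad (s n) (t n) := by
      unfold quad
      rw [s3, t3]
      ext ⟨x, y⟩
      simp only [mem_prod, mem_iUnion, mem_Iio]
      constructor
      · rintro ⟨⟨i, hi⟩, ⟨j, hj⟩⟩
        exact ⟨max i j, hi.trans_le (s1 (le_max_left _ _)), hj.trans_le (t1 (le_max_right _ _))⟩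
      · rintro ⟨i, h1, h2⟩; exact ⟨⟨i, h1⟩, ⟨i, h2⟩⟩
    have hm : Monotone fun n => quad (s n) (t n) := fun i j hij =>
      prod_mono (Iio_subset_Iio (s1 hij)) (Iio_subset_Iio (t1 hij))
    rw [this, hm.measure_iUnion, hm.measure_iUnion]
    congr 1; ext n; exact h _ (s2 n) _ (t2 n)
  have huniv : μ univ = ν univ := by
    have : (univ : Set (ℝ × ℝ)) = ⋃ n : ℕ, quad n n := by
      ext ⟨x, y⟩
      simp only [mem_univ, quad, mem_iUnion, mem_prod, mem_Iio, true_iff]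
      obtain ⟨n, hn⟩ := exists_nat_gt (max x y)
      exact ⟨n, (le_max_left _ _).trans_lt hn, (le_max_right _ _).trans_lt hn⟩
    have hm : Monotone fun n : ℕ => quad n n := fun i j hij => by
      have : (i:ℝ) ≤ j := by exact_mod_cast hij
      exact prod_mono (Iio_subset_Iio this) (Iio_subset_Iio this)
    rw [this, hm.measure_iUnion, hm.measure_iUnion]
    congr 1; ext n; exact hall _ _
  refine ext_of_generate_finite (image2 (· ×ˢ ·) (range Iio) (range Iio)) ?_
    ((isPiSystem_Iio).prod isPiSystem_Iio) ?_ huniv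
  · have hb : MeasurableSpace.generateFrom (range (Iio : ℝ → Set ℝ)) = Real.measurableSpace := by
      rw [← borel_eq_generateFrom_Iio]; exact BorelSpace.measurable_eq.symm
    have hs : IsCountablySpanning (range (Iio : ℝ → Set ℝ)) := by
      refine ⟨fun n => Iio (n:ℝ), fun n => ⟨_, rfl⟩, ?_⟩
      ext x
      simp only [mem_iUnion, mem_Iio, mem_univ, iff_true]
      exact exists_nat_gt x
    exact (generateFrom_eq_prod hb hb hs hs).symm
  · rintro _ ⟨_, ⟨a, rfl⟩, _, ⟨b, rfl⟩, rfl⟩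
    exact hall a b

theorem gauss_green (hM : ∀ k, SliceM (pt k) K (M k)) (hG : IsOpen G) (hf : frontier G ⊆ K)
    (hR : ∀ z ∈ G, |z.1| ≤ R ∧ |z.2| ≤ R) (B : Set (ℝ × ℝ)) (hB : MeasurableSet B) :
    M 0 (B ∩ JR (ed 0) G) + M 1 (B ∩ JR (ed 1) G) + M 2 (B ∩ JR (ed 2) G) =
    M 0 (B ∩ JL (ed 0) G) + M 1 (B ∩ JL (ed 1) G) + M 2 (B ∩ JL (ed 2) G) := by
  have := fun k => (hM k).fin
  have hbd : Bornology.IsBounded G := by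
    refine (Metric.isBounded_iff_subset_closedBall 0).mpr ⟨R, fun z hz => ?_⟩
    simp [Prod.norm_def]; exact hR z hz
  have key : (M 0).restrict (JR (ed 0) G) + (M 1).restrict (JR (ed 1) G) + (M 2).restrict (JR (ed 2) G) =
     (M 0).restrict (JL (ed 0) G) + (M 1).restrict (JL (ed 1) G) + (M 2).restrict (JL (ed 2) G) := by
    refine ext_quad _ _ (Ga := {a | {y | (a, y) ∈ K}.Finite}) (Gb := {b | {x | (x, b) ∈ K}.Finite}) ?_ ?_ ?_
    · filter_upwards [(hM 0).ae_fin] with c hc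
      simpa [pt] using hc
    · filter_upwards [(hM 1).ae_fin] with c hc
      simp only [pt] at hc
      have : {x | (x, c) ∈ K} = (fun u => 1 - c - u) '' {u | (1 - c - u, c) ∈ K} := by
        ext x; simp only [mem_ofPred_eq, mem_image]
        constructor
        · intro hx; exact ⟨1 - c - x, by simpa using hx, by ring⟩
        · rintro ⟨u, hu, rfl⟩; exact hu
      simp only [mem_ofPred_eq, this]
      exact Finite.image _ (by simpa using hc)
    · intro a ha b hb
      simp only [Measure.coe_add, Pi.add_apply, Measure.restrict_apply (measurableSet_quad a b)]
      have h0 := gg0 (a := a) (hM 0) hG hf hR hb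
      have h1 := gg1 (b := b) (hM 1) hG hf hR ha
      have h2 := gg2 (hM 2) hG hf ha hb
      have hv : volume (Vs G a b) ≠ ⊤ := by
        refine ne_top_of_le_ne_top (b := volume (Icc (-R) R)) (by simp) (measure_mono fun y hy => ?_)
        exact abs_le.mp (hR _ hy.2).2
      have hh : volume (Hs G a b) ≠ ⊤ := by
        refine ne_top_of_le_ne_top (b := volume (Icc (-R) R)) (by simp) (measure_mono fun y hy => ?_)
        exact abs_le.mp (hR _ hy.2).1
      rw [← ENNReal.add_left_inj hv, ← ENNReal.add_left_inj hh]
      calc _ = M 0 (quad a b ∩ JR (ed 0) G) + (M 1 (quad a b ∩ JR (ed 1) G) + volume (Vs G a b)) +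
            (M 2 (quad a b ∩ JR (ed 2) G) + volume (Hs G a b)) := by ring
        _ = _ := by rw [h0, h1, h2]; ring
  have := congrArg (fun μ => μ B) key
  simpa only [Measure.coe_add, Pi.add_apply, Measure.restrict_apply hB] using this

theorem gauss_green3 (hM : ∀ k, SliceM (pt k) K (M k)) (hM3 : SliceM pd K M3) (hG : IsOpen G)
    (hf : frontier G ⊆ K)
    (hR : ∀ z ∈ G, |z.1| ≤ R ∧ |z.2| ≤ R) (B : Set (ℝ × ℝ)) (hB : MeasurableSet B) :
    M3 (B ∩ JR ed3 G) + M 0 (B ∩ JL (ed 0) G) + M 1 (B ∩ JR (ed 1) G) =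
    M3 (B ∩ JL ed3 G) + M 0 (B ∩ JR (ed 0) G) + M 1 (B ∩ JL (ed 1) G) := by
  have := fun k => (hM k).fin
  have := hM3.fin
  have key : M3.restrict (JR ed3 G) + (M 0).restrict (JL (ed 0) G) + (M 1).restrict (JR (ed 1) G) =
     M3.restrict (JL ed3 G) + (M 0).restrict (JR (ed 0) G) + (M 1).restrict (JL (ed 1) G) := by
    refine ext_quad _ _ (Ga := {a | {y | (a, y) ∈ K}.Finite}) (Gb := {b | {x | (x, b) ∈ K}.Finite}) ?_ ?_ ?_
    · filter_upwards [(hM 0).ae_fin] with c hc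
      simpa [pt] using hc
    · filter_upwards [(hM 1).ae_fin] with c hc
      simp only [pt] at hc
      have : {x | (x, c) ∈ K} = (fun u => 1 - c - u) '' {u | (1 - c - u, c) ∈ K} := by
        ext x; simp only [mem_ofPred_eq, mem_image]
        constructor
        · intro hx; exact ⟨1 - c - x, by simpa using hx, by ring⟩
        · rintro ⟨u, hu, rfl⟩; exact hu
      simp only [mem_ofPred_eq, this]
      exact Finite.image _ (by simpa using hc)
    · intro a ha b hb
      simp only [Measure.coe_add, Pi.add_apply, Measure.restrict_apply (measurableSet_quad a b)]
      rw [gg0 (a := a) (hM 0) hG hf hR hb, ← gg1 (b := b) (hM 1) hG hf hR ha, gg3 hM3 hG hf hR ha hb]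
      ring
  have := congrArg (fun μ => μ B) key
  simpa only [Measure.coe_add, Pi.add_apply, Measure.restrict_apply hB] using this
end GG

def Om : Set (ℝ × ℝ) := {z | 0 < z.1 ∧ 0 < z.2 ∧ z.1 + z.2 < 1}

lemma isOpen_Om : IsOpen Om := by
  have h1 : IsOpen {z : ℝ × ℝ | 0 < z.1} := isOpen_lt (by fun_prop) (by fun_prop)
  have h2 : IsOpen {z : ℝ × ℝ | 0 < z.2} := isOpen_lt (by fun_prop) (by fun_prop)
  have h3 : IsOpen {z : ℝ × ℝ | z.1 + z.2 < 1} := isOpen_lt (by fun_prop) (by fun_prop)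
  exact h1.inter (h2.inter h3)

lemma Om_bdd : ∀ z ∈ Om, |z.1| ≤ 1 ∧ |z.2| ≤ 1 := by
  rintro ⟨x, y⟩ ⟨h1, h2, h3⟩
  simp only at *
  rw [abs_le, abs_le]
  refine ⟨⟨by linarith, by linarith⟩, by linarith, by linarith⟩

structure Cfg (G : Fin 3 → Set (ℝ × ℝ)) (K : Set (ℝ × ℝ)) (M : Fin 3 → Measure (ℝ × ℝ))
    (M3 ν : Measure (ℝ × ℝ)) : Prop where
  op : ∀ i, IsOpen (G i)
  dj : ∀ i j, i ≠ j → Disjoint (G i) (G j)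
  sub : ∀ i, G i ⊆ Om
  cov : Om ⊆ K ∪ ⋃ i, G i
  fr : ∀ i, frontier (G i) ⊆ K
  hM : ∀ k, SliceM (pt k) K (M k)
  hM3 : SliceM pd K M3
  le : ∀ k B, MeasurableSet B → M k B ≤ ν B
  fin : IsFiniteMeasure ν

section
variable {G : Fin 3 → Set (ℝ × ℝ)} {K : Set (ℝ × ℝ)} {M : Fin 3 → Measure (ℝ × ℝ)}
    {M3 ν : Measure (ℝ × ℝ)}

lemma Cfg.good_right (h : Cfg G K M M3 ν) {L e} (hL : IsDir L e) {c u : ℝ}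
    (hc : {u | L c u ∈ K}.Finite) (hu : L c u ∈ Om) : ∃ P, ∀ i, L c u ∈ JR e (G i) ↔ i = P := by
  have h1 : ∀ᶠ v in 𝓝 u, L c v ∈ Om := (hL.cont c).continuousAt (isOpen_Om.mem_nhds hu)
  obtain ⟨b, hb, hb2⟩ := (mem_nhdsGE_iff_exists_Icc_subset).mp (mem_nhdsWithin_of_mem_nhds h1)
  obtain ⟨q, hq1, hq2, hq3⟩ := exists_gap_right hc u hb
  have hq4 : L c q ∈ Om := hb2 ⟨hq1.le, hq2.le⟩
  have hq5 := hq3 q ⟨hq1, le_rfl⟩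
  obtain ⟨P, hP⟩ := mem_iUnion.mp ((h.cov hq4).resolve_left hq5)
  refine ⟨P, fun i => ?_⟩
  rw [hL.JR_iff, (lc_line hL (h.op i) (h.fr i) c).jr_iff hq1 hq3]
  constructor
  · intro hi
    by_contra hne
    exact (Set.disjoint_left.mp (h.dj i P hne)) hi hP
  · rintro rfl; exact hP

lemma Cfg.good_left (h : Cfg G K M M3 ν) {L e} (hL : IsDir L e) {c u : ℝ}
    (hc : {u | L c u ∈ K}.Finite) (hu : L c u ∈ Om) : ∃ P, ∀ i, L c u ∈ JL e (G i) ↔ i = P := by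
  have h1 : ∀ᶠ v in 𝓝 u, L c v ∈ Om := (hL.cont c).continuousAt (isOpen_Om.mem_nhds hu)
  obtain ⟨b, hb, hb2⟩ := (mem_nhdsLE_iff_exists_Icc_subset).mp (mem_nhdsWithin_of_mem_nhds h1)
  obtain ⟨q, hq2, hq1, hq3⟩ := exists_gap_left hc u hb
  have hq4 : L c q ∈ Om := hb2 ⟨hq2.le, hq1.le⟩
  have hq5 := hq3 q ⟨le_rfl, hq1⟩
  obtain ⟨P, hP⟩ := mem_iUnion.mp ((h.cov hq4).resolve_left hq5)
  refine ⟨P, fun i => ?_⟩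
  rw [hL.JL_iff, (lc_line hL (h.op i) (h.fr i) c).jl_iff hq1 hq3]
  constructor
  · intro hi
    by_contra hne
    exact (Set.disjoint_left.mp (h.dj i P hne)) hi hP
  · rintro rfl; exact hP

def NR (G : Fin 3 → Set (ℝ × ℝ)) (e : ℝ × ℝ) : Set (ℝ × ℝ) :=
  {z | ∃ P Q, ∀ i, (z ∈ JR e (G i) ↔ i = P) ∧ (z ∈ JL e (G i) ↔ i = Q)}

lemma Cfg.meas_NR (h : Cfg G K M M3 ν) (e) : MeasurableSet (NR G e) := by
  unfold NR
  have h1 := fun i => measurableSet_JR e (h.op i).measurableSet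
  have h2 := fun i => measurableSet_JL e (h.op i).measurableSet
  have : {z | ∃ P Q, ∀ i, (z ∈ JR e (G i) ↔ i = P) ∧ (z ∈ JL e (G i) ↔ i = Q)} =
    ⋃ P, ⋃ Q, ⋂ i, {z | (z ∈ JR e (G i) ↔ i = P)} ∩ {z | (z ∈ JL e (G i) ↔ i = Q)} := by
    ext z; simp
  rw [this]
  refine MeasurableSet.iUnion fun P => MeasurableSet.iUnion fun Q => MeasurableSet.iInter fun i =>
    MeasurableSet.inter ?_ ?_
  · by_cases hi : i = P
    · simpa [hi] using h1 P
    · have : {z | (z ∈ JR e (G i) ↔ i = P)} = (JR e (G i))ᶜ := by ext z; simp [hi]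
      rw [this]; exact (h1 i).compl
  · by_cases hi : i = Q
    · simpa [hi] using h2 Q
    · have : {z | (z ∈ JL e (G i) ↔ i = Q)} = (JL e (G i))ᶜ := by ext z; simp [hi]
      rw [this]; exact (h2 i).compl

lemma Cfg.null_bad (h : Cfg G K M M3 ν) {L e m} (hL : IsDir L e) (hm : SliceM L K m) :
    m (Om \ NR G e) = 0 := by
  rw [hm.app _ (isOpen_Om.measurableSet.diff (h.meas_NR e)), lintegral_eq_zero_iff' (hm.meas _ (isOpen_Om.measurableSet.diff (h.meas_NR e)))]
  filter_upwards [hm.ae_fin] with c hc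
  have : {u | L c u ∈ K ∩ (Om \ NR G e)} = ∅ := by
    ext u
    simp only [mem_inter_iff, mem_ofPred_eq, mem_empty_iff_false, iff_false, Set.mem_sdiff]
    rintro ⟨-, h1, h2⟩
    obtain ⟨P, hP⟩ := h.good_right hL hc h1
    obtain ⟨Q, hQ⟩ := h.good_left hL hc h1
    exact h2 ⟨P, Q, fun i => ⟨hP i, hQ i⟩⟩
  rw [this, cnt_empty]; rfl

lemma atom_induct {α : Type*} [MeasurableSpace α] (P : Set α → Prop) (𝒞 : Set (Set α)) (hf : 𝒞.Finite)
    (hP : ∀ B C, MeasurableSet B → MeasurableSet C → P (B ∩ C) → P (B \ C) → P B) :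
    (∀ C ∈ 𝒞, MeasurableSet C) →
    (∀ B, MeasurableSet B → (∀ C ∈ 𝒞, B ⊆ C ∨ Disjoint B C) → P B) → ∀ B, MeasurableSet B → P B := by
  induction 𝒞, hf using Set.Finite.induction_on with
  | empty => intro _ h B hB; exact h B hB (by simp)
  | @insert C 𝒟 hC hfin ih =>
    intro hm h
    apply ih (fun C hC => hm C (mem_insert_of_mem _ hC))
    intro B hB hat
    have hCm := hm C (mem_insert _ _)
    apply hP B C hB hCm
    · apply h _ (hB.inter hCm)
      intro D hD
      rcases hD with rfl | hD
      · left; exact inter_subset_right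
      · rcases hat D hD with h1 | h1
        · left; exact inter_subset_left.trans h1
        · right; exact h1.mono_left inter_subset_left
    · apply h _ (hB.diff hCm)
      intro D hD
      rcases hD with rfl | hD
      · right; exact disjoint_sdiff_left
      · rcases hat D hD with h1 | h1
        · left; exact sdiff_subset.trans h1
        · right; exact h1.mono_left sdiff_subset

/-- the finite family of jump sets -/
def fam (G : Fin 3 → Set (ℝ × ℝ)) : Set (Set (ℝ × ℝ)) :=
  (range fun p : Fin 3 × Fin 3 => JR (ed p.1) (G p.2)) ∪ (range fun p : Fin 3 × Fin 3 => JL (ed p.1) (G p.2)) ∪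
  (range fun i : Fin 3 => JR ed3 (G i)) ∪ (range fun i : Fin 3 => JL ed3 (G i)) ∪ {Om}

lemma fam_finite (G) : (fam G).Finite := by
  unfold fam
  exact ((((finite_range _).union (finite_range _)).union (finite_range _)).union (finite_range _)).union
    (finite_singleton _)

lemma Cfg.fam_meas (h : Cfg G K M M3 ν) : ∀ C ∈ fam G, MeasurableSet C := by
  rintro C ((((⟨p, rfl⟩ | ⟨p, rfl⟩) | ⟨p, rfl⟩) | ⟨p, rfl⟩) | rfl)
  · exact measurableSet_JR _ (h.op _).measurableSet
  · exact measurableSet_JL _ (h.op _).measurableSet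
  · exact measurableSet_JR _ (h.op _).measurableSet
  · exact measurableSet_JL _ (h.op _).measurableSet
  · exact isOpen_Om.measurableSet

lemma Cfg.atom_type (h : Cfg G K M M3 ν) {L e m} (hL : IsDir L e) (hm : SliceM L K m)
    {B : Set (ℝ × ℝ)} (hB : B ⊆ Om)
    (h1 : ∀ i, B ⊆ JR e (G i) ∨ Disjoint B (JR e (G i))) (h2 : ∀ i, B ⊆ JL e (G i) ∨ Disjoint B (JL e (G i))) :
    ∃ P Q, ∀ i, m.real (B ∩ JR e (G i)) = (if i = P then m.real B else 0) ∧
      m.real (B ∩ JL e (G i)) = (if i = Q then m.real B else 0) := by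
  have := hm.fin
  by_cases h0 : m B = 0
  · refine ⟨0, 0, fun i => ?_⟩
    have hz : ∀ C, m (B ∩ C) = 0 := fun C => measure_mono_null inter_subset_left h0
    simp [Measure.real, hz, h0]
  · have : ∃ z ∈ B, z ∈ NR G e := by
      by_contra hh
      push Not at hh
      exact h0 (measure_mono_null (fun z hz => (⟨hB hz, hh z hz⟩ : z ∈ Om \ NR G e)) (h.null_bad hL hm))
    obtain ⟨z, hz, P, Q, hPQ⟩ := this
    refine ⟨P, Q, fun i => ⟨?_, ?_⟩⟩
    · split_ifs with hi
      · rcases h1 i with h3 | h3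
        · rw [inter_eq_left.mpr h3]
        · exact absurd ((hPQ i).1.mpr hi) (Set.disjoint_left.mp h3 hz)
      · rcases h1 i with h3 | h3
        · exact absurd ((hPQ i).1.mp (h3 hz)) hi
        · rw [h3.inter_eq]; simp
    · split_ifs with hi
      · rcases h2 i with h3 | h3
        · rw [inter_eq_left.mpr h3]
        · exact absurd ((hPQ i).2.mpr hi) (Set.disjoint_left.mp h3 hz)
      · rcases h2 i with h3 | h3
        · exact absurd ((hPQ i).2.mp (h3 hz)) hi
        · rw [h3.inter_eq]; simp
end

/-- jump set -/
def JX (k : Fin 3) (G : Set (ℝ × ℝ)) : Set (ℝ × ℝ) :=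
  (JR (ed k) G \ JL (ed k) G) ∪ (JL (ed k) G \ JR (ed k) G)

/-- the arithmetic behind the structure of atoms -/
lemma arith_atom (A0 A1 A2 A3 : Fin 3 → ℝ) (n : ℝ)
    (h0 : ∀ i, |A0 i| ≤ n) (h1 : ∀ i, |A1 i| ≤ n) (h2 : ∀ i, |A2 i| ≤ n)
    (hs : ∀ i, A0 i + A1 i + A2 i = 0) (hd : ∀ i, A3 i = A0 i - A1 i)
    (z0 : ∃ i, A0 i = 0) (z1 : ∃ i, A1 i = 0) (z2 : ∃ i, A2 i = 0) (z3 : ∃ i, A3 i = 0)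
    (s0 : A0 0 + A0 1 + A0 2 = 0) (s1 : A1 0 + A1 1 + A1 2 = 0) :
    (A0 1 - A1 0 ≤ n) ∧ ((∃ i, A0 i = 0 ∧ A1 i = 0 ∧ A2 i = 0)) := by
  have hn : 0 ≤ n := (abs_nonneg _).trans (h0 0)
  have e : ∃ i, A0 i = 0 ∧ A1 i = 0 ∧ A2 i = 0 := by
    by_contra hcon
    push Not at hcon
    have hA3 := hd 0
    have hA31 := hd 1
    have hA32 := hd 2
    have t0 := hs 0
    have t1 := hs 1
    have t2 := hs 2
    have c0 := hcon 0
    have c1 := hcon 1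
    have c2 := hcon 2
    obtain ⟨i, hi⟩ := z0
    obtain ⟨j, hj⟩ := z1
    obtain ⟨k, hk⟩ := z2
    obtain ⟨l, hl⟩ := z3
    fin_cases i <;> fin_cases j <;> fin_cases k <;> fin_cases l <;> simp only [Fin.reduceFinMk, Fin.zero_eta, Fin.isValue] at hi hj hk hl <;>
    first
    | exact c0 (by linarith) (by linarith) (by linarith)
    | exact c1 (by linarith) (by linarith) (by linarith)
    | exact c2 (by linarith) (by linarith) (by linarith)
  refine ⟨?_, e⟩
  obtain ⟨i, e0, e1, e2⟩ := e
  have a1 := abs_le.mp (h0 1)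
  have a2 := abs_le.mp (h1 0)
  have a3 := abs_le.mp (h2 0)
  have := hs 0
  fin_cases i <;> simp only [Fin.reduceFinMk, Fin.zero_eta, Fin.isValue] at e0 e1 e2 <;> linarith


lemma real_JX (m : Measure (ℝ × ℝ)) (k : Fin 3) (G : Set (ℝ × ℝ)) (B : Set (ℝ × ℝ))
    (h1 : B ⊆ JR (ed k) G ∨ Disjoint B (JR (ed k) G)) (h2 : B ⊆ JL (ed k) G ∨ Disjoint B (JL (ed k) G)) :
    m.real (B ∩ JX k G) = |m.real (B ∩ JR (ed k) G) - m.real (B ∩ JL (ed k) G)| := by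
  have hn : 0 ≤ m.real B := measureReal_nonneg
  rcases h1 with h1 | h1 <;> rcases h2 with h2 | h2
  · have : B ∩ JX k G = ∅ := by
      ext z; simp only [JX, mem_inter_iff, mem_union, Set.mem_sdiff, mem_empty_iff_false, iff_false]
      rintro ⟨a, b⟩; have := h1 a; have := h2 a; tauto
    rw [this, inter_eq_left.mpr h1, inter_eq_left.mpr h2]; simp
  · have : B ∩ JX k G = B := by
      ext z; simp only [JX, mem_inter_iff, mem_union, Set.mem_sdiff, and_iff_left_iff_imp]
      intro a; have := h1 a; have := Set.disjoint_left.mp h2 a; tauto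
    rw [this, inter_eq_left.mpr h1, h2.inter_eq]; simp [abs_of_nonneg hn]
  · have : B ∩ JX k G = B := by
      ext z; simp only [JX, mem_inter_iff, mem_union, Set.mem_sdiff, and_iff_left_iff_imp]
      intro a; have := h2 a; have := Set.disjoint_left.mp h1 a; tauto
    rw [this, inter_eq_left.mpr h2, h1.inter_eq]; simp [abs_of_nonneg hn]
  · have : B ∩ JX k G = ∅ := by
      ext z; simp only [JX, mem_inter_iff, mem_union, Set.mem_sdiff, mem_empty_iff_false, iff_false]
      rintro ⟨a, b⟩; have := Set.disjoint_left.mp h1 a; have := Set.disjoint_left.mp h2 a; tauto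
    rw [this, h1.inter_eq, h2.inter_eq]; simp

lemma measurableSet_JX (k : Fin 3) {G : Set (ℝ × ℝ)} (hG : MeasurableSet G) : MeasurableSet (JX k G) :=
  ((measurableSet_JR _ hG).diff (measurableSet_JL _ hG)).union ((measurableSet_JL _ hG).diff (measurableSet_JR _ hG))

section
variable {G : Fin 3 → Set (ℝ × ℝ)} {K : Set (ℝ × ℝ)} {M : Fin 3 → Measure (ℝ × ℝ)}
    {M3 ν : Measure (ℝ × ℝ)}

lemma Cfg.gg (h : Cfg G K M M3 ν) (i : Fin 3) {B : Set (ℝ × ℝ)} (hB : MeasurableSet B) :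
    ((M 0).real (B ∩ JR (ed 0) (G i)) - (M 0).real (B ∩ JL (ed 0) (G i))) +
    ((M 1).real (B ∩ JR (ed 1) (G i)) - (M 1).real (B ∩ JL (ed 1) (G i))) +
    ((M 2).real (B ∩ JR (ed 2) (G i)) - (M 2).real (B ∩ JL (ed 2) (G i))) = 0 := by
  have := fun k => (h.hM k).fin
  have := congrArg ENNReal.toReal (gauss_green h.hM (h.op i) (h.fr i) (fun z hz => Om_bdd z (h.sub i hz)) B hB)
  simp only [ENNReal.toReal_add, ne_eq, ENNReal.add_eq_top, measure_ne_top, or_self, not_false_eq_true] at this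
  simp only [Measure.real]; linarith

lemma Cfg.gg3 (h : Cfg G K M M3 ν) (i : Fin 3) {B : Set (ℝ × ℝ)} (hB : MeasurableSet B) :
    (M3.real (B ∩ JR ed3 (G i)) - M3.real (B ∩ JL ed3 (G i))) =
    ((M 0).real (B ∩ JR (ed 0) (G i)) - (M 0).real (B ∩ JL (ed 0) (G i))) -
    ((M 1).real (B ∩ JR (ed 1) (G i)) - (M 1).real (B ∩ JL (ed 1) (G i))) := by
  have := fun k => (h.hM k).fin
  have := h.hM3.fin
  have := congrArg ENNReal.toReal (gauss_green3 h.hM h.hM3 (h.op i) (h.fr i) (fun z hz => Om_bdd z (h.sub i hz)) B hB)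
  simp only [ENNReal.toReal_add, ne_eq, ENNReal.add_eq_top, measure_ne_top, or_self, not_false_eq_true] at this
  simp only [Measure.real]; linarith

lemma Cfg.real_le (h : Cfg G K M M3 ν) (k) {B : Set (ℝ × ℝ)} (hB : MeasurableSet B) :
    (M k).real B ≤ ν.real B := by
  have := h.fin
  exact ENNReal.toReal_mono (measure_ne_top _ _) (h.le k B hB)

lemma ite_zero_sum {P Q : Fin 3} {m : ℝ} (A : Fin 3 → ℝ)
    (hA : ∀ i, A i = (if i = P then m else 0) - (if i = Q then m else 0)) :
    (∃ i, A i = 0) ∧ A 0 + A 1 + A 2 = 0 ∧ (∀ i, |A i| ≤ |m|) := by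
  refine ⟨?_, ?_, ?_⟩
  · have : ∃ i, i ≠ P ∧ i ≠ Q := by clear hA; revert P Q; decide
    obtain ⟨i, h1, h2⟩ := this
    exact ⟨i, by rw [hA]; simp [h1, h2]⟩
  · simp only [hA]; fin_cases P <;> fin_cases Q <;> simp
  · intro i; rw [hA]; split_ifs <;> simp

/-- everything about an atom -/
lemma Cfg.atom (h : Cfg G K M M3 ν) {B : Set (ℝ × ℝ)} (hB : MeasurableSet B) (hO : B ⊆ Om)
    (hat : ∀ C ∈ fam G, B ⊆ C ∨ Disjoint B C) :
    ((M 0).real (B ∩ JR (ed 0) (G 1)) - (M 0).real (B ∩ JL (ed 0) (G 1))) -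
    ((M 1).real (B ∩ JR (ed 1) (G 0)) - (M 1).real (B ∩ JL (ed 1) (G 0))) ≤ ν.real B ∧
    (∑ i, ∑ k, (M k).real (B ∩ JX k (G i))) ≤ 4 * ν.real B ∧
    (∀ i k, 2 * (M k).real (B ∩ JX k (G i)) ≤ ∑ k, (M k).real (B ∩ JX k (G i))) := by
  have hR : ∀ k i, B ⊆ JR (ed k) (G i) ∨ Disjoint B (JR (ed k) (G i)) := fun k i =>
    hat _ (Or.inl (Or.inl (Or.inl (Or.inl ⟨(k, i), rfl⟩))))
  have hL : ∀ k i, B ⊆ JL (ed k) (G i) ∨ Disjoint B (JL (ed k) (G i)) := fun k i =>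
    hat _ (Or.inl (Or.inl (Or.inl (Or.inr ⟨(k, i), rfl⟩))))
  have hR3 : ∀ i, B ⊆ JR ed3 (G i) ∨ Disjoint B (JR ed3 (G i)) := fun i =>
    hat _ (Or.inl (Or.inl (Or.inr ⟨i, rfl⟩)))
  have hL3 : ∀ i, B ⊆ JL ed3 (G i) ∨ Disjoint B (JL ed3 (G i)) := fun i =>
    hat _ (Or.inl (Or.inr ⟨i, rfl⟩))
  have hX : ∀ k i, (M k).real (B ∩ JX k (G i)) = |(M k).real (B ∩ JR (ed k) (G i)) - (M k).real (B ∩ JL (ed k) (G i))| :=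
    fun k i => real_JX (M k) k (G i) B (hR k i) (hL k i)
  simp only [hX]
  have hA : ∀ k, ∃ A : Fin 3 → ℝ, (∀ i, A i = (M k).real (B ∩ JR (ed k) (G i)) - (M k).real (B ∩ JL (ed k) (G i))) ∧
      (∃ i, A i = 0) ∧ A 0 + A 1 + A 2 = 0 ∧ (∀ i, |A i| ≤ ν.real B) := by
    intro k
    obtain ⟨P, Q, hPQ⟩ := h.atom_type (isDir_pt k) (h.hM k) hO (hR k) (hL k)
    refine ⟨fun i => (M k).real (B ∩ JR (ed k) (G i)) - (M k).real (B ∩ JL (ed k) (G i)), fun i => rfl, ?_⟩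
    obtain ⟨h1, h2, h3⟩ := ite_zero_sum (P := P) (Q := Q) (m := (M k).real B)
      (fun i => (M k).real (B ∩ JR (ed k) (G i)) - (M k).real (B ∩ JL (ed k) (G i)))
      (fun i => by simp only [(hPQ i).1, (hPQ i).2])
    refine ⟨h1, h2, fun i => (h3 i).trans ?_⟩
    rw [abs_of_nonneg measureReal_nonneg]; exact h.real_le k hB
  have z3 : ∃ i, M3.real (B ∩ JR ed3 (G i)) - M3.real (B ∩ JL ed3 (G i)) = 0 := by
    obtain ⟨P, Q, hPQ⟩ := h.atom_type isDir_pd h.hM3 hO hR3 hL3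
    exact (ite_zero_sum (P := P) (Q := Q) (m := M3.real B)
      (fun i => M3.real (B ∩ JR ed3 (G i)) - M3.real (B ∩ JL ed3 (G i)))
      (fun i => by simp only [(hPQ i).1, (hPQ i).2])).1
  have hgg := fun i => h.gg i hB
  have hgg3 := fun i => h.gg3 i hB
  obtain ⟨A0, e0, a0, b0, c0⟩ := hA 0
  obtain ⟨A1, e1, a1, b1, c1⟩ := hA 1
  obtain ⟨A2, e2, a2, b2, c2⟩ := hA 2
  simp only [← e0, ← e1, ← e2] at hgg hgg3
  obtain ⟨r1, i, i0, i1, i2⟩ := arith_atom A0 A1 A2 _ (ν.real B) c0 c1 c2 hgg hgg3 a0 a1 a2 z3 b0 b1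
  refine ⟨by rw [← e0, ← e1]; exact r1, ?_, ?_⟩
  · simp only [Fin.sum_univ_three, ← e0, ← e1, ← e2]
    have key : ∀ p q r n : ℝ, p + q + r = 0 → |p| ≤ n → |q| ≤ n → |r| ≤ n → |p| + |q| + |r| ≤ 2 * n := by
      intro p q r n hs hp hq hr
      rcases abs_cases p with hp' | hp' <;> rcases abs_cases q with hq' | hq' <;>
        rcases abs_cases r with hr' | hr' <;> linarith
    have k0 := key _ _ _ _ (hgg 0) (c0 0) (c1 0) (c2 0)
    have k1 := key _ _ _ _ (hgg 1) (c0 1) (c1 1) (c2 1)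
    have k2 := key _ _ _ _ (hgg 2) (c0 2) (c1 2) (c2 2)
    have hn : 0 ≤ ν.real B := measureReal_nonneg
    fin_cases i <;> simp only [Fin.reduceFinMk, Fin.zero_eta, Fin.isValue] at i0 i1 i2 <;> simp only [i0, i1, i2, abs_zero] <;> linarith
  · intro i k
    simp only [Fin.sum_univ_three, ← e0, ← e1, ← e2]
    have := hgg i
    have t0 : |A0 i| ≤ |A1 i| + |A2 i| := by
      rw [show A0 i = -(A1 i + A2 i) by linarith, abs_neg]; exact abs_add_le _ _
    have t1 : |A1 i| ≤ |A0 i| + |A2 i| := by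
      rw [show A1 i = -(A0 i + A2 i) by linarith, abs_neg]; exact abs_add_le _ _
    have t2 : |A2 i| ≤ |A0 i| + |A1 i| := by
      rw [show A2 i = -(A0 i + A1 i) by linarith, abs_neg]; exact abs_add_le _ _
    fin_cases k <;> simp only [Fin.reduceFinMk, Fin.zero_eta, Fin.isValue, ← e0, ← e1, ← e2] <;> linarith

lemma real_split (m : Measure (ℝ × ℝ)) [IsFiniteMeasure m] (B C D : Set (ℝ × ℝ)) (hC : MeasurableSet C) :
    m.real (B ∩ D) = m.real (B ∩ C ∩ D) + m.real ((B \ C) ∩ D) := by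
  rw [← measureReal_inter_add_sdiff (s := B ∩ D) hC]
  congr 2
  · ext z; simp; tauto
  · ext z; simp; tauto

theorem Cfg.struct (h : Cfg G K M M3 ν) {B : Set (ℝ × ℝ)} (hB : MeasurableSet B) (hO : B ⊆ Om) :
    ((M 0).real (B ∩ JR (ed 0) (G 1)) - (M 0).real (B ∩ JL (ed 0) (G 1))) -
    ((M 1).real (B ∩ JR (ed 1) (G 0)) - (M 1).real (B ∩ JL (ed 1) (G 0))) ≤ ν.real B ∧
    (∑ i, ∑ k, (M k).real (B ∩ JX k (G i))) ≤ 4 * ν.real B ∧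
    (∀ i k, 2 * (M k).real (B ∩ JX k (G i)) ≤ ∑ k, (M k).real (B ∩ JX k (G i))) := by
  have := fun k => (h.hM k).fin
  have := h.fin
  revert hO
  refine atom_induct (fun B => B ⊆ Om → 
    ((M 0).real (B ∩ JR (ed 0) (G 1)) - (M 0).real (B ∩ JL (ed 0) (G 1))) -
    ((M 1).real (B ∩ JR (ed 1) (G 0)) - (M 1).real (B ∩ JL (ed 1) (G 0))) ≤ ν.real B ∧
    (∑ i, ∑ k, (M k).real (B ∩ JX k (G i))) ≤ 4 * ν.real B ∧
    (∀ i k, 2 * (M k).real (B ∩ JX k (G i)) ≤ ∑ k, (M k).real (B ∩ JX k (G i)))) (fam G) (fam_finite G) ?_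
    h.fam_meas (fun B hB hat hO => h.atom hB hO hat) B hB
  intro B C hB hC h1 h2 hO
  obtain ⟨a1, a2, a3⟩ := h1 (inter_subset_left.trans hO)
  obtain ⟨b1, b2, b3⟩ := h2 (sdiff_subset.trans hO)
  have hν : ν.real B = ν.real (B ∩ C) + ν.real (B \ C) := (measureReal_inter_add_sdiff hC).symm
  have e : ∀ k D, (M k).real (B ∩ D) = (M k).real (B ∩ C ∩ D) + (M k).real ((B \ C) ∩ D) :=
    fun k D => real_split (M k) B C D hC
  refine ⟨?_, ?_, ?_⟩
  · rw [e 0, e 0, e 1, e 1, hν]; linarith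
  · simp only [e _ (JX _ _), Finset.sum_add_distrib] at a2 b2 ⊢; linarith
  · intro i k
    have := a3 i k
    have := b3 i k
    simp only [e _ (JX _ _), Finset.sum_add_distrib]; linarith
end

noncomputable def NJ (J : Fin 3 → Set (ℝ × ℝ)) (B : Set (ℝ × ℝ)) (k : Fin 3) (c : ℝ) : ENNReal :=
  cnt {u | pt k c u ∈ B ∩ J k}

/-- far from `X` / in `X` near a boundary point -/
def trIn (X : Set (ℝ × ℝ)) (s : ℝ × ℝ) : Prop := ∀ᶠ z in 𝓝[Om] s, z ∈ X
def trOut (X : Set (ℝ × ℝ)) (s : ℝ × ℝ) : Prop := ∀ᶠ z in 𝓝[Om] s, z ∉ X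

structure PD (X K E : Set (ℝ × ℝ)) (J : Fin 3 → Set (ℝ × ℝ)) (P : Measure (ℝ × ℝ)) : Prop where
  op : IsOpen X
  sub : X ⊆ Om
  fin : ∀ k, ∀ᵐ c, {u | pt k c u ∈ K}.Finite
  flip : ∀ k, ∀ᵐ c, ∀ p q, p < q → pt k c p ∈ Om → pt k c q ∈ Om → pt k c p ∉ K → pt k c q ∉ K →
    ¬ (pt k c p ∈ X ↔ pt k c q ∈ X) → ∃ u, p < u ∧ u < q ∧ pt k c u ∈ J k
  meas : ∀ k B, MeasurableSet B → AEMeasurable (NJ J B k)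
  le1 : ∀ k B, MeasurableSet B → ∫⁻ c, NJ J B k c ≤ P B
  le3 : ∀ B, MeasurableSet B → ∑ k, ∫⁻ c, NJ J B k c ≤ 2 * P B
  finE : E.Finite
  bd : ∀ k c, 0 < c → c < 1 → pt k 0 c ∉ E → trIn X (pt k 0 c) ∨ trOut X (pt k 0 c)

lemma pt_mem_Om (k : Fin 3) {c u : ℝ} (hc : 0 < c) (hu : 0 < u) (h : u < 1 - c) : pt k c u ∈ Om := by
  fin_cases k <;> simp [pt, Om] <;> (try constructor) <;> (try constructor) <;> linarith

lemma cont_pt (k : Fin 3) (c : ℝ) : Continuous (pt k c) := (isDir_pt k).cont c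

/-- one sided approach to the start of a line -/
lemma tendsto_start (k : Fin 3) {c : ℝ} (hc : 0 < c) (hc1 : c < 1) :
    Tendsto (pt k c) (𝓝[>] 0) (𝓝[Om] (pt k c 0)) := by
  apply tendsto_nhdsWithin_of_tendsto_nhds_of_eventually_within
  · exact ((cont_pt k c).tendsto 0).mono_left nhdsWithin_le_nhds
  · have : Ioo 0 (1 - c) ∈ 𝓝[>] (0:ℝ) := Ioo_mem_nhdsGT (by linarith)
    filter_upwards [this] with u hu
    exact pt_mem_Om k hc hu.1 hu.2

lemma tendsto_end (k : Fin 3) {c : ℝ} (hc : 0 < c) (hc1 : c < 1) :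
    Tendsto (pt k c) (𝓝[<] (1 - c)) (𝓝[Om] (pt k c (1 - c))) := by
  apply tendsto_nhdsWithin_of_tendsto_nhds_of_eventually_within
  · exact ((cont_pt k c).tendsto (1 - c)).mono_left nhdsWithin_le_nhds
  · have : Ioo 0 (1 - c) ∈ 𝓝[<] (1 - c) := Ioo_mem_nhdsLT (by linarith)
    filter_upwards [this] with u hu
    exact pt_mem_Om k hc hu.1 hu.2

/-- a point near the start, off K -/
lemma near_start (k : Fin 3) {c b : ℝ} (hc : 0 < c) (hc1 : c < 1) (hb : 0 < b) {K : Set (ℝ × ℝ)}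
    (hK : {u | pt k c u ∈ K}.Finite) {Q : Set (ℝ × ℝ)} (hQ : ∀ᶠ z in 𝓝[Om] (pt k c 0), z ∈ Q) :
    ∃ u, 0 < u ∧ u < b ∧ u < 1 - c ∧ pt k c u ∈ Om ∧ pt k c u ∉ K ∧ pt k c u ∈ Q := by
  have h1 := (tendsto_start k hc hc1).eventually hQ
  obtain ⟨q, hq1, hq2, hq3⟩ := exists_gap_right hK 0 (b := min b (1 - c)) (lt_min hb (by linarith))
  have h2 : Ioo 0 q ∈ 𝓝[>] (0:ℝ) := Ioo_mem_nhdsGT hq1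
  obtain ⟨u, hu, hu2⟩ := (h1.and h2).exists
  have hb' := hu2.2.trans (hq2.trans_le (min_le_left _ _))
  have hb'' := hu2.2.trans (hq2.trans_le (min_le_right _ _))
  exact ⟨u, hu2.1, hb', hb'', pt_mem_Om k hc hu2.1 hb'', hq3 u ⟨hu2.1, hu2.2.le⟩, hu⟩

lemma near_end (k : Fin 3) {c b : ℝ} (hc : 0 < c) (hc1 : c < 1) (hb : b < 1 - c) {K : Set (ℝ × ℝ)}
    (hK : {u | pt k c u ∈ K}.Finite) {Q : Set (ℝ × ℝ)} (hQ : ∀ᶠ z in 𝓝[Om] (pt k c (1 - c)), z ∈ Q) :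
    ∃ u, 0 < u ∧ b < u ∧ u < 1 - c ∧ pt k c u ∈ Om ∧ pt k c u ∉ K ∧ pt k c u ∈ Q := by
  have h1 := (tendsto_end k hc hc1).eventually hQ
  obtain ⟨q, hq1, hq2, hq3⟩ := exists_gap_left hK (1 - c) (a := max b 0) (max_lt hb (by linarith))
  have h2 : Ioo q (1 - c) ∈ 𝓝[<] (1 - c) := Ioo_mem_nhdsLT hq2
  obtain ⟨u, hu, hu2⟩ := (h1.and h2).exists
  have hb' := ((le_max_left b 0).trans_lt hq1).trans hu2.1
  have hb'' := ((le_max_right b 0).trans_lt hq1).trans hu2.1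
  exact ⟨u, hb'', hb', hu2.2, pt_mem_Om k hc hb'' hu2.2, hq3 u ⟨hu2.1.le, hu2.2⟩, hu⟩

lemma one_le_cnt {S : Set ℝ} (h : S.Nonempty) : 1 ≤ cnt S := by
  unfold cnt
  have := Set.one_le_encard_iff_nonempty.mpr h
  exact_mod_cast this

lemma two_le_cnt {S : Set ℝ} {a b : ℝ} (ha : a ∈ S) (hb : b ∈ S) (hab : a ≠ b) : 2 ≤ cnt S := by
  have h1 : ({a, b} : Set ℝ).encard ≤ S.encard := Set.encard_le_encard (by
    intro x hx; rcases hx with rfl | rfl <;> assumption)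
  rw [Set.encard_pair hab] at h1
  unfold cnt
  exact_mod_cast h1

def pset (k : Fin 3) (X : Set (ℝ × ℝ)) (c : ℝ) : Set ℝ := {u | pt k c u ∈ X}

lemma pset_open (k) {X : Set (ℝ × ℝ)} (hX : IsOpen X) (c) : IsOpen (pset k X c) :=
  hX.preimage (cont_pt k c)

lemma pt_Om_iff (k : Fin 3) (c u : ℝ) : pt k c u ∈ Om ↔ 0 < c ∧ 0 < u ∧ u < 1 - c := by
  constructor
  · intro h; fin_cases k <;> simp [pt, Om] at h <;> (refine ⟨?_, ?_, ?_⟩) <;> linarith [h.1, h.2.1, h.2.2]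
  · rintro ⟨h1, h2, h3⟩; exact pt_mem_Om k h1 h2 h3

lemma pset_sub (k) {X : Set (ℝ × ℝ)} (hX : X ⊆ Om) (c) : pset k X c ⊆ Ioo 0 (1 - c) := by
  intro u hu
  have := (pt_Om_iff k c u).mp (hX hu)
  exact ⟨this.2.1, this.2.2⟩

section
variable {X K E : Set (ℝ × ℝ)} {J : Fin 3 → Set (ℝ × ℝ)} {P : Measure (ℝ × ℝ)}

/-- points of `pset` off `K` exist as soon as it has positive measure -/
lemma exists_pset (k) {c} (hK : {u | pt k c u ∈ K}.Finite) {S : Set ℝ} (h : volume S ≠ 0) :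
    ∃ u ∈ S, pt k c u ∉ K := by
  by_contra hh
  push Not at hh
  exact h (measure_mono_null (fun u hu => hh u hu) (hK.measure_zero volume))

def nonfull (X : Set (ℝ × ℝ)) : Set ℝ :=
  {c | 0 < c ∧ c < 1 ∧ volume (pset 0 X c) ≠ 0 ∧ volume (pset 0 X c) ≠ ENNReal.ofReal (1 - c)}

lemma measurable_p (hX : IsOpen X) : Measurable fun c => volume (pset 0 X c) :=
  measurable_measure_prodMk_left hX.measurableSet

lemma measurableSet_nonfull (hX : IsOpen X) : MeasurableSet (nonfull X) := by
  have h := measurable_p hX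
  have h1 : MeasurableSet {c | volume (pset 0 X c) = 0} := h (measurableSet_singleton 0)
  have h2 : MeasurableSet {c | volume (pset 0 X c) = ENNReal.ofReal (1 - c)} :=
    measurableSet_eq_fun h (by fun_prop)
  exact measurableSet_Ioi.inter (measurableSet_Iio.inter (h1.compl.inter h2.compl))

/-- region `x > c0` -/
lemma PD.right (h : PD X K E J P) {c0 : ℝ} :
    volume (nonfull X ∩ Ioi c0) ≤ P (Om ∩ {z | c0 < z.1}) := by
  have hm : MeasurableSet (Om ∩ {z : ℝ × ℝ | c0 < z.1}) :=
    isOpen_Om.measurableSet.inter (measurableSet_lt measurable_const measurable_fst)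
  refine le_trans ?_ (h.le1 0 _ hm)
  have hms := (measurableSet_nonfull h.op).inter (measurableSet_Ioi (a := c0))
  rw [← lintegral_ind hms]
  apply lintegral_mono_ae
  filter_upwards [h.fin 0, h.flip 0] with c hK hf
  by_cases hc : c ∈ nonfull X ∩ Ioi c0
  · rw [ind, if_pos hc]
    obtain ⟨⟨c1, c2, c3, c4⟩, c5⟩ := hc
    apply one_le_cnt
    obtain ⟨u, hu, huK⟩ := exists_pset 0 hK c3
    have : volume (Ioo 0 (1 - c) \ pset 0 X c) ≠ 0 := by
      intro h0
      apply c4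
      have h1 := pset_sub 0 h.sub c
      have := measure_sdiff_add_inter (μ := volume) (s := Ioo 0 (1-c)) (pset_open 0 h.op c).measurableSet
      rw [h0, zero_add, inter_eq_right.mpr h1] at this
      rw [this]; simp
    obtain ⟨v, hv, hvK⟩ := exists_pset 0 hK this
    have hu' := pset_sub 0 h.sub c hu
    have uO := pt_mem_Om 0 c1 hu'.1 hu'.2
    have vO := pt_mem_Om 0 c1 hv.1.1 hv.1.2
    have hne : u ≠ v := by rintro rfl; exact hv.2 hu
    rcases lt_or_gt_of_ne hne with huv | huv
    · obtain ⟨w, w1, w2, w3⟩ := hf u v huv uO vO huK hvK (fun hh => hv.2 (hh.mp hu))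
      refine ⟨w, ⟨pt_mem_Om 0 c1 (hu'.1.trans w1) (w2.trans hv.1.2), ?_⟩, w3⟩
      simpa [pt] using c5
    · obtain ⟨w, w1, w2, w3⟩ := hf v u huv vO uO hvK huK (fun hh => hv.2 (hh.mpr hu))
      refine ⟨w, ⟨pt_mem_Om 0 c1 (hv.1.1.trans w1) (w2.trans hu'.2), ?_⟩, w3⟩
      simpa [pt] using c5
  · rw [ind, if_neg hc]; exact zero_le

lemma ae_notMem_E (hE : E.Finite) (f : ℝ → ℝ × ℝ) (hf : Function.Injective f) : ∀ᵐ c, f c ∉ E :=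
  ae_notMem_finite (hE.preimage hf.injOn)

lemma ae_sub_left {p : ℝ → Prop} (a : ℝ) (h : ∀ᵐ c, p c) : ∀ᵐ c, p (a - c) :=
  (Measure.measurePreserving_sub_left volume a).quasiMeasurePreserving.ae h

/-- the three lines at a low level -/
lemma PD.left_point (h : PD X K E J P) 
    (hmiss : ∀ c, 0 < c → c < 1 → pt 0 0 c ∉ E → trOut X (pt 0 0 c)) (c0 : ℝ) :
    ∀ᵐ c, c ∈ Ioo 0 1 → c < c0 → volume (pset 0 X c) ≠ 0 →
      2 ≤ NJ J (Om ∩ {z | z.1 < c0}) 0 c + NJ J (Om ∩ {z | z.1 < c0}) 1 (1 - c) +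
        NJ J (Om ∩ {z | z.1 < c0}) 2 (1 - c) := by
  have i0 : Function.Injective (fun c : ℝ => pt 0 0 c) := by intro a b hab; simpa [pt] using hab
  have i1 : Function.Injective (fun c : ℝ => pt 1 0 c) := by intro a b hab; simpa [pt] using hab
  have i2 : Function.Injective (fun c : ℝ => pt 2 0 c) := by intro a b hab; simp [pt] at hab; exact hab
  filter_upwards [h.fin 0, h.flip 0, ae_sub_left 1 (h.fin 1), ae_sub_left 1 (h.flip 1),
    ae_sub_left 1 (h.fin 2), ae_sub_left 1 (h.flip 2), ae_notMem_E h.finE _ i0, ae_sub_left 1 (ae_notMem_E h.finE _ i0),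
    ae_sub_left 1 (ae_notMem_E h.finE _ i1), ae_notMem_E h.finE _ i2] with c k0 f0 k1 f1 k2 f2 e0 e0' e1 e2 hc hcc hp
  have hc0 := hc.1
  have hc1 := hc.2
  have p1s : pt 1 (1 - c) 0 = pt 2 0 c := by simp [pt]
  have p1e : pt 1 (1 - c) (1 - (1 - c)) = pt 0 0 (1 - c) := by simp [pt]
  have p2s : pt 2 (1 - c) 0 = pt 0 0 c := by simp [pt]
  have p2e : pt 2 (1 - c) (1 - (1 - c)) = pt 1 0 (1 - c) := by simp [pt]
  have p0s : pt 0 c 0 = pt 1 0 (1 - c) := by simp [pt]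
  have p0e : pt 0 c (1 - c) = pt 2 0 c := by simp [pt]
  have m0 := hmiss (1 - c) (by linarith) (by linarith) e0'
  have m0' := hmiss c hc0 hc1 e0
  -- contributions
  have A1 : trIn X (pt 2 0 c) → 1 ≤ NJ J (Om ∩ {z | z.1 < c0}) 1 (1 - c) := by
    intro hin
    rw [← p1s] at hin
    rw [← p1e] at m0
    obtain ⟨q, q1, q2, q3, q4, q5, q6⟩ := near_end 1 (c := 1 - c) (b := 0) (by linarith) (by linarith) (by linarith) k1 (Q := Xᶜ) m0
    obtain ⟨p, r1, r2, r3, r4, r5, r6⟩ := near_start 1 (c := 1 - c) (b := q) (by linarith) (by linarith) q1 k1 (Q := X) hin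
    obtain ⟨w, w1, w2, w3⟩ := f1 p q r2 r4 q4 r5 q5 (fun hh => q6 (hh.mp r6))
    apply one_le_cnt
    refine ⟨w, ⟨pt_mem_Om 1 (by linarith) (by linarith) (by linarith), ?_⟩, w3⟩
    simp [pt]; linarith
  have A2 : trIn X (pt 1 0 (1 - c)) → 1 ≤ NJ J (Om ∩ {z | z.1 < c0}) 2 (1 - c) := by
    intro hin
    rw [← p2e] at hin
    rw [← p2s] at m0'
    obtain ⟨q, q1, q2, q3, q4, q5, q6⟩ := near_end 2 (c := 1 - c) (b := 0) (by linarith) (by linarith) (by linarith) k2 (Q := X) hin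
    obtain ⟨p, r1, r2, r3, r4, r5, r6⟩ := near_start 2 (c := 1 - c) (b := q) (by linarith) (by linarith) q1 k2 (Q := Xᶜ) m0'
    obtain ⟨w, w1, w2, w3⟩ := f2 p q r2 r4 q4 r5 q5 (fun hh => r6 (hh.mpr q6))
    apply one_le_cnt
    refine ⟨w, ⟨pt_mem_Om 2 (by linarith) (by linarith) (by linarith), ?_⟩, w3⟩
    simp [pt]; linarith
  obtain ⟨v, hv, hvK⟩ := exists_pset 0 k0 hp
  have hv' := pset_sub 0 h.sub c hv
  have vO := pt_mem_Om 0 hc0 hv'.1 hv'.2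
  have B1 : trOut X (pt 2 0 c) → ∃ w, v < w ∧ w ∈ {u | pt 0 c u ∈ (Om ∩ {z | z.1 < c0}) ∩ J 0} := by
    intro hout
    rw [← p0e] at hout
    obtain ⟨q, q1, q2, q3, q4, q5, q6⟩ := near_end 0 (c := c) (b := v) hc0 hc1 hv'.2 k0 (Q := Xᶜ) hout
    obtain ⟨w, w1, w2, w3⟩ := f0 v q q2 vO q4 hvK q5 (fun hh => q6 (hh.mp hv))
    refine ⟨w, w1, ⟨pt_mem_Om 0 hc0 (hv'.1.trans w1) (w2.trans q3), ?_⟩, w3⟩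
    simpa [pt] using hcc
  have B2 : trOut X (pt 1 0 (1 - c)) → ∃ w, w < v ∧ w ∈ {u | pt 0 c u ∈ (Om ∩ {z | z.1 < c0}) ∩ J 0} := by
    intro hout
    rw [← p0s] at hout
    obtain ⟨q, q1, q2, q3, q4, q5, q6⟩ := near_start 0 (c := c) (b := v) hc0 hc1 hv'.1 k0 (Q := Xᶜ) hout
    obtain ⟨w, w1, w2, w3⟩ := f0 q v q2 q4 vO q5 hvK (fun hh => q6 (hh.mpr hv))
    refine ⟨w, w2, ⟨pt_mem_Om 0 hc0 (q1.trans w1) (w2.trans hv'.2), ?_⟩, w3⟩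
    simpa [pt] using hcc
  have one2 : (2:ENNReal) = 1 + 1 := by norm_num
  rcases h.bd 2 c hc0 hc1 e2 with s1 | s1 <;> rcases h.bd 1 (1 - c) (by linarith) (by linarith) e1 with s2 | s2
  · have a1 := A1 s1
    have a2 := A2 s2
    rw [one2]
    calc (1:ENNReal) + 1 ≤ _ := add_le_add a1 a2
      _ ≤ _ := by rw [add_assoc]; exact le_add_self
  · have a1 := A1 s1
    obtain ⟨w, -, hw⟩ := B2 s2
    have a2 : 1 ≤ NJ J (Om ∩ {z | z.1 < c0}) 0 c := one_le_cnt ⟨w, hw⟩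
    rw [one2]
    exact (add_le_add a2 a1).trans le_self_add
  · have a1 := A2 s2
    obtain ⟨w, -, hw⟩ := B1 s1
    have a2 : 1 ≤ NJ J (Om ∩ {z | z.1 < c0}) 0 c := one_le_cnt ⟨w, hw⟩
    rw [one2]
    refine (add_le_add a2 a1).trans ?_
    gcongr; exact le_self_add
  · obtain ⟨w, hw1, hw⟩ := B1 s1
    obtain ⟨w', hw1', hw'⟩ := B2 s2
    have a2 : 2 ≤ NJ J (Om ∩ {z | z.1 < c0}) 0 c := two_le_cnt hw hw' (by linarith)
    refine a2.trans ?_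
    rw [add_assoc]; exact le_self_add
end

section
variable {X K E : Set (ℝ × ℝ)} {J : Fin 3 → Set (ℝ × ℝ)} {P : Measure (ℝ × ℝ)}

lemma PD.left_lines (h : PD X K E J P) 
    (hmiss : ∀ c, 0 < c → c < 1 → pt 0 0 c ∉ E → trOut X (pt 0 0 c)) {c0 : ℝ} (hc0 : 0 < c0)
    (hK0 : {u | pt 0 c0 u ∈ K}.Finite) :
    (∀ᵐ y, y ∈ pset 0 X c0 → 1 ≤ NJ J (Om ∩ {z | z.1 < c0}) 1 y) ∧
    (∀ᵐ y, 1 - c0 - y ∈ pset 0 X c0 → 1 ≤ NJ J (Om ∩ {z | z.1 < c0}) 2 y) := by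
  have i0 : Function.Injective (fun c : ℝ => pt 0 0 c) := by intro a b hab; simpa [pt] using hab
  constructor
  · filter_upwards [h.fin 1, h.flip 1, ae_notMem_finite hK0, ae_notMem_E h.finE _ i0] with y k1 f1 hyK e0 hy
    have hy' := pset_sub 0 h.sub c0 hy
    have h1 := hy'.1
    have h2 := hy'.2
    have m0 := hmiss y h1 (by linarith) e0
    have p1e : pt 1 y (1 - y) = pt 0 0 y := by simp [pt]
    have p1m : pt 1 y (1 - y - c0) = pt 0 c0 y := by simp [pt]
    rw [← p1e] at m0
    obtain ⟨q, q1, q2, q3, q4, q5, q6⟩ := near_end 1 (c := y) (b := 1 - y - c0) (by linarith) (by linarith) (by linarith) k1 (Q := Xᶜ) m0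
    obtain ⟨w, w1, w2, w3⟩ := f1 _ q q2 (by rw [p1m]; exact h.sub hy) q4 (by rw [p1m]; exact hyK) q5 (fun hh => q6 (hh.mp (by rw [p1m]; exact hy)))
    apply one_le_cnt
    refine ⟨w, ⟨pt_mem_Om 1 (by linarith) (by linarith) (by linarith), ?_⟩, w3⟩
    simp [pt]; linarith
  · filter_upwards [h.fin 2, h.flip 2, ae_sub_left (1 - c0) (ae_notMem_finite hK0), ae_sub_left 1 (ae_notMem_E h.finE _ i0)] with y k1 f1 hyK e0 hy
    have hy' := pset_sub 0 h.sub c0 hy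
    have h1 := hy'.1
    have h2 := hy'.2
    have m0 := hmiss (1 - y) (by linarith) (by linarith) e0
    have p1e : pt 2 y 0 = pt 0 0 (1 - y) := by simp [pt]
    have p1m : pt 2 y c0 = pt 0 c0 (1 - c0 - y) := by simp [pt]; ring
    rw [← p1e] at m0
    obtain ⟨q, q1, q2, q3, q4, q5, q6⟩ := near_start 2 (c := y) (b := c0) (by linarith) (by linarith) (by linarith) k1 (Q := Xᶜ) m0
    obtain ⟨w, w1, w2, w3⟩ := f1 q _ q2 q4 (by rw [p1m]; exact h.sub hy) q5 (by rw [p1m]; exact hyK) (fun hh => q6 (hh.mpr (by rw [p1m]; exact hy)))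
    apply one_le_cnt
    refine ⟨w, ⟨pt_mem_Om 2 (by linarith) (by linarith) (by linarith), ?_⟩, w3⟩
    simp [pt]; linarith

def lowset (X : Set (ℝ × ℝ)) (c0 : ℝ) : Set ℝ := {c | c ∈ Ioo 0 1 ∧ c < c0 ∧ volume (pset 0 X c) ≠ 0}

lemma measurableSet_lowset (hX : IsOpen X) (c0) : MeasurableSet (lowset X c0) :=
  measurableSet_Ioo.inter (measurableSet_Iio.inter ((measurable_p hX (measurableSet_singleton 0)).compl))

lemma PD.left (h : PD X K E J P) 
    (hmiss : ∀ c, 0 < c → c < 1 → pt 0 0 c ∉ E → trOut X (pt 0 0 c)) {c0 : ℝ} (hc0 : 0 < c0)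
    (hK0 : {u | pt 0 c0 u ∈ K}.Finite) :
    volume (pset 0 X c0) + volume (lowset X c0) ≤ P (Om ∩ {z | z.1 < c0}) := by
  set B := Om ∩ {z : ℝ × ℝ | z.1 < c0} with hB
  have hm : MeasurableSet B :=
    isOpen_Om.measurableSet.inter (measurableSet_lt measurable_fst measurable_const)
  obtain ⟨l1, l2⟩ := h.left_lines hmiss hc0 hK0
  have l3 := h.left_point hmiss c0
  have h3 := h.le3 B hm
  rw [Fin.sum_univ_three] at h3
  set S := pset 0 X c0
  have hS : MeasurableSet S := (pset_open 0 h.op c0).measurableSet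
  have hSs : S ⊆ Ioo 0 (1 - c0) := pset_sub 0 h.sub c0
  have e1 : volume S + ∫⁻ y, (Ioi (1 - c0)).indicator (NJ J B 1) y ≤ ∫⁻ y, NJ J B 1 y := by
    rw [← lintegral_ind hS, ← lintegral_add_left (measurable_ind hS)]
    apply lintegral_mono_ae
    filter_upwards [l1] with y hy
    by_cases hyS : y ∈ S
    · have : y ∉ Ioi (1 - c0) := fun hh => absurd (hSs hyS).2 (not_lt.mpr (le_of_lt hh))
      rw [indicator_of_notMem this, ind, if_pos hyS, add_zero]
      exact hy hyS
    · rw [ind, if_neg hyS, zero_add]; exact indicator_le_self _ _ _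
  have e2 : volume S + ∫⁻ y, (Ioi (1 - c0)).indicator (NJ J B 2) y ≤ ∫⁻ y, NJ J B 2 y := by
    have hS' : MeasurableSet {y | 1 - c0 - y ∈ S} := (measurable_const.sub measurable_id) hS
    have hvol : volume S = volume {y | 1 - c0 - y ∈ S} :=
      ((Measure.measurePreserving_sub_left volume (1 - c0)).measure_preimage hS.nullMeasurableSet).symm
    rw [hvol, ← lintegral_ind hS', ← lintegral_add_left (measurable_ind hS')]
    apply lintegral_mono_ae
    filter_upwards [l2] with y hy
    by_cases hyS : 1 - c0 - y ∈ S
    · have : y ∉ Ioi (1 - c0) := fun hh => by have := (hSs hyS).1; simp at hh; linarith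
      rw [indicator_of_notMem this, ind, if_pos hyS, add_zero]
      exact hy hyS
    · rw [ind, if_neg hyS, zero_add]; exact indicator_le_self _ _ _
  have ms := Measure.measurePreserving_sub_left (volume : Measure ℝ) 1
  have g (k : Fin 3) : AEMeasurable ((Ioi (1 - c0)).indicator (NJ J B k)) := (h.meas k B hm).indicator measurableSet_Ioi
  have sw (k : Fin 3) : ∫⁻ y, (Ioi (1 - c0)).indicator (NJ J B k) y = ∫⁻ c, (Ioi (1 - c0)).indicator (NJ J B k) (1 - c) := by
    have := lintegral_map' (μ := volume) (f := (Ioi (1 - c0)).indicator (NJ J B k)) (g := fun c : ℝ => 1 - c) (by rw [ms.map_eq]; exact g k) ms.measurable.aemeasurable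
    rw [ms.map_eq] at this; exact this
  have gm (k : Fin 3) : AEMeasurable (fun c => (Ioi (1 - c0)).indicator (NJ J B k) (1 - c)) :=
    (g k).comp_quasiMeasurePreserving ms.quasiMeasurePreserving
  have hL := measurableSet_lowset h.op c0
  have e3 : 2 * volume (lowset X c0) ≤ (∫⁻ c, NJ J B 0 c) + (∫⁻ y, (Ioi (1 - c0)).indicator (NJ J B 1) y) + ∫⁻ y, (Ioi (1 - c0)).indicator (NJ J B 2) y := by
    rw [sw 1, sw 2, ← lintegral_add_left' (h.meas 0 B hm), ← lintegral_add_right' _ (gm 2), ← lintegral_ind hL, ← lintegral_const_mul _ (measurable_ind hL)]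
    apply lintegral_mono_ae
    filter_upwards [l3] with c hc
    by_cases hcS : c ∈ lowset X c0
    · have : 1 - c ∈ Ioi (1 - c0) := by have := hcS.2.1; simp; exact this
      rw [indicator_of_mem this, indicator_of_mem this, ind, if_pos hcS, mul_one]
      exact hc hcS.1 hcS.2.1 hcS.2.2
    · rw [ind, if_neg hcS, mul_zero]; exact zero_le
  have : 2 * (volume S + volume (lowset X c0)) ≤ 2 * P B := by
    refine le_trans ?_ h3
    calc 2 * (volume S + volume (lowset X c0)) = volume S + volume S + 2 * volume (lowset X c0) := by ring
      _ ≤ volume S + volume S + ((∫⁻ c, NJ J B 0 c) + (∫⁻ y, (Ioi (1 - c0)).indicator (NJ J B 1) y) + ∫⁻ y, (Ioi (1 - c0)).indicator (NJ J B 2) y) := by gcongr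
      _ = (∫⁻ c, NJ J B 0 c) + (volume S + ∫⁻ y, (Ioi (1 - c0)).indicator (NJ J B 1) y) + (volume S + ∫⁻ y, (Ioi (1 - c0)).indicator (NJ J B 2) y) := by ring
      _ ≤ _ := by gcongr
  rwa [ENNReal.mul_le_mul_iff_right (by norm_num) (by norm_num)] at this

lemma PD.plemma (h : PD X K E J P) 
    (hmiss : ∀ c, 0 < c → c < 1 → pt 0 0 c ∉ E → trOut X (pt 0 0 c)) :
    ∀ᵐ c0, 0 < c0 → volume (pset 0 X c0) + volume (nonfull X) ≤ P Om := by
  filter_upwards [h.fin 0] with c0 hK0 hc0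
  have e1 := h.left hmiss hc0 hK0
  have e2 := h.right (c0 := c0)
  have m1 : MeasurableSet (Om ∩ {z : ℝ × ℝ | c0 < z.1}) :=
    isOpen_Om.measurableSet.inter (measurableSet_lt measurable_const measurable_fst)
  have e3 : volume (nonfull X) ≤ volume (lowset X c0) + volume (nonfull X ∩ Ioi c0) := by
    have : nonfull X ⊆ (lowset X c0 ∪ (nonfull X ∩ Ioi c0)) ∪ {c0} := by
      intro c hc
      rcases lt_trichotomy c c0 with hh | hh | hh
      · exact Or.inl (Or.inl ⟨⟨hc.1, hc.2.1⟩, hh, hc.2.2.1⟩)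
      · exact Or.inr hh
      · exact Or.inl (Or.inr ⟨hc, hh⟩)
    calc _ ≤ _ := measure_mono this
      _ ≤ _ := measure_union_le _ _
      _ ≤ _ := by simp; exact measure_union_le _ _
  calc _ ≤ volume (pset 0 X c0) + (volume (lowset X c0) + volume (nonfull X ∩ Ioi c0)) := by gcongr
    _ ≤ P (Om ∩ {z | z.1 < c0}) + P (Om ∩ {z | c0 < z.1}) := by rw [← add_assoc]; gcongr
    _ = P ((Om ∩ {z | z.1 < c0}) ∪ (Om ∩ {z | c0 < z.1})) := by
      rw [measure_union _ m1]
      rw [Set.disjoint_left]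
      rintro z ⟨_, h1⟩ ⟨_, h2⟩
      simp at h1 h2; linarith
    _ ≤ _ := measure_mono (by rintro z (hz | hz) <;> exact hz.1)
end

section
variable {X Y K E : Set (ℝ × ℝ)} {J : Fin 3 → Set (ℝ × ℝ)} {P : Measure (ℝ × ℝ)}

def full (X : Set (ℝ × ℝ)) : Set ℝ := {c | c ∈ Ioo 0 1 ∧ volume (pset 0 X c) = ENNReal.ofReal (1 - c)}

lemma measurableSet_full (hX : IsOpen X) : MeasurableSet (full X) :=
  measurableSet_Ioo.inter (measurableSet_eq_fun (measurable_p hX) (by fun_prop))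

lemma lint_tri {M : ℝ} (hM : 0 ≤ M) : ∫⁻ c in Icc (1 - M) 1, ENNReal.ofReal (2 * (1 - c)) = ENNReal.ofReal (M ^ 2) := by
  have h1 : (1 - M) ≤ 1 := by linarith
  have hc : Continuous fun c : ℝ => 2 * (1 - c) := by fun_prop
  rw [← ofReal_integral_eq_lintegral_ofReal]
  · congr 1
    rw [integral_Icc_eq_integral_Ioc, ← intervalIntegral.integral_of_le h1]
    simp
    rw [intervalIntegral.integral_sub (by simp) (by simp)]
    simp; ring
  · exact hc.continuousOn.integrableOn_Icc
  · filter_upwards [ae_restrict_mem measurableSet_Icc] with c hc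
    have := hc.2
    simp; linarith

lemma area2 (hY : IsOpen Y) (hXO : X ⊆ Om) (hYO : Y ⊆ Om) (hd : Disjoint X Y) {M : ℝ} (hM : 0 ≤ M)
    (h1 : ∀ᵐ c, c ∈ Ioo 0 1 → volume (pset 0 X c) ≤ ENNReal.ofReal M)
    (h2 : ∀ᵐ c, c ∈ Ioo 0 1 → volume (pset 0 Y c) ≤ ENNReal.ofReal M) :
    (∫⁻ c in full X, ENNReal.ofReal (2 * (1 - c))) + (∫⁻ c in full Y, ENNReal.ofReal (2 * (1 - c))) ≤ ENNReal.ofReal (M ^ 2) := by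
  rw [← lint_tri hM, ← lintegral_union (measurableSet_full hY)]
  · apply lintegral_mono_set'
    filter_upwards [h1, h2] with c g1 g2 hc
    rcases hc with ⟨ha, hb⟩ | ⟨ha, hb⟩
    · have := g1 ha
      rw [hb, ENNReal.ofReal_le_ofReal_iff hM] at this
      exact ⟨by linarith, ha.2.le⟩
    · have := g2 ha
      rw [hb, ENNReal.ofReal_le_ofReal_iff hM] at this
      exact ⟨by linarith, ha.2.le⟩
  · rw [Set.disjoint_left]
    rintro c ⟨ha, hb⟩ ⟨-, hb'⟩
    have hdd : Disjoint (pset 0 X c) (pset 0 Y c) := by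
      rw [Set.disjoint_left]; intro u hu hu'; exact Set.disjoint_left.mp hd hu hu'
    have := measure_union (μ := volume) hdd (pset_open 0 hY c).measurableSet
    have h3 : volume (pset 0 X c ∪ pset 0 Y c) ≤ volume (Ioo 0 (1 - c)) :=
      measure_mono (union_subset (pset_sub 0 hXO c) (pset_sub 0 hYO c))
    rw [this, hb, hb', ← ENNReal.ofReal_add (by linarith [ha.2]) (by linarith [ha.2]), Real.volume_Ioo, ENNReal.ofReal_le_ofReal_iff (by linarith [ha.2])] at h3
    linarith [ha.2]

lemma PD.area (h : PD X K E J P) 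
    (hmiss : ∀ c, 0 < c → c < 1 → pt 0 0 c ∉ E → trOut X (pt 0 0 c)) (hP : P Om ≠ ⊤) :
    ∃ m Q : ℝ, 0 ≤ m ∧ 0 ≤ Q ∧ (P Om).toReal = m + Q ∧
      (∀ᵐ c, c ∈ Ioo 0 1 → volume (pset 0 X c) ≤ ENNReal.ofReal m) ∧
      2 * volume X ≤ (∫⁻ c in full X, ENNReal.ofReal (2 * (1 - c))) + ENNReal.ofReal (2 * m * Q) := by
  have hp := h.plemma hmiss
  have hNt : volume (nonfull X) ≠ ⊤ := by
    have : nonfull X ⊆ Ioo 0 1 := fun c hc => ⟨hc.1, hc.2.1⟩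
    exact ne_top_of_le_ne_top (by simp) (measure_mono this)
  set Q := (volume (nonfull X)).toReal with hQ
  have hNQ : volume (nonfull X) = ENNReal.ofReal Q := (ENNReal.ofReal_toReal hNt).symm
  have hpm : ∀ᵐ c, c ∈ Ioo (0:ℝ) 1 → volume (pset 0 X c) ≤ ENNReal.ofReal ((P Om).toReal - Q) := by
    filter_upwards [hp] with c hc hc'
    have := hc hc'.1
    rw [ENNReal.ofReal_sub _ ENNReal.toReal_nonneg, ENNReal.ofReal_toReal hP, ← hNQ]
    exact ENNReal.le_sub_of_add_le_right hNt this
  have hQP : Q ≤ (P Om).toReal := by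
    have hne : ∃ c0, (0 < c0 → volume (pset 0 X c0) + volume (nonfull X) ≤ P Om) ∧ 0 < c0 := by
      by_contra hh
      push Not at hh
      have : volume (Ioo (0:ℝ) 1) = 0 := by
        refine measure_mono_null ?_ hp
        intro c hc hc2
        exact absurd hc.1 (not_lt.mpr (hh c hc2))
      simp at this
    obtain ⟨c0, hc1, hc2⟩ := hne
    exact ENNReal.toReal_mono hP (le_add_self.trans (hc1 hc2))
  refine ⟨(P Om).toReal - Q, Q, by linarith, ENNReal.toReal_nonneg, by ring, hpm, ?_⟩
  set m := (P Om).toReal - Q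
  have hm0 : 0 ≤ m := by simp only [m]; linarith
  have hv : volume X = ∫⁻ c, volume (pset 0 X c) := by
    rw [Measure.volume_eq_prod, Measure.prod_apply h.op.measurableSet]; rfl
  have hF := measurableSet_full h.op
  have hN := measurableSet_nonfull h.op
  rw [hv, ← lintegral_const_mul _ (measurable_p h.op), ← lintegral_indicator hF]
  have e1 : ENNReal.ofReal (2 * m * Q) = ∫⁻ c, (nonfull X).indicator (fun _ => ENNReal.ofReal (2 * m)) c := by
    rw [lintegral_indicator hN, ENNReal.ofReal_mul (by linarith), ← hNQ]; simp
  rw [e1, ← lintegral_add_left (by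
    apply Measurable.indicator _ hF; fun_prop)]
  apply lintegral_mono_ae
  filter_upwards [hpm] with c hc
  by_cases h0 : volume (pset 0 X c) = 0
  · rw [h0]; simp
  have hcc : c ∈ Ioo (0:ℝ) 1 := by
    obtain ⟨u, hu⟩ := nonempty_of_measure_ne_zero h0
    have := (pt_Om_iff 0 c u).mp (h.sub hu)
    exact ⟨this.1, by linarith [this.2.1, this.2.2]⟩
  have := hc hcc
  by_cases hf : volume (pset 0 X c) = ENNReal.ofReal (1 - c)
  · have : c ∈ full X := ⟨hcc, hf⟩
    rw [indicator_of_mem this, hf, ENNReal.ofReal_mul (by norm_num)]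
    simp
  · have h' : c ∈ nonfull X := ⟨hcc.1, hcc.2, h0, hf⟩
    rw [indicator_of_mem h', ENNReal.ofReal_mul (by norm_num)]
    refine le_trans ?_ le_add_self
    simp only [ENNReal.ofReal_ofNat]
    gcongr

lemma le_of_sq' {w x : ℝ} (hx : 0 ≤ x) (h : w ^ 2 ≤ x ^ 2) : w ≤ x :=
  (le_abs_self w).trans (abs_le_of_sq_le_sq h hx)

lemma num_pair {b c x y z A : ℝ} (hb : 0 ≤ b) (hc : 0 ≤ c) (hb1 : b ≤ 0.34) (hc1 : c ≤ 0.34)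
    (hx : 0 ≤ x) (hy : 0 ≤ y) (hz : 0 ≤ z) (hx1 : b ≤ x ^ 2) (hx2 : 2 * (b - A) ≤ x ^ 2) (hA : 0 ≤ A)
    (hy1 : c + A ≤ y ^ 2) (hz1 : b + c ≤ z ^ 2) : 3 * (b + c) ≤ x + y + z := by
  by_cases hs : b + c ≤ 4 / 9
  · have h0 : (3 / 2 * (b + c)) ^ 2 ≤ b + c := by nlinarith
    have h1 : 3 / 2 * (b + c) ≤ z := le_of_sq' hz (h0.trans hz1)
    have h2 : 3 / 2 * (b + c) ≤ x + y := le_of_sq' (by linarith) (by nlinarith [mul_nonneg hx hy])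
    linarith
  push Not at hs
  have z1 : 0.666 + 0.668 * (b + c - 4 / 9) ≤ z := by
    apply le_of_sq' hz
    refine le_trans ?_ hz1
    nlinarith [mul_nonneg (sub_nonneg.mpr hs.le) (show 0 ≤ 0.68 - (b + c) by linarith)]
  have x1 : 0.583 - 1.106 * (0.34 - b) ≤ x := by
    apply le_of_sq' hx
    refine le_trans ?_ hx1
    nlinarith [mul_nonneg (show 0 ≤ b - 0.1044 by linarith) (show 0 ≤ 0.34 - b by linarith)]
  rcases le_or_gt (b / 4) A with hA' | hA'
  · have y1 : 0.6515 - 0.92 * (0.34 - c) - 0.2 * (0.34 - b) ≤ y := by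
      apply le_of_sq' hy
      refine le_trans ?_ hy1
      obtain ⟨u, rfl⟩ : ∃ u, b = 0.34 - u := ⟨0.34 - b, by ring⟩
      obtain ⟨v, rfl⟩ : ∃ v, c = 0.34 - v := ⟨0.34 - c, by ring⟩
      have hu : 0 ≤ u := by linarith
      have hv : 0 ≤ v := by linarith
      have huv : 0 ≤ 0.2356 - u - v := by linarith
      have g1 := mul_nonneg hu hv
      have g2 := mul_nonneg hu huv
      have g3 := mul_nonneg hv huv
      have : (0.6515 - 0.92 * (0.34 - (0.34 - v)) - 0.2 * (0.34 - (0.34 - u))) ^ 2 ≤ 0.34 - v + (0.34 - u) / 4 := by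
        linarith
      linarith
    linarith
  · have x2 : 0.714 - 1.37 * (0.34 - b) ≤ x := by
      apply le_of_sq' hx
      refine le_trans ?_ hx2
      nlinarith [mul_nonneg (show 0 ≤ b - 0.1044 by linarith) (show 0 ≤ 0.34 - b by linarith)]
    have y1 : 0.583 - 1.106 * (0.34 - c) ≤ y := by
      apply le_of_sq' hy
      refine le_trans ?_ hy1
      nlinarith [mul_nonneg (show 0 ≤ c - 0.1044 by linarith) (show 0 ≤ 0.34 - c by linarith)]
    linarith

/-- the pair lemma, side 0 -/
lemma pair0 {Z KX KY KZ EX EY EZ : Set (ℝ × ℝ)} {JX' JY JZ : Fin 3 → Set (ℝ × ℝ)} {PX PY PZ : Measure (ℝ × ℝ)}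
    (hX : PD X KX EX JX' PX) (hY : PD Y KY EY JY PY) (hZ : PD Z KZ EZ JZ PZ)
    (mX : ∀ c, 0 < c → c < 1 → pt 0 0 c ∉ EX → trOut X (pt 0 0 c))
    (mY : ∀ c, 0 < c → c < 1 → pt 0 0 c ∉ EY → trOut Y (pt 0 0 c))
    (mZ : ∀ c, 0 < c → c < 1 → pt 0 0 c ∉ EZ → trOut Z (pt 0 0 c))
    (fX : PX Om ≠ ⊤) (fY : PY Om ≠ ⊤) (fZ : PZ Om ≠ ⊤) (hd : Disjoint X Y)
    (hv : volume X + volume Y ≤ volume Z) {b c : ℝ} (hb : 0 ≤ b) (hc : 0 ≤ c) (hb1 : b ≤ 0.34) (hc1 : c ≤ 0.34)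
    (hbX : 2 * volume X = ENNReal.ofReal b) (hcY : 2 * volume Y = ENNReal.ofReal c) :
    3 * (b + c) ≤ (PX Om).toReal + (PY Om).toReal + (PZ Om).toReal := by
  obtain ⟨m1, Q1, a1, a2, a3, a4, a5⟩ := hX.area mX fX
  obtain ⟨m2, Q2, b1, b2, b3, b4, b5⟩ := hY.area mY fY
  obtain ⟨m3, Q3, c1, c2, c3, c4, c5⟩ := hZ.area mZ fZ
  have e1 := area2 isOpen_empty hX.sub (empty_subset _) (disjoint_empty _) a1 a4 (by simp [pset])
  have e2 := area2 isOpen_empty hY.sub (empty_subset _) (disjoint_empty _) b1 b4 (by simp [pset])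
  have e3 := area2 isOpen_empty hZ.sub (empty_subset _) (disjoint_empty _) c1 c4 (by simp [pset])
  have e12 := area2 hY.op hX.sub hY.sub hd (M := max m1 m2) (le_max_of_le_left a1)
    (by filter_upwards [a4] with c hc hh; exact (hc hh).trans (ENNReal.ofReal_le_ofReal (le_max_left _ _)))
    (by filter_upwards [b4] with c hc hh; exact (hc hh).trans (ENNReal.ofReal_le_ofReal (le_max_right _ _)))
  set A1 := ∫⁻ c in full X, ENNReal.ofReal (2 * (1 - c))
  set A2 := ∫⁻ c in full Y, ENNReal.ofReal (2 * (1 - c))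
  set A3 := ∫⁻ c in full Z, ENNReal.ofReal (2 * (1 - c))
  have e1' := le_self_add.trans e1
  have e2' := le_self_add.trans e2
  have e3' := le_self_add.trans e3
  obtain ⟨α1, p1, q1⟩ : ∃ α : ℝ, 0 ≤ α ∧ A1 = ENNReal.ofReal α :=
    ⟨A1.toReal, ENNReal.toReal_nonneg, (ENNReal.ofReal_toReal (ne_top_of_le_ne_top ENNReal.ofReal_ne_top e1')).symm⟩
  obtain ⟨α2, p2, q2⟩ : ∃ α : ℝ, 0 ≤ α ∧ A2 = ENNReal.ofReal α :=
    ⟨A2.toReal, ENNReal.toReal_nonneg, (ENNReal.ofReal_toReal (ne_top_of_le_ne_top ENNReal.ofReal_ne_top e2')).symm⟩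
  obtain ⟨α3, p3, q3⟩ : ∃ α : ℝ, 0 ≤ α ∧ A3 = ENNReal.ofReal α :=
    ⟨A3.toReal, ENNReal.toReal_nonneg, (ENNReal.ofReal_toReal (ne_top_of_le_ne_top ENNReal.ofReal_ne_top e3')).symm⟩
  have n1 : 0 ≤ 2 * m1 * Q1 := by positivity
  have n2 : 0 ≤ 2 * m2 * Q2 := by positivity
  have n3 : 0 ≤ 2 * m3 * Q3 := by positivity
  have c5' : ENNReal.ofReal b + ENNReal.ofReal c ≤ A3 + ENNReal.ofReal (2 * m3 * Q3) := by
    refine le_trans ?_ c5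
    rw [← hbX, ← hcY, ← mul_add]; gcongr
  rw [q1, hbX, ← ENNReal.ofReal_add p1 n1, ENNReal.ofReal_le_ofReal_iff (by linarith)] at a5
  rw [q2, hcY, ← ENNReal.ofReal_add p2 n2, ENNReal.ofReal_le_ofReal_iff (by linarith)] at b5
  rw [q3, ← ENNReal.ofReal_add hb hc, ← ENNReal.ofReal_add p3 n3, ENNReal.ofReal_le_ofReal_iff (by linarith)] at c5'
  rw [q1, ENNReal.ofReal_le_ofReal_iff (by positivity)] at e1'
  rw [q2, ENNReal.ofReal_le_ofReal_iff (by positivity)] at e2'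
  rw [q3, ENNReal.ofReal_le_ofReal_iff (by positivity)] at e3'
  rw [q1, q2, ← ENNReal.ofReal_add p1 p2, ENNReal.ofReal_le_ofReal_iff (by positivity)] at e12
  rw [a3, b3, c3]
  have s1 : 0 ≤ m1 ^ 2 - 2 * m1 * Q1 + Q1 ^ 2 := by rw [← sub_sq]; exact sq_nonneg _
  have s2 : 0 ≤ m2 ^ 2 - 2 * m2 * Q2 + Q2 ^ 2 := by rw [← sub_sq]; exact sq_nonneg _
  have t1 := sq_nonneg Q1
  have t2 := sq_nonneg Q2
  have t3 := sq_nonneg Q3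
  rcases le_total m1 m2 with hm | hm
  · rw [max_eq_right hm] at e12
    exact num_pair (A := α1) hb hc hb1 hc1 (by linarith) (by linarith) (by linarith) (by rw [add_sq]; linarith) (by rw [add_sq]; linarith) p1
      (by rw [add_sq]; linarith) (by rw [add_sq]; linarith)
  · rw [max_eq_left hm] at e12
    have := num_pair (b := c) (c := b) (x := m2 + Q2) (y := m1 + Q1) (z := m3 + Q3) (A := α2) hc hb hc1 hb1 (by linarith) (by linarith) (by linarith) (by rw [add_sq]; linarith) (by rw [add_sq]; linarith) p2
      (by rw [add_sq]; linarith) (by rw [add_sq]; linarith)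
    linarith
end

def rot (k : Fin 3) (z : ℝ × ℝ) : ℝ × ℝ := pt k z.1 z.2

lemma rot_pt (k j : Fin 3) (c u : ℝ) : rot k (pt j c u) = pt (k + j) c u := by
  fin_cases k <;> fin_cases j <;> simp [rot, pt] <;> ring

lemma rot_rot (k j : Fin 3) (z) : rot k (rot j z) = rot (k + j) z := rot_pt k j z.1 z.2

lemma rot_zero (z) : rot 0 z = z := by simp [rot, pt]

lemma rot_neg (k : Fin 3) (z) : rot (-k) (rot k z) = z := by rw [rot_rot]; simp [rot_zero]
lemma rot_neg' (k : Fin 3) (z) : rot k (rot (-k) z) = z := by rw [rot_rot]; simp [rot_zero]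

lemma continuous_rot (k : Fin 3) : Continuous (rot k) := by
  have : rot k = fun z => pt k z.1 z.2 := rfl
  rw [this]
  fin_cases k <;> simp [pt] <;> constructor <;> fun_prop

lemma rot_Om (k : Fin 3) (z) : rot k z ∈ Om ↔ z ∈ Om := by
  have h := pt_Om_iff k z.1 z.2
  have h0 := pt_Om_iff 0 z.1 z.2
  unfold rot
  rw [h, ← h0]; simp [pt]

lemma rot_mp (k : Fin 3) : MeasurePreserving (rot k) := by
  have h1 : MeasurePreserving (rot 1) := by
    have := MeasurePreserving.skew_product (μa := (volume : Measure ℝ)) (μc := (volume : Measure ℝ))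
      (μb := (volume : Measure ℝ)) (μd := (volume : Measure ℝ)) (MeasurePreserving.id _) (g := fun x y => 1 - x - y) (by fun_prop)
      (Eventually.of_forall fun x => (Measure.measurePreserving_sub_left volume (1 - x)).map_eq)
    have h2 := (Measure.measurePreserving_swap (μ := (volume : Measure ℝ)) (ν := (volume : Measure ℝ))).comp this
    exact h2
  fin_cases k
  · have : rot 0 = id := funext rot_zero
    simp only [Fin.zero_eta, this]; exact MeasurePreserving.id _
  · exact h1
  · have : rot 2 = rot 1 ∘ rot 1 := by
      funext z; rw [Function.comp, rot_rot]; rfl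
    have h3 := h1.comp h1
    rw [← this] at h3; exact h3

lemma trIn_rot (k : Fin 3) {X : Set (ℝ × ℝ)} {s} (h : trIn X (rot k s)) : trIn (rot k ⁻¹' X) s := by
  have : Tendsto (rot k) (𝓝[Om] s) (𝓝[Om] (rot k s)) := by
    apply tendsto_nhdsWithin_of_tendsto_nhds_of_eventually_within
    · exact ((continuous_rot k).tendsto s).mono_left nhdsWithin_le_nhds
    · filter_upwards [self_mem_nhdsWithin] with z hz; exact (rot_Om k z).mpr hz
  exact this.eventually h

lemma trOut_rot (k : Fin 3) {X : Set (ℝ × ℝ)} {s} (h : trOut X (rot k s)) : trOut (rot k ⁻¹' X) s :=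
  trIn_rot (X := Xᶜ) k h

section
variable {X K E : Set (ℝ × ℝ)} {J : Fin 3 → Set (ℝ × ℝ)} {P : Measure (ℝ × ℝ)}

lemma NJ_rot (k : Fin 3) (B : Set (ℝ × ℝ)) (j : Fin 3) (c : ℝ) :
    NJ (fun j => rot k ⁻¹' (J (k + j))) B j c = NJ J (rot (-k) ⁻¹' B) (k + j) c := by
  unfold NJ
  congr 1; ext u
  simp only [mem_ofPred_eq, mem_inter_iff, mem_preimage, rot_pt, neg_add_cancel_left]

lemma PD.rot (h : PD X K E J P) (k : Fin 3) :
    PD (rot k ⁻¹' X) (rot k ⁻¹' K) (rot k ⁻¹' E) (fun j => rot k ⁻¹' (J (k + j))) (P.map (_root_.rot (-k))) where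
  op := h.op.preimage (continuous_rot k)
  sub := fun z hz => (rot_Om k z).mp (h.sub hz)
  fin := fun j => by simpa only [mem_preimage, rot_pt] using h.fin (k + j)
  flip := fun j => by
    filter_upwards [h.flip (k + j)] with c hc p q
    have e1 := rot_Om k (pt j c p)
    have e2 := rot_Om k (pt j c q)
    rw [rot_pt] at e1 e2
    rw [← e1, ← e2]
    simpa only [mem_preimage, rot_pt] using hc p q
  meas := fun j B hB => by
    have : NJ (fun j => _root_.rot k ⁻¹' (J (k + j))) B j = NJ J (_root_.rot (-k) ⁻¹' B) (k + j) := funext (NJ_rot k B j)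
    rw [this]
    exact h.meas _ _ ((continuous_rot _).measurable hB)
  le1 := fun j B hB => by
    have hm := (continuous_rot (-k)).measurable
    simp_rw [NJ_rot]
    rw [Measure.map_apply hm hB]
    exact h.le1 _ _ (hm hB)
  le3 := fun B hB => by
    have hm := (continuous_rot (-k)).measurable
    simp_rw [NJ_rot]
    rw [Measure.map_apply hm hB]
    have := h.le3 _ (hm hB)
    rwa [← Equiv.sum_comp (Equiv.addLeft k)] at this
  finE := h.finE.preimage (Function.LeftInverse.injective (rot_neg k)).injOn
  bd := fun j c h0 h1 hE => by
    rw [mem_preimage, rot_pt] at hE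
    rcases h.bd (k + j) c h0 h1 hE with hh | hh
    · left; rw [← rot_pt] at hh; exact trIn_rot k hh
    · right; rw [← rot_pt] at hh; exact trOut_rot k hh
end

/-- `X` misses side `k` -/
def Miss (X E : Set (ℝ × ℝ)) (k : Fin 3) : Prop :=
  ∀ c, 0 < c → c < 1 → pt k 0 c ∉ E → trOut X (pt k 0 c)

lemma Miss.rot {X E : Set (ℝ × ℝ)} {k : Fin 3} (h : Miss X E k) : Miss (rot k ⁻¹' X) (rot k ⁻¹' E) 0 := by
  intro c h0 h1 hE
  rw [mem_preimage, rot_pt, add_zero] at hE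
  apply trOut_rot
  rw [rot_pt, add_zero]
  exact h c h0 h1 hE

lemma pairk (k : Fin 3) {X Y Z KX KY KZ EX EY EZ : Set (ℝ × ℝ)} {JX' JY JZ : Fin 3 → Set (ℝ × ℝ)} {PX PY PZ : Measure (ℝ × ℝ)}
    (hX : PD X KX EX JX' PX) (hY : PD Y KY EY JY PY) (hZ : PD Z KZ EZ JZ PZ)
    (mX : Miss X EX k) (mY : Miss Y EY k) (mZ : Miss Z EZ k)
    (fX : PX Om ≠ ⊤) (fY : PY Om ≠ ⊤) (fZ : PZ Om ≠ ⊤) (hd : Disjoint X Y)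
    (hv : volume X + volume Y ≤ volume Z) {b c : ℝ} (hb : 0 ≤ b) (hc : 0 ≤ c) (hb1 : b ≤ 0.34) (hc1 : c ≤ 0.34)
    (hbX : 2 * volume X = ENNReal.ofReal b) (hcY : 2 * volume Y = ENNReal.ofReal c) :
    3 * (b + c) ≤ (PX Om).toReal + (PY Om).toReal + (PZ Om).toReal := by
  have hO : rot (-k) ⁻¹' Om = Om := by ext z; exact rot_Om _ z
  have e (P : Measure (ℝ × ℝ)) : P.map (rot (-k)) Om = P Om := by
    rw [Measure.map_apply (continuous_rot _).measurable isOpen_Om.measurableSet, hO]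
  have ev {X : Set (ℝ × ℝ)} (hX : IsOpen X) : volume (rot k ⁻¹' X) = volume X :=
    (rot_mp k).measure_preimage hX.measurableSet.nullMeasurableSet
  have := pair0 (hX.rot k) (hY.rot k) (hZ.rot k) mX.rot mY.rot mZ.rot (by rwa [e]) (by rwa [e]) (by rwa [e])
    (hd.preimage _) (by rwa [ev hX.op, ev hY.op, ev hZ.op]) hb hc hb1 hc1 (by rwa [ev hX.op]) (by rwa [ev hY.op])
  rwa [e, e, e] at this

lemma nhds_start_neBot (k : Fin 3) {c : ℝ} (hc : 0 < c) (hc1 : c < 1) : (𝓝[Om] (pt k c 0)).NeBot :=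
  (tendsto_start k hc hc1).neBot

lemma pt_side (k : Fin 3) (c : ℝ) : pt k 0 c = pt (k + 2) (1 - c) 0 := by
  fin_cases k <;> simp [pt]

lemma trIn_not_trOut (k : Fin 3) {c : ℝ} (hc : 0 < c) (hc1 : c < 1) {X} (h : trIn X (pt k 0 c)) : ¬ trOut X (pt k 0 c) := by
  rw [pt_side] at *
  intro h2
  have := nhds_start_neBot (k + 2) (c := 1 - c) (by linarith) (by linarith)
  obtain ⟨z, hz, hz2⟩ := (h.and h2).exists
  exact hz2 hz

lemma trIn_open (X : Set (ℝ × ℝ)) : IsOpen {s | trIn X s} := by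
  rw [isOpen_iff_mem_nhds]
  intro s hs
  have := (eventually_nhdsWithin_iff.mp hs)
  filter_upwards [eventually_eventually_nhds.mpr this] with t ht
  exact eventually_nhdsWithin_iff.mpr ht

lemma line_tele (k : Fin 3) {K G : Set (ℝ × ℝ)} (hG : IsOpen G) (hf : frontier G ⊆ K) {c : ℝ} (hc : 0 < c) (hc1 : c < 1)
    (hK : {u | pt k c u ∈ K}.Finite) (hs : trIn G (pt k c 0) ∨ trOut G (pt k c 0))
    (he : trIn G (pt k c (1 - c)) ∨ trOut G (pt k c (1 - c))) :
    cnt {u | pt k c u ∈ K ∧ pt k c u ∈ Om ∧ jr {v | pt k c v ∈ G} u} + ind (trIn G (pt k c 0)) =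
    cnt {u | pt k c u ∈ K ∧ pt k c u ∈ Om ∧ jl {v | pt k c v ∈ G} u} + ind (trIn G (pt k c (1 - c))) := by
  obtain ⟨b, hb1, hb2, hb3⟩ := exists_gap_right hK 0 (b := (1 - c)) (by linarith)
  obtain ⟨a, ha1, ha2, ha3⟩ := exists_gap_left hK (1 - c) (a := b) hb2
  have s1 : ∃ p, 0 < p ∧ p < b ∧ (trIn G (pt k c 0) ↔ pt k c p ∈ G) := by
    rcases hs with h | h
    · obtain ⟨u, h1, h2, h3, h4, h5, h6⟩ := near_start k hc hc1 hb1 hK (Q := G) h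
      exact ⟨u, h1, h2, by simp [h, h6]⟩
    · obtain ⟨u, h1, h2, h3, h4, h5, h6⟩ := near_start k hc hc1 hb1 hK (Q := Gᶜ) h
      refine ⟨u, h1, h2, ?_⟩
      have : ¬ trIn G (pt k c 0) := by
        intro h'
        have := nhds_start_neBot k hc hc1
        obtain ⟨z, hz, hz2⟩ := (h.and h').exists
        exact hz hz2
      simp only [this, false_iff]; exact h6
  have s2 : ∃ q, a < q ∧ q < 1 - c ∧ (trIn G (pt k c (1 - c)) ↔ pt k c q ∈ G) := by
    rcases he with h | h
    · obtain ⟨u, h1, h2, h3, h4, h5, h6⟩ := near_end k hc hc1 ha2 hK (Q := G) h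
      exact ⟨u, h2, h3, by simp [h, h6]⟩
    · obtain ⟨u, h1, h2, h3, h4, h5, h6⟩ := near_end k hc hc1 ha2 hK (Q := Gᶜ) h
      refine ⟨u, h2, h3, ?_⟩
      have : ¬ trIn G (pt k c (1 - c)) := by
        intro h'
        have := (tendsto_end k hc hc1).neBot
        obtain ⟨z, hz, hz2⟩ := (h.and h').exists
        exact hz hz2
      simp only [this, false_iff]; exact h6
  obtain ⟨p, p1, p2, p3⟩ := s1
  obtain ⟨q, q1, q2, q3⟩ := s2
  have := (lc_line (isDir_pt k) hG hf c).tele hK (p := p) (q := q) (by linarith) (hb3 p ⟨p1, p2.le⟩) (ha3 q ⟨q1.le, q2⟩)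
  have e (R : ℝ → Prop) : {u | pt k c u ∈ K ∧ pt k c u ∈ Om ∧ R u} = {u | u ∈ {u | pt k c u ∈ K} ∧ (p < u ∧ u < q) ∧ R u} := by
    ext u
    simp only [mem_ofPred_eq]
    refine and_congr_right fun hu => and_congr_left fun _ => ?_
    rw [pt_Om_iff]
    constructor
    · rintro ⟨_, h1, h2⟩
      constructor
      · by_contra hh; push Not at hh; exact hb3 u ⟨h1, by linarith⟩ hu
      · by_contra hh; push Not at hh; exact ha3 u ⟨by linarith, h2⟩ hu
    · rintro ⟨h1, h2⟩; exact ⟨hc, by linarith, by linarith⟩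
  rw [e, e, p3, q3]
  exact this

lemma cnt_out (k : Fin 3) {K : Set (ℝ × ℝ)} {c : ℝ} (hc : c ∉ Ioo (0:ℝ) 1) (R : ℝ → Prop) :
    cnt {u | pt k c u ∈ K ∧ pt k c u ∈ Om ∧ R u} = 0 := by
  have : {u | pt k c u ∈ K ∧ pt k c u ∈ Om ∧ R u} = ∅ := by
    rw [eq_empty_iff_forall_notMem]
    rintro u ⟨_, h, _⟩
    rw [pt_Om_iff] at h
    exact hc ⟨h.1, by linarith [h.2.1, h.2.2]⟩
  rw [this, cnt_empty]

def sideIn (X : Set (ℝ × ℝ)) (k : Fin 3) : Set ℝ := {c | c ∈ Ioo 0 1 ∧ trIn X (pt k 0 c)}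

lemma cont_side (k : Fin 3) : Continuous fun c => pt k 0 c := (isDir_pt k).cont 0

lemma measurableSet_sideIn (X : Set (ℝ × ℝ)) (k : Fin 3) : MeasurableSet (sideIn X k) :=
  (isOpen_Ioo.inter ((trIn_open X).preimage (cont_side k))).measurableSet

lemma side_inj (k : Fin 3) : Function.Injective fun c => pt k 0 c := by
  intro a b hab
  fin_cases k <;> simp [pt] at hab <;> exact hab

section
variable {G : Fin 3 → Set (ℝ × ℝ)} {K E : Set (ℝ × ℝ)} {M : Fin 3 → Measure (ℝ × ℝ)}
    {M3 ν : Measure (ℝ × ℝ)}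

lemma case1 (h : Cfg G K M M3 ν) (hE : E.Finite)
    (hbd : ∀ k c, 0 < c → c < 1 → pt k 0 c ∉ E → ∃ i, trIn (G i) (pt k 0 c))
    (hm : ∀ k, Miss (G k) E k) : 1 ≤ ν.real Om := by
  have hms := isOpen_Om.measurableSet
  obtain ⟨h1, -, -⟩ := h.struct hms subset_rfl
  have bd : ∀ i k c, 0 < c → c < 1 → pt k 0 c ∉ E → trIn (G i) (pt k 0 c) ∨ trOut (G i) (pt k 0 c) := by
    intro i k c h0 h1 hcE
    obtain ⟨j, hj⟩ := hbd k c h0 h1 hcE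
    by_cases hij : i = j
    · left; rw [hij]; exact hj
    · right
      filter_upwards [hj] with z hz hz'
      exact Set.disjoint_left.mp (h.dj i j hij) hz' hz
  have q0 : ∀ c, pt 0 c 0 = pt 1 0 (1 - c) := by simp [pt]
  have q1 : ∀ c, pt 0 c (1 - c) = pt 2 0 c := by simp [pt]
  have q2 : ∀ c, pt 1 c 0 = pt 2 0 (1 - c) := by simp [pt]
  have q3 : ∀ c, pt 1 c (1 - c) = pt 0 0 c := by simp [pt]
  have E0 : M 0 (Om ∩ JR (ed 0) (G 1)) + ∫⁻ _c : ℝ, 0 = M 0 (Om ∩ JL (ed 0) (G 1)) + ∫⁻ c, ind (c ∈ sideIn (G 1) 2) := by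
    refine (h.hM 0).integ (isDir_pt 0) (h.op 1) hms _ _ measurable_const (measurable_ind (measurableSet_sideIn _ _)) ?_
    filter_upwards [(h.hM 0).ae_fin, ae_notMem_E hE _ (side_inj 2), ae_sub_left 1 (ae_notMem_E hE _ (side_inj 1))] with c hK e2 e1
    by_cases hc : c ∈ Ioo (0:ℝ) 1
    · have := line_tele 0 (h.op 1) (h.fr 1) hc.1 hc.2 hK (by rw [q0]; exact bd 1 1 _ (by linarith [hc.2]) (by linarith [hc.1]) e1)
        (by rw [q1]; exact bd 1 2 _ hc.1 hc.2 e2)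
      have n1 : ¬ trIn (G 1) (pt 0 c 0) := by
        intro hh
        rw [q0] at hh
        exact trIn_not_trOut 1 (by linarith [hc.2]) (by linarith [hc.1]) hh (hm 1 _ (by linarith [hc.2]) (by linarith [hc.1]) e1)
      rw [ind, if_neg n1, q1] at this
      rw [this]
      congr 2
      simp [sideIn, hc.1, hc.2]
    · rw [cnt_out 0 hc, cnt_out 0 hc, ind, if_neg (fun hh => hc hh.1)]
  have E1 : M 1 (Om ∩ JR (ed 1) (G 0)) + ∫⁻ c, ind (c ∈ (fun c => 1 - c) ⁻¹' sideIn (G 0) 2) = M 1 (Om ∩ JL (ed 1) (G 0)) + ∫⁻ _c : ℝ, 0 := by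
    refine (h.hM 1).integ (isDir_pt 1) (h.op 0) hms _ _ (measurable_ind ((measurable_const.sub measurable_id) (measurableSet_sideIn _ _))) measurable_const ?_
    filter_upwards [(h.hM 1).ae_fin, ae_sub_left 1 (ae_notMem_E hE _ (side_inj 2)), ae_notMem_E hE _ (side_inj 0)] with c hK e2 e1
    by_cases hc : c ∈ Ioo (0:ℝ) 1
    · have := line_tele 1 (h.op 0) (h.fr 0) hc.1 hc.2 hK (by rw [q2]; exact bd 0 2 _ (by linarith [hc.2]) (by linarith [hc.1]) e2)
        (by rw [q3]; exact bd 0 0 _ hc.1 hc.2 e1)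
      have n1 : ¬ trIn (G 0) (pt 1 c (1 - c)) := by
        intro hh
        rw [q3] at hh
        exact trIn_not_trOut 0 hc.1 hc.2 hh (hm 0 _ hc.1 hc.2 e1)
      rw [ind, ind, if_neg n1, q2] at this
      rw [← this, ind]
      congr 2
      simp [sideIn, hc.1, hc.2]
    · rw [cnt_out 1 hc, cnt_out 1 hc, ind, if_neg]
      intro hh
      have := hh.1
      exact hc ⟨by linarith [this.2], by linarith [this.1]⟩
  rw [lintegral_ind (measurableSet_sideIn _ _), lintegral_zero, add_zero] at E0
  have hpm : MeasurableSet ((fun c : ℝ => 1 - c) ⁻¹' sideIn (G 0) 2) := (measurable_const.sub measurable_id) (measurableSet_sideIn _ _)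
  rw [lintegral_ind hpm, lintegral_zero, add_zero, vol_sub_preimage] at E1
  have := fun k => (h.hM k).fin
  have fs (X : Set (ℝ × ℝ)) : volume (sideIn X 2) ≠ ⊤ :=
    ne_top_of_le_ne_top (by simp) (measure_mono (fun c hc => hc.1 : sideIn X 2 ⊆ Ioo 0 1))
  have r0 := congrArg ENNReal.toReal E0
  have r1 := congrArg ENNReal.toReal E1
  rw [ENNReal.toReal_add (by simp) (fs _)] at r0 r1
  have cover : (1:ENNReal) ≤ volume (sideIn (G 0) 2) + volume (sideIn (G 1) 2) := by
    refine le_trans ?_ (measure_union_le _ _)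
    have e : (1:ENNReal) = volume (Ioo (0:ℝ) 1) := by simp
    rw [e]
    apply measure_mono_ae
    filter_upwards [ae_notMem_E hE _ (side_inj 2)] with c e2 hc
    have hc' : c ∈ Ioo (0:ℝ) 1 := hc
    obtain ⟨i, hi⟩ := hbd 2 c hc'.1 hc'.2 e2
    fin_cases i
    · exact Or.inl ⟨hc', hi⟩
    · exact Or.inr ⟨hc', hi⟩
    · exact absurd (hm 2 c hc'.1 hc'.2 e2) (trIn_not_trOut 2 hc'.1 hc'.2 hi)
  have cr := ENNReal.toReal_mono (by simp [fs]) cover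
  rw [ENNReal.toReal_add (fs _) (fs _)] at cr
  simp only [ENNReal.toReal_one] at cr
  simp only [Measure.real] at h1 ⊢
  linarith
end

structure Core (G : Fin 3 → Set (ℝ × ℝ)) (K E : Set (ℝ × ℝ)) (M : Fin 3 → Measure (ℝ × ℝ))
    (M3 ν : Measure (ℝ × ℝ)) : Prop extends Cfg G K M M3 ν where
  bdK : closure Om \ Om ⊆ K
  dK : ∀ i, Disjoint (G i) K
  finE : E.Finite
  bd : ∀ k c, 0 < c → c < 1 → pt k 0 c ∉ E → ∃ i, trIn (G i) (pt k 0 c)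

/-- decomposition of `Om` minus a tripod contained in `G w` -/
structure Dec (w : Fin 3) (D : Fin 3 → Set (ℝ × ℝ)) (G : Fin 3 → Set (ℝ × ℝ)) (E : Set (ℝ × ℝ)) : Prop where
  op : ∀ k, IsOpen (D k)
  dj : ∀ i j, i ≠ j → Disjoint (D i) (D j)
  sub : ∀ k, D k ⊆ Om
  cov : ∀ z ∈ Om, z ∉ G w → ∃ k, z ∈ D k
  bd : ∀ k c, 0 < c → c < 1 → pt k 0 c ∉ E → ∃ i, trIn (D i) (pt k 0 c)
  miss : ∀ k, Miss (D k) E k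

section
variable {G D : Fin 3 → Set (ℝ × ℝ)} {K E : Set (ℝ × ℝ)} {M : Fin 3 → Measure (ℝ × ℝ)}
    {M3 ν : Measure (ℝ × ℝ)} {w : Fin 3}

lemma fr_aux (h : Core G K E M M3 ν) (hD : Dec w D G E) (S : Set (Fin 3)) (hw : w ∉ S) (k : Fin 3) :
    frontier ((⋃ i ∈ S, G i) ∩ D k) ⊆ K := by
  have hop : IsOpen ((⋃ i ∈ S, G i) ∩ D k) := (isOpen_biUnion fun i _ => h.op i).inter (hD.op k)
  rintro x ⟨hx, hx2⟩
  rw [hop.interior_eq] at hx2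
  by_cases hxO : x ∈ Om
  · rcases h.cov hxO with hh | hh
    · exact hh
    exfalso
    obtain ⟨j, hj⟩ := mem_iUnion.mp hh
    obtain ⟨y, hy1, hy2⟩ := mem_closure_iff.mp hx _ (h.op j) hj
    obtain ⟨i, hi, hyi⟩ := mem_iUnion₂.mp hy2.1
    have hij : i = j := by
      by_contra hne
      exact Set.disjoint_left.mp (h.dj i j hne) hyi hy1
    subst hij
    have hxw : x ∉ G w := fun hxw => by
      have : i ≠ w := fun e => hw (e ▸ hi)
      exact Set.disjoint_left.mp (h.dj i w this) hj hxw
    obtain ⟨l, hl⟩ := hD.cov x hxO hxw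
    obtain ⟨y', hy1', hy2'⟩ := mem_closure_iff.mp hx _ (hD.op l) hl
    have hlk : l = k := by
      by_contra hne
      exact Set.disjoint_left.mp (hD.dj l k hne) hy1' hy2'.2
    subst hlk
    exact hx2 ⟨mem_iUnion₂.mpr ⟨i, hi, hj⟩, hl⟩
  · exact h.bdK ⟨closure_mono (inter_subset_right.trans (hD.sub k)) hx, hxO⟩

/-- jump set data -/
def JD (i : Fin 3) (D K : Set (ℝ × ℝ)) (G : Fin 3 → Set (ℝ × ℝ)) (k : Fin 3) : Set (ℝ × ℝ) := K ∩ (D ∩ JX k (G i))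

noncomputable def PM (i : Fin 3) (D : Set (ℝ × ℝ)) (G : Fin 3 → Set (ℝ × ℝ)) (M : Fin 3 → Measure (ℝ × ℝ)) : Measure (ℝ × ℝ) :=
  (2⁻¹ : ENNReal) • ∑ k, (M k).restrict (D ∩ JX k (G i))

lemma PM_apply (i : Fin 3) (D : Set (ℝ × ℝ)) {B : Set (ℝ × ℝ)} (hB : MeasurableSet B) :
    PM i D G M B = 2⁻¹ * ∑ k, M k (B ∩ (D ∩ JX k (G i))) := by
  simp [PM, Measure.finsetSum_apply, Measure.restrict_apply hB]

/-- one sided limits along a line -/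
lemma jr_xor_of_flip (k : Fin 3) {X : Set (ℝ × ℝ)} (hX : IsOpen X) (hf : frontier X ⊆ K) {c p q : ℝ} (hK : {u | pt k c u ∈ K}.Finite)
    (hpq : p < q) (hp : pt k c p ∉ K) (hq : pt k c q ∉ K) (hne : ¬ (pt k c p ∈ X ↔ pt k c q ∈ X)) :
    ∃ u, p < u ∧ u < q ∧ pt k c u ∈ K ∧ ¬ (jr {v | pt k c v ∈ X} u ↔ jl {v | pt k c v ∈ X} u) := by
  by_contra hh
  push Not at hh
  have := (lc_line (isDir_pt k) hX hf c).tele hK hpq hp hq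
  have e : {u | u ∈ {u | pt k c u ∈ K} ∧ (p < u ∧ u < q) ∧ jr {v | pt k c v ∈ X} u} = {u | u ∈ {u | pt k c u ∈ K} ∧ (p < u ∧ u < q) ∧ jl {v | pt k c v ∈ X} u} := by
    ext u
    simp only [mem_ofPred_eq]
    refine and_congr_right fun h1 => and_congr_right fun h2 => hh u h2.1 h2.2 h1
  have hfin : cnt {u | u ∈ {u | pt k c u ∈ K} ∧ (p < u ∧ u < q) ∧ jl {v | pt k c v ∈ X} u} ≠ ⊤ := by
    unfold cnt
    have : {u | u ∈ {u | pt k c u ∈ K} ∧ (p < u ∧ u < q) ∧ jl {v | pt k c v ∈ X} u}.Finite := hK.subset fun u hu => hu.1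
    simpa using this
  rw [e, ENNReal.add_right_inj hfin] at this
  apply hne
  by_cases h1 : pt k c p ∈ X <;> by_cases h2 : pt k c q ∈ X <;> simp [ind, h1, h2] at this ⊢

lemma jr_congr {X Y : Set ℝ} {u : ℝ} (h : ∀ᶠ v in 𝓝 u, (v ∈ X ↔ v ∈ Y)) : jr X u ↔ jr Y u := by
  have t : Tendsto (fun n : ℕ => u + 1 / ((n:ℝ) + 1)) atTop (𝓝 u) := by
    simpa using (tendsto_one_div_add_atTop_nhds_zero_nat (𝕜 := ℝ)).const_add u
  exact eventually_congr (t.eventually h)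

lemma jl_congr {X Y : Set ℝ} {u : ℝ} (h : ∀ᶠ v in 𝓝 u, (v ∈ X ↔ v ∈ Y)) : jl X u ↔ jl Y u := by
  have t : Tendsto (fun n : ℕ => u - 1 / ((n:ℝ) + 1)) atTop (𝓝 u) := by
    simpa using (tendsto_one_div_add_atTop_nhds_zero_nat (𝕜 := ℝ)).const_sub u
  exact eventually_congr (t.eventually h)

lemma jr_false (u : ℝ) : ¬ jr ∅ u := by simp [jr]; exact fun x => ⟨x, le_rfl⟩
lemma jl_false (u : ℝ) : ¬ jl ∅ u := by simp [jl]; exact fun x => ⟨x, le_rfl⟩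

/-- main PD construction -/
lemma pd_aux (h : Core G K E M M3 ν) (hD : Dec w D G E) (S : Set (Fin 3)) (hw : w ∉ S) (k i : Fin 3)
    (hS : ∀ (l : Fin 3) (c u : ℝ), {u | pt l c u ∈ K}.Finite → pt l c u ∈ Om → 
      ¬ (pt l c u ∈ JR (ed l) (⋃ i ∈ S, G i) ↔ pt l c u ∈ JL (ed l) (⋃ i ∈ S, G i)) → pt l c u ∈ JX l (G i)) :
    PD ((⋃ i ∈ S, G i) ∩ D k) K E (JD i (D k) K G) (PM i (D k) G M) := by
  have hop : IsOpen ((⋃ i ∈ S, G i) ∩ D k) := (isOpen_biUnion fun i _ => h.op i).inter (hD.op k)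
  have hmD := (hD.op k).measurableSet
  have hmJ (l : Fin 3) := measurableSet_JX l (h.op i).measurableSet
  have hNJ (B : Set (ℝ × ℝ)) (l : Fin 3) (c : ℝ) : NJ (JD i (D k) K G) B l c = cnt {u | pt l c u ∈ K ∩ (B ∩ (D k ∩ JX l (G i)))} := by
    unfold NJ JD
    congr 1; ext u; simp only [mem_ofPred_eq, mem_inter_iff]; tauto
  have hI (B : Set (ℝ × ℝ)) (hB : MeasurableSet B) (l : Fin 3) : ∫⁻ c, NJ (JD i (D k) K G) B l c = M l (B ∩ (D k ∩ JX l (G i))) := by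
    simp_rw [hNJ]
    exact ((h.hM l).app _ (hB.inter (hmD.inter (hmJ l)))).symm
  have hle3 (B : Set (ℝ × ℝ)) (hB : MeasurableSet B) : ∑ l, M l (B ∩ (D k ∩ JX l (G i))) = 2 * PM i (D k) G M B := by
    rw [PM_apply i (D k) hB, ← mul_assoc, ENNReal.mul_inv_cancel (by norm_num) (by norm_num), one_mul]
  refine ⟨hop, inter_subset_right.trans (hD.sub k), fun l => (h.hM l).ae_fin, ?_, ?_, ?_, ?_, h.finE, ?_⟩
  · intro l
    filter_upwards [(h.hM l).ae_fin] with c hK p q hpq pO qO pK qK hne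
    obtain ⟨u, u1, u2, u3, u4⟩ := jr_xor_of_flip l hop (fr_aux h hD S hw k) hK hpq pK qK hne
    refine ⟨u, u1, u2, u3, ?_⟩
    have uO : pt l c u ∈ Om := by
      rw [pt_Om_iff] at pO qO ⊢
      exact ⟨pO.1, by linarith [pO.2.1], by linarith [qO.2.2]⟩
    have uw : pt l c u ∉ G w := fun hh => Set.disjoint_left.mp (h.dK w) hh u3
    obtain ⟨j, hj⟩ := hD.cov _ uO uw
    have hev : ∀ᶠ v in 𝓝 u, pt l c v ∈ D j := (cont_pt l c).continuousAt ((hD.op j).mem_nhds hj)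
    by_cases hjk : j = k
    · subst hjk
      refine ⟨hj, hS l c u hK uO ?_⟩
      have e : ∀ᶠ v in 𝓝 u, (v ∈ {v | pt l c v ∈ (⋃ i ∈ S, G i) ∩ D j} ↔ v ∈ {v | pt l c v ∈ (⋃ i ∈ S, G i)}) := by
        filter_upwards [hev] with v hv
        exact ⟨fun hh => hh.1, fun hh => ⟨hh, hv⟩⟩
      rw [jr_congr e, jl_congr e] at u4
      rwa [(isDir_pt l).JR_iff, (isDir_pt l).JL_iff]
    · exfalso
      have e : ∀ᶠ v in 𝓝 u, (v ∈ {v | pt l c v ∈ (⋃ i ∈ S, G i) ∩ D k} ↔ v ∈ (∅ : Set ℝ)) := by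
        filter_upwards [hev] with v hv
        simp only [mem_empty_iff_false, iff_false]
        exact fun hh => Set.disjoint_left.mp (hD.dj j k hjk) hv hh.2
      rw [jr_congr e, jl_congr e] at u4
      exact u4 (by simp [jr_false, jl_false])
  · intro l B hB
    have : NJ (JD i (D k) K G) B l = fun c => cnt {u | pt l c u ∈ K ∩ (B ∩ (D k ∩ JX l (G i)))} := funext (hNJ B l)
    rw [this]
    exact (h.hM l).meas _ (hB.inter (hmD.inter (hmJ l)))
  · intro l B hB
    rw [hI B hB]
    obtain ⟨-, -, h3⟩ := h.struct (hB.inter hmD) (inter_subset_right.trans (hD.sub k))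
    have h4 := h3 i l
    have fin := fun k => (h.hM k).fin
    have h5 : 2 * M l (B ∩ (D k ∩ JX l (G i))) ≤ 2 * PM i (D k) G M B := by
      rw [← hle3 B hB]
      simp only [inter_assoc, Measure.real] at h4
      rw [← ENNReal.toReal_sum (by simp), ← ENNReal.toReal_ofNat, ← ENNReal.toReal_mul] at h4
      rwa [ENNReal.toReal_le_toReal (ENNReal.mul_ne_top (by norm_num) (by simp)) (by simp)] at h4
    rwa [ENNReal.mul_le_mul_iff_right (by norm_num) (by norm_num)] at h5
  · intro B hB
    simp_rw [hI B hB, hle3 B hB]; exact le_rfl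
  · intro l c h0 h1 hcE
    obtain ⟨a, ha⟩ := h.bd l c h0 h1 hcE
    obtain ⟨b, hb⟩ := hD.bd l c h0 h1 hcE
    by_cases hbk : b = k
    · by_cases haS : a ∈ S
      · left
        filter_upwards [ha, hb] with z z1 z2
        exact ⟨mem_iUnion₂.mpr ⟨a, haS, z1⟩, hbk ▸ z2⟩
      · right
        filter_upwards [ha] with z z1
        rintro ⟨z2, -⟩
        obtain ⟨a', ha', z3⟩ := mem_iUnion₂.mp z2
        exact Set.disjoint_left.mp (h.dj a a' (fun e => haS (e ▸ ha'))) z1 z3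
    · right
      filter_upwards [hb] with z z1
      rintro ⟨-, z2⟩
      exact Set.disjoint_left.mp (hD.dj b k hbk) z1 z2

lemma all3 : ∀ w x y : Fin 3, x ≠ w → y ≠ w → x ≠ y → ∀ i, i = w ∨ i = x ∨ i = y := by decide

lemma sum3 {w x y : Fin 3} (hxw : x ≠ w) (hyw : y ≠ w) (hxy : x ≠ y) (f : Fin 3 → ℝ) : ∑ i, f i = f x + f y + f w := by
  have : (Finset.univ : Finset (Fin 3)) = {x, y, w} := by
    ext i; have := all3 w x y hxw hyw hxy i; simp; tauto
  rw [this, Finset.sum_insert (by simp [hxy, hxw]), Finset.sum_insert (by simp [hyw]), Finset.sum_singleton]; ring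

lemma case2k (h : Core G K E M M3 ν) (hD : Dec w D G E) (k : Fin 3) {x y : Fin 3} (hxw : x ≠ w) (hyw : y ≠ w) (hxy : x ≠ y)
    (h1 : 2 * volume (G x) ≤ ENNReal.ofReal 0.34) (h2 : 2 * volume (G y) ≤ ENNReal.ofReal 0.34) :
    3 * (2 * volume.real (G x ∩ D k) + 2 * volume.real (G y ∩ D k)) ≤ 2 * ν.real (D k) := by
  have fin := fun k => (h.hM k).fin
  have all : ∀ i : Fin 3, i = w ∨ i = x ∨ i = y := all3 _ _ _ hxw hyw hxy
  have PX := pd_aux h hD {x} (by simpa using hxw.symm) k x (by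
    intro l c u hK hO hne
    simp only [mem_singleton_iff, iUnion_iUnion_eq_left] at hne
    unfold JX; simp only [mem_union, Set.mem_sdiff]; tauto)
  have PY := pd_aux h hD {y} (by simpa using hyw.symm) k y (by
    intro l c u hK hO hne
    simp only [mem_singleton_iff, iUnion_iUnion_eq_left] at hne
    unfold JX; simp only [mem_union, Set.mem_sdiff]; tauto)
  have PZ := pd_aux h hD {x, y} (by simp [hxw.symm, hyw.symm]) k w (by
    intro l c u hK hO hne
    obtain ⟨P, hP⟩ := h.good_right (isDir_pt l) hK hO
    obtain ⟨Q, hQ⟩ := h.good_left (isDir_pt l) hK hO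
    have e1 : pt l c u ∈ JR (ed l) (⋃ i ∈ ({x, y} : Set (Fin 3)), G i) ↔ P ≠ w := by
      constructor
      · rintro hh rfl
        have := (hP P).mpr rfl
        obtain ⟨n, n1, n2⟩ := (Filter.Eventually.and hh this).exists
        obtain ⟨i, hi, n3⟩ := mem_iUnion₂.mp n1
        have : i ≠ P := by rcases hi with rfl | rfl <;> assumption
        exact Set.disjoint_left.mp (h.dj i P this) n3 n2
      · intro hh
        have := (hP P).mpr rfl
        have hPxy : P ∈ ({x, y} : Set (Fin 3)) := by rcases all P with e | e | e <;> simp_all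
        filter_upwards [this] with n hn
        exact mem_iUnion₂.mpr ⟨P, hPxy, hn⟩
    have e2 : pt l c u ∈ JL (ed l) (⋃ i ∈ ({x, y} : Set (Fin 3)), G i) ↔ Q ≠ w := by
      constructor
      · rintro hh rfl
        have := (hQ Q).mpr rfl
        obtain ⟨n, n1, n2⟩ := (Filter.Eventually.and hh this).exists
        obtain ⟨i, hi, n3⟩ := mem_iUnion₂.mp n1
        have : i ≠ Q := by rcases hi with rfl | rfl <;> assumption
        exact Set.disjoint_left.mp (h.dj i Q this) n3 n2
      · intro hh
        have := (hQ Q).mpr rfl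
        have hPxy : Q ∈ ({x, y} : Set (Fin 3)) := by rcases all Q with e | e | e <;> simp_all
        filter_upwards [this] with n hn
        exact mem_iUnion₂.mpr ⟨Q, hPxy, hn⟩
    rw [e1, e2] at hne
    have a1 := hP w
    have a2 := hQ w
    unfold JX; simp only [mem_union, Set.mem_sdiff, a1, a2]
    by_cases c1 : w = P <;> by_cases c2 : w = Q <;> simp_all [eq_comm])
  simp only [mem_singleton_iff, iUnion_iUnion_eq_left] at PX PY
  have ms : ∀ X : Set (ℝ × ℝ), Miss (X ∩ D k) E k := fun X c a b d => by
    filter_upwards [hD.miss k c a b d] with z hz hz2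
    exact hz hz2.2
  have hPMf : ∀ i, PM i (D k) G M Om ≠ ⊤ := by
    intro i
    rw [PM_apply i _ isOpen_Om.measurableSet]
    exact ENNReal.mul_ne_top (by simp) (by simp)
  have hd : Disjoint (G x ∩ D k) (G y ∩ D k) := (h.dj x y hxy).mono inter_subset_left inter_subset_left
  have vb : ∀ i, 2 * volume (G i) ≤ ENNReal.ofReal 0.34 → 2 * volume.real (G i ∩ D k) ≤ 0.34 ∧ 2 * volume (G i ∩ D k) = ENNReal.ofReal (2 * volume.real (G i ∩ D k)) := by
    intro i hi
    have h3 : 2 * volume (G i ∩ D k) ≤ ENNReal.ofReal 0.34 := le_trans (by gcongr; exact inter_subset_left) hi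
    have h4 : volume (G i ∩ D k) ≠ ⊤ := fun e => by rw [e] at h3; simp at h3
    constructor
    · have := ENNReal.toReal_mono ENNReal.ofReal_ne_top h3
      rw [ENNReal.toReal_mul, ENNReal.toReal_ofReal (by norm_num)] at this
      simpa [Measure.real] using this
    · rw [ENNReal.ofReal_mul (by norm_num), Measure.real, ENNReal.ofReal_toReal h4]; simp
  have := pairk k PX PY PZ (ms _) (ms _) (ms _) (hPMf _) (hPMf _) (hPMf _) hd (by
    rw [← measure_union hd ((h.op y).inter (hD.op k)).measurableSet]
    apply measure_mono
    rw [← union_inter_distrib_right]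
    apply inter_subset_inter_left
    simp) (by positivity) (by positivity) (vb x h1).1 (vb y h2).1 (vb x h1).2 (vb y h2).2
  refine this.trans ?_
  obtain ⟨-, h3, -⟩ := h.struct ((hD.op k).measurableSet) (hD.sub k)
  have e (i : Fin 3) : (PM i (D k) G M Om).toReal = 2⁻¹ * ∑ l, (M l).real (D k ∩ JX l (G i)) := by
    rw [PM_apply i _ isOpen_Om.measurableSet, ENNReal.toReal_mul, ENNReal.toReal_sum (by simp)]
    simp only [ENNReal.toReal_inv, ENNReal.toReal_ofNat]
    congr 1
    apply Finset.sum_congr rfl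
    intro l _
    have : Om ∩ (D k ∩ JX l (G i)) = D k ∩ JX l (G i) := inter_eq_right.mpr (inter_subset_left.trans (hD.sub k))
    rw [this]; rfl
  have s : ∑ i, ∑ l, (M l).real (D k ∩ JX l (G i)) = (∑ l, (M l).real (D k ∩ JX l (G x))) + (∑ l, (M l).real (D k ∩ JX l (G y))) + (∑ l, (M l).real (D k ∩ JX l (G w))) :=
    sum3 hxw hyw hxy _
  rw [s] at h3
  rw [e, e, e]
  linarith

lemma vol_split (hD : Dec w D G E) (hop : ∀ i, IsOpen (G i)) (x : Fin 3) (hx : G x ⊆ ⋃ k, D k) (hf : volume (G x) ≠ ⊤) : volume.real (G x) = ∑ k, volume.real (G x ∩ D k) := by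
  have : G x = ⋃ k, G x ∩ D k := by rw [← inter_iUnion]; exact (inter_eq_left.mpr hx).symm
  have h2 : volume (G x) = ∑ k, volume (G x ∩ D k) := by
    conv_lhs => rw [this]
    rw [measure_iUnion, tsum_fintype]
    · intro i j hij; exact (hD.dj i j hij).mono inter_subset_right inter_subset_right
    · intro i; exact ((hop x).inter (hD.op i)).measurableSet
  have h3 : ∀ k, volume (G x ∩ D k) ≠ ⊤ := fun k => ne_top_of_le_ne_top hf (measure_mono inter_subset_left)
  simp only [Measure.real]
  rw [h2, ENNReal.toReal_sum (fun k _ => h3 k)]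

lemma case2 (h : Core G K E M M3 ν) (hD : Dec w D G E) {x y : Fin 3} (hxw : x ≠ w) (hyw : y ≠ w) (hxy : x ≠ y)
    (h1 : 2 * volume (G x) ≤ ENNReal.ofReal 0.34) (h2 : 2 * volume (G y) ≤ ENNReal.ofReal 0.34) :
    3 * (volume.real (G x) + volume.real (G y)) ≤ ν.real Om := by
  have fin := h.fin
  have cov : ∀ i, i ≠ w → G i ⊆ ⋃ k, D k := by
    intro i hi z hz
    exact mem_iUnion.mpr (hD.cov z (h.sub i hz) (fun hh => Set.disjoint_left.mp (h.dj i w hi) hz hh))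
  have nt : ∀ i, 2 * volume (G i) ≤ ENNReal.ofReal 0.34 → volume (G i) ≠ ⊤ := fun i hi e => by rw [e] at hi; simp at hi
  rw [vol_split hD h.op x (cov x hxw) (nt x h1), vol_split hD h.op y (cov y hyw) (nt y h2)]
  have := fun k => case2k h hD k hxw hyw hxy h1 h2
  have sum : ∑ k, ν.real (D k) ≤ ν.real Om := by
    rw [← measureReal_iUnion_fintype (fun i j hij => hD.dj i j hij) (fun i => (hD.op i).measurableSet)]
    exact measureReal_mono (iUnion_subset hD.sub)
  have s2 := Finset.sum_le_sum (s := Finset.univ) (fun k _ => this k)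
  simp only [← Finset.mul_sum, Finset.sum_add_distrib] at s2
  linarith
end

lemma sin_trap {θ : ℝ → ℝ} (hc : Continuous θ) (h0 : 0 ≤ θ 0) (h1 : θ 0 ≤ Real.pi)
    (hs : ∀ t ∈ Icc (0:ℝ) 1, 0 ≤ Real.sin (θ t)) : θ 1 ∈ Icc 0 Real.pi := by
  have pp := Real.pi_pos
  constructor
  · by_contra hn
    push Not at hn
    have hm : max (θ 1) (-(Real.pi/2)) ∈ Icc (θ 1) (θ 0) := ⟨le_max_left _ _, max_le (by linarith) (by linarith)⟩
    obtain ⟨t, ht, e⟩ := intermediate_value_Icc' zero_le_one hc.continuousOn hm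
    have := hs t ht
    rw [e] at this
    exact absurd this (not_le.mpr (Real.sin_neg_of_neg_of_neg_pi_lt (max_lt hn (by linarith)) (lt_max_of_lt_right (by linarith))))
  · by_contra hn
    push Not at hn
    have hm : min (θ 1) (Real.pi + Real.pi/2) ∈ Icc (θ 0) (θ 1) := ⟨le_min (by linarith) (by linarith), min_le_left _ _⟩
    obtain ⟨t, ht, e⟩ := intermediate_value_Icc zero_le_one hc.continuousOn hm
    have := hs t ht
    rw [e, ← neg_nonpos, ← Real.sin_sub_pi] at this
    exact absurd this (not_le.mpr (Real.sin_pos_of_pos_of_lt_pi (by linarith [lt_min hn (show Real.pi < Real.pi + Real.pi/2 by linarith)]) (by linarith [min_le_right (θ 1) (Real.pi + Real.pi/2)])))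

lemma crossing {p q p' q' : ℝ} (hp : 0 < p) (hpq : p < q) (hpq' : q' < p')
    (γ : Path ((p, 0) : ℝ × ℝ) (0, p')) (δ : Path ((q, 0) : ℝ × ℝ) (0, q'))
    (hγ : ∀ t, 0 ≤ (γ t).1 ∧ 0 ≤ (γ t).2) (hδ : ∀ t, 0 ≤ (δ t).1 ∧ 0 ≤ (δ t).2) :
    ∃ s t, γ s = δ t := by
  by_contra hne
  push Not at hne
  have pp := Real.pi_pos
  let a : ℝ → ℝ × ℝ := fun s => γ.extend s
  let b : ℝ → ℝ × ℝ := fun s => δ.extend s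
  have ca : Continuous a := γ.extend.continuous
  have cb : Continuous b := δ.extend.continuous
  have ra : ∀ s, ∃ s', a s = γ s' := fun s => by
    have : a s ∈ range γ := by rw [← γ.extend_range]; exact ⟨s, rfl⟩
    obtain ⟨s', h⟩ := this; exact ⟨s', h.symm⟩
  have rb : ∀ s, ∃ s', b s = δ s' := fun s => by
    have : b s ∈ range δ := by rw [← δ.extend_range]; exact ⟨s, rfl⟩
    obtain ⟨s', h⟩ := this; exact ⟨s', h.symm⟩
  have pa : ∀ s, 0 ≤ (a s).1 ∧ 0 ≤ (a s).2 := fun s => by obtain ⟨s', h⟩ := ra s; rw [h]; exact hγ s'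
  have pb : ∀ s, 0 ≤ (b s).1 ∧ 0 ≤ (b s).2 := fun s => by obtain ⟨s', h⟩ := rb s; rw [h]; exact hδ s'
  have a0 : a 0 = (p, 0) := γ.extend_zero
  have a1 : a 1 = (0, p') := γ.extend_one
  have b0 : b 0 = (q, 0) := δ.extend_zero
  have b1 : b 1 = (0, q') := δ.extend_one
  let f : ℝ × ℝ → ℂ := fun z => ((a z.1).1 - (b z.2).1 : ℝ) + ((a z.1).2 - (b z.2).2 : ℝ) * Complex.I
  have fre : ∀ z, (f z).re = (a z.1).1 - (b z.2).1 := fun z => by simp [f]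
  have fim : ∀ z, (f z).im = (a z.1).2 - (b z.2).2 := fun z => by simp [f]
  have cf : Continuous f := by fun_prop
  have f0 : ∀ z, f z ≠ 0 := by
    intro z hz
    have h1 := fre z; have h2 := fim z
    rw [hz] at h1 h2
    simp at h1 h2
    obtain ⟨s, hs⟩ := ra z.1
    obtain ⟨t, ht⟩ := rb z.2
    apply hne s t
    rw [← hs, ← ht]
    exact Prod.ext (by linarith) (by linarith)
  obtain ⟨g, ⟨-, hg⟩, -⟩ := Complex.isCoveringMapOn_exp.existsUnique_continuousMap_lifts (⟨f, cf⟩ : C(ℝ × ℝ, ℂ)) (a₀ := (0,0)) (Complex.exp_log (f0 (0,0))) (fun x => f0 x)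
  have hg' : ∀ z, Complex.exp (g z) = f z := fun z => congrFun hg z
  let φ : ℝ × ℝ → ℝ := fun z => (g z).im - (g (0,0)).im
  have cφ : Continuous φ := by fun_prop
  have e00 : f (0,0) = ((p - q : ℝ) : ℂ) := by
    apply Complex.ext
    · rw [fre]; simp [a0, b0]
    · rw [fim]; simp [a0, b0]
  have c0 : Real.cos (g (0,0)).im = -1 ∧ Real.sin (g (0,0)).im = 0 := by
    have h1 := congrArg Complex.re (hg' (0,0))
    have h2 := congrArg Complex.im (hg' (0,0))
    rw [e00, Complex.exp_re] at h1
    rw [e00, Complex.exp_im] at h2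
    simp only [Complex.ofReal_re, Complex.ofReal_im] at h1 h2
    have pos := Real.exp_pos (g (0,0)).re
    have s0 : Real.sin (g (0,0)).im = 0 := by
      rcases mul_eq_zero.mp h2 with h | h
      · linarith
      · exact h
    refine ⟨?_, s0⟩
    have h3 := Real.sin_sq_add_cos_sq (g (0,0)).im
    have h4 : Real.cos (g (0,0)).im < 0 := by
      by_contra hh
      push Not at hh
      nlinarith [mul_nonneg pos.le hh]
    nlinarith
  have re : ∀ z, (f z).re = - (Real.exp (g z).re * Real.cos (φ z)) := by
    intro z
    rw [← hg', Complex.exp_re, Real.cos_sub, c0.1, c0.2]; ring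
  have im : ∀ z, (f z).im = - (Real.exp (g z).re * Real.sin (φ z)) := by
    intro z
    rw [← hg', Complex.exp_im, Real.sin_sub, c0.1, c0.2]; ring
  have cpos : ∀ z, 0 ≤ (f z).re → Real.cos (φ z) ≤ 0 := fun z h => by
    have := Real.exp_pos (g z).re; rw [re] at h; by_contra hh; push Not at hh; nlinarith [mul_pos this hh]
  have cpos' : ∀ z, 0 < (f z).re → Real.cos (φ z) < 0 := fun z h => by
    have := Real.exp_pos (g z).re; rw [re] at h; by_contra hh; push Not at hh; nlinarith [mul_nonneg this.le hh]
  have cneg : ∀ z, (f z).re ≤ 0 → 0 ≤ Real.cos (φ z) := fun z h => by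
    have := Real.exp_pos (g z).re; rw [re] at h; by_contra hh; push Not at hh; nlinarith [mul_neg_of_pos_of_neg this hh]
  have cneg' : ∀ z, (f z).re < 0 → 0 < Real.cos (φ z) := fun z h => by
    have := Real.exp_pos (g z).re; rw [re] at h; by_contra hh; push Not at hh; nlinarith [mul_nonpos_of_nonneg_of_nonpos this.le hh]
  have spos : ∀ z, 0 ≤ (f z).im → Real.sin (φ z) ≤ 0 := fun z h => by
    have := Real.exp_pos (g z).re; rw [im] at h; by_contra hh; push Not at hh; nlinarith [mul_pos this hh]
  have spos' : ∀ z, 0 < (f z).im → Real.sin (φ z) < 0 := fun z h => by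
    have := Real.exp_pos (g z).re; rw [im] at h; by_contra hh; push Not at hh; nlinarith [mul_nonneg this.le hh]
  have sneg : ∀ z, (f z).im ≤ 0 → 0 ≤ Real.sin (φ z) := fun z h => by
    have := Real.exp_pos (g z).re; rw [im] at h; by_contra hh; push Not at hh; nlinarith [mul_neg_of_pos_of_neg this hh]
  have φ0 : φ (0,0) = 0 := by simp [φ]
  have A1 := sin_trap (θ := fun t => φ (0,t)) (by fun_prop) (by simp [φ0]) (by simp [φ0, pp.le]) (fun t _ => sneg _ (by
    rw [fim]; simp only [a0]; linarith [(pb t).2]))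
  have A2 : Real.pi / 2 ≤ φ (0,1) := by
    by_contra hh
    push Not at hh
    have := cpos' (0,1) (by rw [fre]; simp only [a0, b1]; linarith)
    exact absurd (Real.cos_nonneg_of_neg_pi_div_two_le_of_le (by linarith [A1.1]) hh.le) (by linarith)
  have A3 := sin_trap (θ := fun s => φ (s,1) - Real.pi/2) (by fun_prop) (by linarith) (by linarith [A1.2]) (fun s _ => by
    simp only [Real.sin_sub_pi_div_two]
    linarith [cpos (s,1) (by rw [fre]; simp only [b1]; linarith [(pa s).1])])
  have B1 := sin_trap (θ := fun s => - φ (s,0)) (by fun_prop) (by simp [φ0]) (by simp [φ0, pp.le]) (fun s _ => by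
    rw [Real.sin_neg]
    linarith [spos (s,0) (by rw [fim]; simp only [b0]; linarith [(pa s).2])])
  have B2 : - φ (1,0) ≤ Real.pi / 2 := by
    by_contra hh
    push Not at hh
    have := cneg' (1,0) (by rw [fre]; simp only [a1, b0]; linarith)
    have h2 := Real.cos_nonpos_of_pi_div_two_le_of_le hh.le (by linarith [B1.2])
    rw [Real.cos_neg] at h2; linarith
  have B3 := sin_trap (θ := fun t => φ (1,t) + Real.pi/2) (by fun_prop) (by linarith) (by linarith [B1.1]) (fun t _ => by
    simp only [Real.sin_add_pi_div_two]
    exact cneg (1,t) (by rw [fre]; simp only [a1]; linarith [(pb t).1]))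
  have fin : φ (1,1) = Real.pi/2 := le_antisymm (by linarith [B3.2]) (by linarith [A3.1])
  have := spos' (1,1) (by rw [fim]; simp only [a1, b1]; linarith)
  rw [fin, Real.sin_pi_div_two] at this
  linarith

lemma convex_Om : Convex ℝ Om := by
  intro x hx y hy a b ha hb hab
  obtain ⟨h1, h2, h3⟩ := hx
  obtain ⟨h4, h5, h6⟩ := hy
  rcases ha.eq_or_lt with rfl | ha'
  · have : b = 1 := by linarith
    subst this; simpa using ⟨h4, h5, h6⟩
  · refine ⟨?_, ?_, ?_⟩ <;> simp only [Prod.fst_add, Prod.snd_add, Prod.smul_fst, Prod.smul_snd, smul_eq_mul] <;> nlinarith [mul_pos ha' h1, mul_pos ha' h2, mul_nonneg hb h4.le, mul_nonneg hb h5.le, mul_pos ha' (sub_pos.mpr h3), mul_nonneg hb (sub_pos.mpr h6).le]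

def CO : Set (ℝ × ℝ) := {z | 0 ≤ z.1 ∧ 0 ≤ z.2 ∧ z.1 + z.2 ≤ 1}

lemma Om_CO : Om ⊆ CO := fun _ h => ⟨h.1.le, h.2.1.le, h.2.2.le⟩

lemma rot_CO (k : Fin 3) {z} (h : z ∈ CO) : rot k z ∈ CO := by
  obtain ⟨h1, h2, h3⟩ := h
  fin_cases k <;> simp [rot, pt, CO] <;> (try constructor) <;> (try constructor) <;> linarith

lemma side_CO (k : Fin 3) {c : ℝ} (h : 0 < c) (h1 : c < 1) : pt k 0 c ∈ CO := by
  fin_cases k <;> simp [pt, CO] <;> (try constructor) <;> linarith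

lemma side_notMem (k : Fin 3) (c : ℝ) : pt k 0 c ∉ Om := fun h => lt_irrefl _ ((pt_Om_iff k 0 c).mp h).1

lemma cross_sides (k : Fin 3) {a b a' b' : ℝ} (ha : 0 < a) (hab : a < b) (hab' : a' < b') {F F' : Set (ℝ × ℝ)}
    (hF : F ⊆ CO) (hF' : F' ⊆ CO) (h : JoinedIn F (pt k 0 a) (pt (k + 1) 0 a')) (h' : JoinedIn F' (pt k 0 b) (pt (k + 1) 0 b')) :
    (F ∩ F').Nonempty := by
  obtain ⟨γ, hγ⟩ := h
  obtain ⟨δ, hδ⟩ := h'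
  let f : ℝ × ℝ → ℝ × ℝ := fun z => (rot (-k) z).swap
  have cf : Continuous f := continuous_swap.comp (continuous_rot _)
  have fi : Function.Injective f := by
    intro x y h
    have := Prod.swap_injective h
    rw [← rot_neg' k x, this, rot_neg']
  have f1 : ∀ c, f (pt k 0 c) = (c, 0) := fun c => by
    simp only [f]; rw [rot_pt]; simp [pt]
  have f2 : ∀ c, f (pt (k + 1) 0 c) = (0, 1 - c) := fun c => by
    simp only [f]; rw [rot_pt]; simp [pt]
  have nn : ∀ z ∈ CO, 0 ≤ (f z).1 ∧ 0 ≤ (f z).2 := fun z hz => by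
    have := rot_CO (-k) hz
    exact ⟨this.2.1, this.1⟩
  obtain ⟨s, t, e⟩ := crossing ha hab (show 1 - b' < 1 - a' by linarith) ((γ.map cf).cast (f1 a).symm (f2 a').symm) ((δ.map cf).cast (f1 b).symm (f2 b').symm) (fun t => nn _ (hF (hγ t))) (fun t => nn _ (hF' (hδ t)))
  have e2 : γ s = δ t := fi e
  exact ⟨γ s, hγ s, e2 ▸ hδ t⟩

lemma side_neBot (k : Fin 3) {c : ℝ} (hc : 0 < c) (hc1 : c < 1) : (𝓝[Om] (pt k 0 c)).NeBot := by
  rw [pt_side]; exact nhds_start_neBot (k + 2) (by linarith) (by linarith)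

lemma tr_ball {X : Set (ℝ × ℝ)} {s} (h : trIn X s) (hs : (𝓝[Om] s).NeBot) :
    ∃ A, IsOpen A ∧ Convex ℝ A ∧ A.Nonempty ∧ A ⊆ X ∧ A ⊆ Om ∧ A ∈ 𝓝[Om] s ∧ s ∈ closure A := by
  obtain ⟨r, hr, h2⟩ := Metric.mem_nhdsWithin_iff.mp h
  have hm : Metric.ball s r ∩ Om ∈ 𝓝[Om] s := inter_mem (mem_nhdsWithin_of_mem_nhds (Metric.ball_mem_nhds s hr)) self_mem_nhdsWithin
  refine ⟨Metric.ball s r ∩ Om, Metric.isOpen_ball.inter isOpen_Om, (convex_ball s r).inter convex_Om, hs.nonempty_of_mem hm, h2, inter_subset_right, hm, ?_⟩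
  rw [mem_closure_iff_clusterPt]
  exact hs.mono (le_inf nhdsWithin_le_nhds (le_principal_iff.mpr hm))

lemma tr_joined {X : Set (ℝ × ℝ)} {s} (h : trIn X s) (hs : (𝓝[Om] s).NeBot) : ∃ y ∈ X, JoinedIn (insert s X) s y := by
  obtain ⟨A, h1, h2, ⟨y, hy⟩, h4, -, -, h5⟩ := tr_ball h hs
  refine ⟨y, h4 hy, JoinedIn.of_segment_subset ?_⟩
  have := h2.openSegment_closure_interior_subset_interior h5 (h1.interior_eq.symm ▸ hy)
  rw [h1.interior_eq] at this
  rw [← insert_endpoints_openSegment]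
  intro z hz
  rcases hz with rfl | rfl | hz
  · exact mem_insert _ _
  · exact mem_insert_of_mem _ (h4 hy)
  · exact mem_insert_of_mem _ (h4 (this hz))

lemma tr_joined_all {X : Set (ℝ × ℝ)} (hX : IsPathConnected X) {s : Fin 3 → ℝ × ℝ} (h : ∀ k, trIn X (s k)) (hs : ∀ k, (𝓝[Om] (s k)).NeBot) (i j : Fin 3) :
    JoinedIn (X ∪ range s) (s i) (s j) := by
  have sub : ∀ i, insert (s i) X ⊆ X ∪ range s := fun i => insert_subset (Or.inr ⟨i, rfl⟩) subset_union_left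
  obtain ⟨x, hx, jx⟩ := tr_joined (h i) (hs i)
  obtain ⟨y, hy, jy⟩ := tr_joined (h j) (hs j)
  exact ((jx.mono (sub i)).trans ((hX.joinedIn x hx y hy).mono subset_union_left)).trans (jy.mono (sub j)).symm

def Tch (X E : Set (ℝ × ℝ)) (k : Fin 3) : Prop := ∃ c, 0 < c ∧ c < 1 ∧ pt k 0 c ∉ E ∧ trIn X (pt k 0 c)

lemma comp_pc {O : Set (ℝ × ℝ)} (hO : IsOpen O) {x} (hx : x ∈ O) : IsPathConnected (connectedComponentIn O x) :=
  hO.connectedComponentIn.isConnected_iff_isPathConnected.mp (isConnected_connectedComponentIn_iff.mpr hx)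

lemma group {O E : Set (ℝ × ℝ)} (hO : IsOpen O)
    (hb : ∀ k c, 0 < c → c < 1 → pt k 0 c ∉ E → trIn O (pt k 0 c))
    (hm : ∀ x ∈ O, ∃ k, ¬ Tch (connectedComponentIn O x) E k) :
    ∃ V : Fin 3 → Set (ℝ × ℝ), (∀ k, IsOpen (V k)) ∧ (∀ i j, i ≠ j → Disjoint (V i) (V j)) ∧ (⋃ k, V k) = O ∧
      (∀ k c, 0 < c → c < 1 → pt k 0 c ∉ E → ∃ i, trIn (V i) (pt k 0 c)) ∧ ∀ k, Miss (V k) E k := by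
  classical
  let f : Set (ℝ × ℝ) → Fin 3 := fun C => if h : ∃ k, ¬ Tch C E k then h.choose else 0
  have hf : ∀ x ∈ O, ¬ Tch (connectedComponentIn O x) E (f (connectedComponentIn O x)) := fun x hx => by
    simp only [f]; rw [dif_pos (hm x hx)]; exact (hm x hx).choose_spec
  let V : Fin 3 → Set (ℝ × ℝ) := fun k => {x | x ∈ O ∧ f (connectedComponentIn O x) = k}
  have sub : ∀ x ∈ O, connectedComponentIn O x ⊆ V (f (connectedComponentIn O x)) := fun x hx y hy =>
    ⟨connectedComponentIn_subset _ _ hy, by rw [connectedComponentIn_eq hy]⟩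
  have dj : ∀ i j, i ≠ j → Disjoint (V i) (V j) := fun i j hij => Set.disjoint_left.mpr fun x h1 h2 => hij (h1.2.symm.trans h2.2)
  have key : ∀ k c, 0 < c → c < 1 → pt k 0 c ∉ E → ∃ x ∈ O, trIn (connectedComponentIn O x) (pt k 0 c) := by
    intro k c hc hc1 hE
    obtain ⟨A, h1, h2, ⟨y, hy⟩, h4, -, h6, h5⟩ := tr_ball (hb k c hc hc1 hE) (side_neBot k hc hc1)
    exact ⟨y, h4 hy, mem_of_superset h6 (h2.isPreconnected.subset_connectedComponentIn hy h4)⟩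
  refine ⟨V, ?_, dj, ?_, ?_, ?_⟩
  · intro k
    rw [isOpen_iff_mem_nhds]
    rintro x ⟨hx, rfl⟩
    exact mem_of_superset (hO.connectedComponentIn.mem_nhds (mem_connectedComponentIn hx)) (sub x hx)
  · ext x; simp [V]
  · intro k c hc hc1 hE
    obtain ⟨x, hx, h⟩ := key k c hc hc1 hE
    exact ⟨_, mem_of_superset h (sub x hx)⟩
  · intro k c hc hc1 hE
    obtain ⟨x, hx, h⟩ := key k c hc hc1 hE
    have : f (connectedComponentIn O x) ≠ k := fun e => by
      have := hf x hx
      rw [e] at this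
      exact this ⟨c, hc, hc1, hE, h⟩
    filter_upwards [h] with z hz hz2
    exact Set.disjoint_left.mp (dj _ _ this) (sub x hx hz) hz2

lemma pigeon (P : Fin 3 → Prop) : ∃ k, (P k ↔ P (k + 1)) := by
  by_contra h
  push Not at h
  have h0 := h 0; have h1 := h 1; have h2 := h 2
  simp at h0 h1 h2
  tauto

section
variable {G : Fin 3 → Set (ℝ × ℝ)} {K E : Set (ℝ × ℝ)} {M : Fin 3 → Measure (ℝ × ℝ)} {M3 ν : Measure (ℝ × ℝ)} {w : Fin 3}

lemma tripod {W : Set (ℝ × ℝ)} (hE : E.Finite) (hWc : IsPathConnected W) (hWO : W ⊆ Om) (ht : ∀ k, Tch W E k) (hWG : W ⊆ G w) :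
    ∃ D F, F.Finite ∧ E ⊆ F ∧ Dec w D G F := by
  choose c c0 c1 cE ctr using ht
  let s : Fin 3 → ℝ × ℝ := fun k => pt k 0 (c k)
  have js := tr_joined_all hWc (s := s) ctr (fun k => side_neBot k (c0 k) (c1 k))
  obtain ⟨γ, hγ⟩ := js 0 1
  obtain ⟨δ, hδ⟩ := js 1 2
  set Y : Set (ℝ × ℝ) := range γ ∪ range δ with hY
  have cY : IsClosed Y := ((isCompact_range γ.continuous).union (isCompact_range δ.continuous)).isClosed
  have YW : Y ⊆ W ∪ range s := union_subset (range_subset_iff.mpr hγ) (range_subset_iff.mpr hδ)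
  have YCO : Y ⊆ CO := YW.trans (union_subset (hWO.trans Om_CO) (range_subset_iff.mpr fun k => side_CO k (c0 k) (c1 k)))
  have YO : ∀ z ∈ Om, z ∈ Y → z ∈ W := fun z hz hzY => by
    rcases YW hzY with h | ⟨k, rfl⟩
    · exact h
    · exact absurd hz (side_notMem k _)
  have jY : ∀ i j, JoinedIn Y (s i) (s j) := by
    have j01 : JoinedIn Y (s 0) (s 1) := ⟨γ, fun t => Or.inl ⟨t, rfl⟩⟩
    have j12 : JoinedIn Y (s 1) (s 2) := ⟨δ, fun t => Or.inr ⟨t, rfl⟩⟩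
    have j0 : ∀ i, JoinedIn Y (s 0) (s i) := by
      intro i
      fin_cases i
      · exact JoinedIn.refl j01.source_mem
      · exact j01
      · exact j01.trans j12
    exact fun i j => (j0 i).symm.trans (j0 j)
  set F := E ∪ range s with hF
  have sF : ∀ k, s k ∈ F := fun k => Or.inr ⟨k, rfl⟩
  have bdY : ∀ k a, pt k 0 a ∉ F → pt k 0 a ∉ Y := fun k a h h2 => by
    rcases YW h2 with h3 | h3
    · exact side_notMem k a (hWO h3)
    · exact h (Or.inr h3)
  have oO : IsOpen (Om \ Y) := isOpen_Om.sdiff cY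
  obtain ⟨D, D1, D2, D3, D4, D5⟩ := group (O := Om \ Y) (E := F) oO (fun k a _ _ h => by
      have : Yᶜ ∈ 𝓝[Om] (pt k 0 a) := mem_nhdsWithin_of_mem_nhds (cY.isOpen_compl.mem_nhds (bdY k a h))
      exact inter_mem self_mem_nhdsWithin this) (by
    intro x hx
    by_contra hcon
    push Not at hcon
    choose d d0 d1 dF dtr using hcon
    have jd := tr_joined_all (comp_pc oO hx) (s := fun k => pt k 0 (d k)) dtr (fun k => side_neBot k (d0 k) (d1 k))
    set Q := connectedComponentIn (Om \ Y) x ∪ range (fun k => pt k 0 (d k)) with hQ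
    have QCO : Q ⊆ CO := union_subset ((connectedComponentIn_subset _ _).trans (sdiff_subset.trans Om_CO)) (range_subset_iff.mpr fun k => side_CO k (d0 k) (d1 k))
    have hne : ∀ k, c k ≠ d k := fun k e => dF k (by rw [← e]; exact sF k)
    have hQY : ¬ (Y ∩ Q).Nonempty := by
      rintro ⟨z, hz, hz2 | ⟨k, rfl⟩⟩
      · exact (connectedComponentIn_subset _ _ hz2).2 hz
      · exact bdY k _ (dF k) hz
    obtain ⟨k, hk⟩ := pigeon (fun k => c k < d k)
    by_cases h : c k < d k
    · exact hQY (cross_sides k (c0 k) h (hk.mp h) YCO QCO (jY k (k+1)) (jd k (k+1)))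
    · have h2 : ¬ c (k+1) < d (k+1) := fun hh => h (hk.mpr hh)
      have h3 := lt_of_le_of_ne (not_lt.mp h) (hne k).symm
      have h4 := lt_of_le_of_ne (not_lt.mp h2) (hne (k+1)).symm
      have := cross_sides k (d0 k) h3 h4 QCO YCO (jd k (k+1)) (jY k (k+1))
      rw [inter_comm] at this
      exact hQY this)
  refine ⟨D, F, hE.union (finite_range s), subset_union_left, ⟨D1, D2, ?_, ?_, D4, D5⟩⟩
  · intro k
    exact (subset_iUnion D k).trans (D3 ▸ sdiff_subset)
  · intro z hz hzw
    have : z ∈ ⋃ k, D k := D3 ▸ ⟨hz, fun h => hzw (hWG (YO z hz h))⟩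
    exact mem_iUnion.mp this

theorem core_bound (h : Core G K E M M3 ν) (hv : ∀ i, 2 * volume (G i) ≤ ENNReal.ofReal 0.34) :
    1 ≤ ν.real Om ∨ ∃ x y, x ≠ y ∧ 3 * (volume.real (G x) + volume.real (G y)) ≤ ν.real Om := by
  have oO : IsOpen (⋃ i, G i) := isOpen_iUnion h.op
  have sO : (⋃ i, G i) ⊆ Om := iUnion_subset h.sub
  by_cases hc : ∀ x ∈ ⋃ i, G i, ∃ k, ¬ Tch (connectedComponentIn (⋃ i, G i) x) E k
  · left
    obtain ⟨V, V1, V2, V3, V4, V5⟩ := group oO (fun k c hc hc1 hE => by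
      obtain ⟨i, hi⟩ := h.bd k c hc hc1 hE
      exact mem_of_superset hi (subset_iUnion G i)) hc
    have VO : ∀ k, V k ⊆ Om := fun k => (subset_iUnion V k).trans (V3 ▸ sO)
    have cfg : Cfg V K M M3 ν := ⟨V1, V2, VO, by rw [V3]; exact h.cov, ?_, h.hM, h.hM3, h.le, h.fin⟩
    · exact case1 cfg h.finE V4 V5
    · rintro i x ⟨hx, hx2⟩
      rw [(V1 i).interior_eq] at hx2
      by_cases hxO : x ∈ Om
      · rcases h.cov hxO with hh | hh
        · exact hh
        exfalso
        rw [← V3] at hh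
        obtain ⟨j, hj⟩ := mem_iUnion.mp hh
        obtain ⟨y, hy1, hy2⟩ := mem_closure_iff.mp hx _ (V1 j) hj
        have hij : i ≠ j := fun e => hx2 (e ▸ hj)
        exact Set.disjoint_left.mp (V2 i j hij) hy2 hy1
      · exact h.bdK ⟨closure_mono (VO i) hx, hxO⟩
  · right
    push Not at hc
    obtain ⟨x, hx, hx2⟩ := hc
    obtain ⟨w, hw⟩ := mem_iUnion.mp hx
    have WG : connectedComponentIn (⋃ i, G i) x ⊆ G w := by
      apply isPreconnected_connectedComponentIn.subset_left_of_subset_union (h.op w) (v := ⋃ j, ⋃ (_ : j ≠ w), G j) (isOpen_iUnion fun j => isOpen_iUnion fun _ => h.op j)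
      · simp only [Set.disjoint_iUnion_right]
        exact fun j hj => h.dj w j hj.symm
      · refine (connectedComponentIn_subset _ _).trans (iUnion_subset fun j => ?_)
        by_cases e : j = w
        · subst e; exact subset_union_left
        · exact subset_union_of_subset_right (subset_iUnion₂ (s := fun j (_ : j ≠ w) => G j) j e) _
      · exact ⟨x, mem_connectedComponentIn hx, hw⟩
    obtain ⟨D, F, hF, hEF, hD⟩ := tripod h.finE (comp_pc oO hx) ((connectedComponentIn_subset _ _).trans sO) hx2 WG
    have h' : Core G K F M M3 ν := ⟨h.toCfg, h.bdK, h.dK, hF, fun k c h0 h1 hn => h.bd k c h0 h1 (fun hh => hn (hEF hh))⟩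
    obtain ⟨x, y, hxw, hyw, hxy⟩ : ∃ x y : Fin 3, x ≠ w ∧ y ≠ w ∧ x ≠ y := by
      clear * -; revert w; decide
    exact ⟨x, y, hxy, case2 h' hD hxw hyw hxy (hv x) (hv y)⟩
end

lemma sliceM_of (Λ : (ℝ × ℝ) ≃ₜ (ℝ × ℝ)) {L : ℝ → ℝ → ℝ × ℝ} (hL : ∀ c u, Λ (c, u) = L c u) {K : Set (ℝ × ℝ)} (hK : IsCompact K)
    (ν : Measure (ℝ × ℝ)) [IsFiniteMeasure ν] (hν : ∀ A ⊆ K, IsCompact A → volume ((fun z => (Λ.symm z).1) '' A) ≤ ν A) :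
    ∃ M, SliceM L K M ∧ ∀ B, MeasurableSet B → M B ≤ ν B := by
  have mΛ : Measurable Λ := Λ.continuous.measurable
  have mΛ' : Measurable Λ.symm := Λ.symm.continuous.measurable
  have pm : ∀ A, MeasurableSet A → (ν.map Λ.symm) A = ν (Λ '' A) := fun A hA => by
    rw [Measure.map_apply mΛ' hA]; exact congrArg ν (Λ.toEquiv.image_eq_preimage_symm A).symm
  obtain ⟨μ, h1, h2, h3⟩ := slice (Λ ⁻¹' K) (Λ.isCompact_preimage.mpr hK) (ν.map Λ.symm) (by
    intro A hA hAc
    rw [pm A hAc.measurableSet]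
    convert hν (Λ '' A) (image_subset_iff.mpr hA) (hAc.image Λ.continuous) using 2
    rw [image_image]; simp)
  have e : ∀ B c, {u | (c, u) ∈ Λ ⁻¹' K ∩ Λ ⁻¹' B} = {u | L c u ∈ K ∩ B} := fun B c => by
    ext u; simp [hL]
  refine ⟨μ.map Λ, ⟨⟨?_⟩, ?_, ?_, ?_⟩, ?_⟩
  · rw [Measure.map_apply mΛ .univ]
    exact (h1 _ (mΛ .univ)).trans_lt (measure_lt_top _ _)
  · filter_upwards [h2] with c hc
    simpa [hL] using hc
  · intro B hB
    have := (h3 _ (mΛ hB)).1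
    simpa only [e] using this
  · intro B hB
    have := (h3 _ (mΛ hB)).2
    rw [Measure.map_apply mΛ hB]
    simpa only [e] using this
  · intro B hB
    rw [Measure.map_apply mΛ hB]
    refine (h1 _ (mΛ hB)).trans ?_
    rw [pm _ (mΛ hB), image_preimage_eq _ Λ.surjective]

def rotH (k : Fin 3) : (ℝ × ℝ) ≃ₜ (ℝ × ℝ) where
  toFun := rot k
  invFun := rot (-k)
  left_inv := rot_neg k
  right_inv := rot_neg' k
  continuous_toFun := continuous_rot k
  continuous_invFun := continuous_rot (-k)

def pdH : (ℝ × ℝ) ≃ₜ (ℝ × ℝ) where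
  toFun := fun z => (z.2, z.2 + z.1)
  invFun := fun z => (z.2 - z.1, z.1)
  left_inv := fun z => by simp
  right_inv := fun z => by simp
  continuous_toFun := by fun_prop
  continuous_invFun := by fun_prop

section
variable {P : Type*} [MetricSpace P] [MeasurableSpace P] [BorelSpace P]

noncomputable def nuH (Θ : (ℝ × ℝ) ≃ₜ P) (K : Set (ℝ × ℝ)) (ρ : NNReal) : Measure (ℝ × ℝ) :=
  ρ • ((μH[1].restrict (Θ '' K)).map Θ.symm)

lemma nuH_apply (Θ : (ℝ × ℝ) ≃ₜ P) {K : Set (ℝ × ℝ)} (ρ : NNReal) {B : Set (ℝ × ℝ)} (hB : MeasurableSet B) :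
    nuH Θ K ρ B = ρ * μH[1] (Θ '' (B ∩ K)) := by
  have m : Measurable Θ.symm := Θ.symm.continuous.measurable
  have e : Θ.symm ⁻¹' B = Θ '' B := (Θ.toEquiv.image_eq_preimage_symm B).symm
  rw [nuH, Measure.smul_apply, Measure.map_apply m hB, Measure.restrict_apply (m hB), e, ← image_inter Θ.injective]
  rfl

lemma nuH_fin (Θ : (ℝ × ℝ) ≃ₜ P) {K : Set (ℝ × ℝ)} (ρ : NNReal) (hf : μH[1] (Θ '' K) ≠ ⊤) : IsFiniteMeasure (nuH Θ K ρ) := by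
  constructor
  rw [nuH_apply _ _ .univ, univ_inter]
  exact ENNReal.mul_lt_top (by simp) (lt_top_iff_ne_top.mpr hf)

lemma sliceH (Θ : (ℝ × ℝ) ≃ₜ P) {K : Set (ℝ × ℝ)} (hK : IsCompact K) (hf : μH[1] (Θ '' K) ≠ ⊤) (ρ : NNReal)
    (Λ : (ℝ × ℝ) ≃ₜ (ℝ × ℝ)) {L : ℝ → ℝ → ℝ × ℝ} (hL : ∀ c u, Λ (c, u) = L c u)
    (hlip : ∀ z w, |(Λ.symm z).1 - (Λ.symm w).1| ≤ ρ * dist (Θ z) (Θ w)) :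
    ∃ M, SliceM L K M ∧ ∀ B, MeasurableSet B → M B ≤ nuH Θ K ρ B := by
  have := nuH_fin Θ ρ hf
  apply sliceM_of Λ hL hK
  intro A hA hAc
  rw [nuH_apply _ _ hAc.measurableSet, inter_eq_left.mpr hA]
  have lip : LipschitzWith ρ (fun p => (Λ.symm (Θ.symm p)).1) := LipschitzWith.of_dist_le_mul fun x y => by
    rw [Real.dist_eq]
    simpa using hlip (Θ.symm x) (Θ.symm y)
  have h := lip.hausdorffMeasure_image_le zero_le_one (Θ '' A)
  rw [hausdorffMeasure_real, ENNReal.rpow_one, image_image] at h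
  simpa using h

lemma vol_Om : volume Om = ENNReal.ofReal (1/2) := by
  have e : Om = regionBetween (fun _ => 0) (fun x : ℝ => 1 - x) (Ioo 0 1) := by
    ext z; simp only [Om, regionBetween, mem_ofPred_eq, mem_Ioo]
    constructor
    · rintro ⟨h1, h2, h3⟩; exact ⟨⟨h1, by linarith⟩, h2, by linarith⟩
    · rintro ⟨⟨h1, h4⟩, h2, h3⟩; exact ⟨h1, h2, by linarith⟩
  have ii : IntegrableOn (fun x : ℝ => 1 - x) (Ioo 0 1) := 
    ((continuous_const.sub continuous_id).integrableOn_Icc (a := (0:ℝ)) (b := 1)).mono_set Ioo_subset_Icc_self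
  rw [e, Measure.volume_eq_prod, volume_regionBetween_eq_integral (by simp) ii measurableSet_Ioo (fun x hx => by linarith [hx.2])]
  congr 1
  rw [← integral_Ioc_eq_integral_Ioo, ← intervalIntegral.integral_of_le zero_le_one]
  simp only [Pi.sub_apply, sub_zero]
  rw [intervalIntegral.integral_sub (by simp) (by simp)]
  simp
  norm_num

lemma closed_CO : IsClosed CO := by
  have h1 : IsClosed {z : ℝ × ℝ | 0 ≤ z.1} := isClosed_le (by fun_prop) (by fun_prop)
  have h2 : IsClosed {z : ℝ × ℝ | 0 ≤ z.2} := isClosed_le (by fun_prop) (by fun_prop)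
  have h3 : IsClosed {z : ℝ × ℝ | z.1 + z.2 ≤ 1} := isClosed_le (by fun_prop) (by fun_prop)
  exact h1.inter (h2.inter h3)

lemma compact_CO : IsCompact CO := by
  apply (isCompact_Icc (a := ((0:ℝ), (0:ℝ))) (b := (1, 1))).of_isClosed_subset closed_CO
  rintro z ⟨h1, h2, h3⟩
  exact ⟨⟨h1, h2⟩, ⟨by simp only; linarith, by simp only; linarith⟩⟩

lemma null_of_slice {K : Set (ℝ × ℝ)} (hK : MeasurableSet K) (h : ∀ᵐ c, {u | (c, u) ∈ K}.Finite) : volume K = 0 := by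
  rw [Measure.volume_eq_prod, Measure.measure_prod_null hK]
  filter_upwards [h] with c hc
  exact hc.measure_zero _

theorem lower_step (Θ : (ℝ × ℝ) ≃ₜ P) (ρ ρ3 : NNReal)
    (hlip : ∀ k z w, |(rot (-k) z).1 - (rot (-k) w).1| ≤ ρ * dist (Θ z) (Θ w))
    (hlip3 : ∀ z w : ℝ × ℝ, |(z.2 - z.1) - (w.2 - w.1)| ≤ ρ3 * dist (Θ z) (Θ w))
    (H : Fin 3 → Set (ℝ × ℝ)) (Hop : ∀ i, IsOpen (H i)) (Hdj : ∀ i j, i ≠ j → ∀ z ∈ CO, z ∈ H i → z ∉ H j)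
    (hfin : μH[1] (Θ '' (CO \ ⋃ i, H i)) ≠ ⊤) (hbfin : μH[1] (Θ '' (CO \ Om)) ≠ ⊤)
    (hE : {s | s ∈ (CO \ Om) \ ⋃ i, H i}.Finite)
    (hv : ∀ i, 2 * volume (H i ∩ Om) ≤ ENNReal.ofReal 0.34) :
    1 ≤ ρ * (μH[1] (Θ '' (Om \ ⋃ i, H i))).toReal ∨
      ∃ w, 3 * (1/2 - volume.real (H w ∩ Om)) ≤ ρ * (μH[1] (Θ '' (Om \ ⋃ i, H i))).toReal := by
  set G : Fin 3 → Set (ℝ × ℝ) := fun i => H i ∩ Om with hG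
  have Gop : ∀ i, IsOpen (G i) := fun i => (Hop i).inter isOpen_Om
  have Gdj : ∀ i j, i ≠ j → Disjoint (G i) (G j) := fun i j hij => Set.disjoint_left.mpr fun z h1 h2 => Hdj i j hij z (Om_CO h1.2) h1.1 h2.1
  set K : Set (ℝ × ℝ) := CO \ ⋃ i, G i with hK
  have cK : IsCompact K := compact_CO.inter_right (isOpen_iUnion Gop).isClosed_compl
  have Ksub : K ⊆ (CO \ ⋃ i, H i) ∪ (CO \ Om) := by
    rintro z ⟨h1, h2⟩
    by_cases hz : z ∈ Om
    · left
      refine ⟨h1, fun h => h2 ?_⟩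
      obtain ⟨i, hi⟩ := mem_iUnion.mp h
      exact mem_iUnion.mpr ⟨i, hi, hz⟩
    · exact Or.inr ⟨h1, hz⟩
  have fK : μH[1] (Θ '' K) ≠ ⊤ := by
    refine ne_top_of_le_ne_top (ENNReal.add_ne_top.mpr ⟨hfin, hbfin⟩) ((measure_mono (image_mono Ksub)).trans ?_)
    rw [image_union]; exact measure_union_le _ _
  have hs := fun k : Fin 3 => sliceH Θ cK fK ρ (rotH k) (L := pt k) (fun c u => rfl) (hlip k)
  choose M hM hMle using hs
  obtain ⟨M3, hM3, -⟩ := sliceH Θ cK fK ρ3 pdH (L := pd) (fun c u => rfl) hlip3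
  have clO : closure Om ⊆ CO := closure_minimal Om_CO closed_CO
  have core : Core G K {s | s ∈ (CO \ Om) \ ⋃ i, H i} M M3 (nuH Θ K ρ) := by
    refine ⟨⟨Gop, Gdj, fun i => inter_subset_right, ?_, ?_, hM, hM3, hMle, nuH_fin Θ ρ fK⟩, ?_, ?_, hE, ?_⟩
    · intro z hz
      by_cases h : z ∈ ⋃ i, G i
      · exact Or.inr h
      · exact Or.inl ⟨Om_CO hz, h⟩
    · rintro i x ⟨hx, hx2⟩
      rw [(Gop i).interior_eq] at hx2
      refine ⟨clO (closure_mono inter_subset_right hx), fun hh => ?_⟩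
      obtain ⟨j, hj⟩ := mem_iUnion.mp hh
      obtain ⟨y, hy1, hy2⟩ := mem_closure_iff.mp hx _ (Gop j) hj
      have hij : i ≠ j := fun e => hx2 (e ▸ hj)
      exact Set.disjoint_left.mp (Gdj i j hij) hy2 hy1
    · rintro z ⟨h1, h2⟩
      refine ⟨clO h1, fun h => h2 ?_⟩
      obtain ⟨i, hi⟩ := mem_iUnion.mp h
      exact hi.2
    · exact fun i => Set.disjoint_left.mpr fun z h1 h2 => h2.2 (mem_iUnion.mpr ⟨i, h1⟩)
    · intro k c h0 h1 hn
      have : pt k 0 c ∈ ⋃ i, H i := by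
        by_contra hh
        exact hn ⟨⟨side_CO k h0 h1, side_notMem k c⟩, hh⟩
      obtain ⟨i, hi⟩ := mem_iUnion.mp this
      exact ⟨i, inter_mem (mem_nhdsWithin_of_mem_nhds ((Hop i).mem_nhds hi)) self_mem_nhdsWithin⟩
  have nuE : (nuH Θ K ρ).real Om = ρ * (μH[1] (Θ '' (Om \ ⋃ i, H i))).toReal := by
    rw [Measure.real, nuH_apply _ _ isOpen_Om.measurableSet, ENNReal.toReal_mul]
    have : Om ∩ K = Om \ ⋃ i, H i := by
      ext z
      simp only [hK, hG, mem_inter_iff, Set.mem_sdiff, mem_iUnion, not_exists]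
      constructor
      · rintro ⟨h1, h2, h3⟩; exact ⟨h1, fun i hi => h3 i ⟨hi, h1⟩⟩
      · rintro ⟨h1, h2⟩; exact ⟨h1, Om_CO h1, fun i hi => h2 i hi.1⟩
    rw [this]; simp
  have nK : volume K = 0 := null_of_slice cK.measurableSet (hM 0).ae_fin
  rw [← nuE]
  refine (core_bound core hv).imp_right ?_
  rintro ⟨x, y, hxy, h⟩
  obtain ⟨w, hxw, hyw⟩ : ∃ w : Fin 3, x ≠ w ∧ y ≠ w := by clear * -; revert x y; decide
  refine ⟨w, le_trans ?_ h⟩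
  have e1 : volume.real Om ≤ volume.real (G x) + volume.real (G y) + volume.real (G w) := by
    have fG : ∀ i, volume (G i) ≠ ⊤ := fun i => ne_top_of_le_ne_top (by rw [vol_Om]; simp) (measure_mono inter_subset_right : volume (G i) ≤ volume Om)
    rw [← sum3 hxw hyw hxy (fun i => volume.real (G i))]
    have : volume Om ≤ ∑ i, volume (G i) := by
      calc volume Om ≤ volume (K ∪ ⋃ i, G i) := measure_mono core.cov
        _ ≤ volume K + volume (⋃ i, G i) := measure_union_le _ _
        _ ≤ 0 + ∑ i, volume (G i) := by rw [nK]; gcongr; exact measure_iUnion_fintype_le _ _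
        _ = _ := zero_add _
    simp only [Measure.real]
    rw [← ENNReal.toReal_sum (fun i _ => fG i)]
    exact ENNReal.toReal_mono (ENNReal.sum_ne_top.mpr fun i _ => fG i) this
  have e2 : volume.real Om = 1/2 := by rw [Measure.real, vol_Om, ENNReal.toReal_ofReal (by norm_num)]
  linarith
end

lemma CO_eq : CO = convexHull ℝ {((1:ℝ), (0:ℝ)), (0, 1), (0, 0)} := by
  apply Subset.antisymm
  · rintro ⟨x, y⟩ ⟨h1, h2, h3⟩
    simp only at h1 h2 h3
    have c := convex_convexHull ℝ {((1:ℝ), (0:ℝ)), (0, 1), (0, 0)}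
    have m : ∀ p ∈ ({((1:ℝ), (0:ℝ)), (0, 1), (0, 0)} : Set (ℝ × ℝ)), p ∈ convexHull ℝ {((1:ℝ), (0:ℝ)), (0, 1), (0, 0)} := fun p hp => subset_convexHull ℝ _ hp
    have := c.sum_mem (t := Finset.univ) (w := ![x, y, 1 - x - y]) (z := ![((1:ℝ), (0:ℝ)), (0, 1), (0, 0)])
      (by intro i _; fin_cases i <;> simp <;> linarith) (by simp [Fin.sum_univ_three]) (by intro i _; fin_cases i <;> apply m <;> simp)
    simpa [Fin.sum_univ_three] using this
  · apply convexHull_min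
    · intro p hp
      simp only [mem_insert_iff, mem_singleton_iff] at hp
      rcases hp with rfl | rfl | rfl <;> simp [CO]
    · intro x hx y hy a b ha hb hab
      obtain ⟨h1, h2, h3⟩ := hx
      obtain ⟨h4, h5, h6⟩ := hy
      refine ⟨?_, ?_, ?_⟩ <;> simp only [Prod.fst_add, Prod.snd_add, Prod.smul_fst, Prod.smul_snd, smul_eq_mul]
      · positivity
      · positivity
      · nlinarith [mul_nonneg ha (sub_nonneg.mpr h3), mul_nonneg hb (sub_nonneg.mpr h6)]

abbrev PP := EuclideanSpace ℝ (Fin 2)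

lemma exists_Psi (A B C : PP) (hAB : dist A B = 1) (hBC : dist B C = 1) (hCA : dist C A = 1) :
    ∃ Ψ : (ℝ × ℝ) ≃ₜ PP,
      (∀ z w, dist (Ψ z) (Ψ w) ^ 2 = (z.1 - w.1) ^ 2 + (z.1 - w.1) * (z.2 - w.2) + (z.2 - w.2) ^ 2) ∧
      Ψ '' CO = convexHull ℝ {A, B, C} ∧
      (∀ S, volume (Ψ '' S) = ENNReal.ofReal (Real.sqrt 3 / 2) * volume S) ∧
      ∀ z w, Ψ '' segment ℝ z w = segment ℝ (Ψ z) (Ψ w) := by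
  set a := A - C with ha
  set b := B - C with hb
  have na : ‖a‖ = 1 := by rw [ha, ← dist_eq_norm, dist_comm]; exact hCA
  have nb : ‖b‖ = 1 := by rw [hb, ← dist_eq_norm]; exact hBC
  have nab : ‖a - b‖ = 1 := by rw [ha, hb, sub_sub_sub_cancel_right, ← dist_eq_norm]; exact hAB
  have co : ∀ v : PP, ‖v‖ ^ 2 = v 0 ^ 2 + v 1 ^ 2 := fun v => by
    rw [EuclideanSpace.norm_sq_eq]; simp [Fin.sum_univ_two]
  have ca := co a; have cb := co b; have cab := co (a - b)
  rw [na] at ca; rw [nb] at cb; rw [nab] at cab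
  simp only [PiLp.sub_apply] at cab
  let ℓ : (ℝ × ℝ) →ₗ[ℝ] PP := (LinearMap.toSpanSingleton ℝ PP a).comp (LinearMap.fst ℝ ℝ ℝ) + (LinearMap.toSpanSingleton ℝ PP b).comp (LinearMap.snd ℝ ℝ ℝ)
  have hℓ : ∀ z, ℓ z = z.1 • a + z.2 • b := fun z => by simp [ℓ]
  have nℓ : ∀ z, ‖ℓ z‖ ^ 2 = z.1 ^ 2 + z.1 * z.2 + z.2 ^ 2 := fun z => by
    rw [co, hℓ]; simp only [PiLp.add_apply, PiLp.smul_apply, smul_eq_mul]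
    linear_combination (-(z.1^2) - z.1 * z.2) * ca + (- (z.2^2) - z.1 * z.2) * cb + z.1 * z.2 * cab
  have inj : Function.Injective ℓ := by
    rw [injective_iff_map_eq_zero]
    intro z hz
    have := nℓ z
    rw [hz] at this
    simp at this
    have h1 : z.1 = 0 := by nlinarith [sq_nonneg (z.1), sq_nonneg (z.1 + 2 * z.2)]
    have h2 : z.2 = 0 := by nlinarith [sq_nonneg (z.2), sq_nonneg (z.2 + 2 * z.1)]
    exact Prod.ext h1 h2
  let e : (ℝ × ℝ) ≃ₗ[ℝ] PP := LinearMap.linearEquivOfInjective ℓ inj (by simp)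
  have he : ∀ z, e z = ℓ z := fun z => rfl
  let Ψ : (ℝ × ℝ) ≃ₜ PP := e.toContinuousLinearEquiv.toHomeomorph.trans (Homeomorph.addLeft C)
  have hΨ : ∀ z, Ψ z = C + ℓ z := fun z => rfl
  let Ψa : (ℝ × ℝ) →ᵃ[ℝ] PP := ℓ.toAffineMap + AffineMap.const ℝ _ C
  have hΨa : (Ψ : (ℝ × ℝ) → PP) = Ψa := by funext z; rw [hΨ]; simp [Ψa, add_comm]
  refine ⟨Ψ, ?_, ?_, ?_, ?_⟩
  · intro z w
    rw [hΨ, hΨ, dist_add_left, dist_eq_norm, ← map_sub, nℓ]; rfl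
  · rw [hΨa, CO_eq, AffineMap.image_convexHull, ← hΨa]
    simp [image_insert_eq, hΨ, hℓ, ha, hb]
  · intro S
    let Q : PP → ℝ × ℝ := fun p => (p 0, p 1)
    have mp : MeasurePreserving Q := (volume_preserving_finTwoArrow ℝ).comp (PiLp.volume_preserving_ofLp (Fin 2))
    have Qi : Function.Injective Q := fun p q h => by
      have h0 := congrArg Prod.fst h; have h1 := congrArg Prod.snd h
      ext i; fin_cases i
      · exact h0
      · exact h1
    let N : Matrix (Fin 2) (Fin 2) ℝ := !![a 0, b 0; a 1, b 1]
    let f : (ℝ × ℝ) →ₗ[ℝ] ℝ × ℝ := Matrix.toLin (Module.Basis.finTwoProd ℝ) (Module.Basis.finTwoProd ℝ) N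
    have fd : LinearMap.det f = a 0 * b 1 - b 0 * a 1 := by
      simp [f, N, Matrix.det_fin_two]
    have ff : ∀ z, f z = Q (ℓ z) := fun z => by
      rw [hℓ]
      simp [f, N, Q, Matrix.toLin_finTwoProd, mul_comm]
    have ad : |LinearMap.det f| = Real.sqrt 3 / 2 := by
      rw [fd, ← Real.sqrt_sq_eq_abs]
      rw [show (a 0 * b 1 - b 0 * a 1)^2 = 3 / 4 by
        have hd : a 0 * b 0 + a 1 * b 1 = 1/2 := by linarith
        rw [show (a 0 * b 1 - b 0 * a 1)^2 = (a 0 ^ 2 + a 1 ^ 2) * (b 0 ^ 2 + b 1 ^ 2) - (a 0 * b 0 + a 1 * b 1)^2 by ring, ← ca, ← cb, hd]; norm_num]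
      rw [Real.sqrt_div (by norm_num), show (4:ℝ) = 2^2 by norm_num, Real.sqrt_sq (by norm_num)]
    have h1 : Ψ '' S = (fun p => C + p) '' (ℓ '' S) := by rw [image_image]; rfl
    have h2 : volume (Q '' (ℓ '' S)) = volume (ℓ '' S) := by
      have me : MeasurableEmbedding Q := ((MeasurableEquiv.toLp 2 (Fin 2 → ℝ)).symm.trans MeasurableEquiv.finTwoArrow).measurableEmbedding
      rw [← mp.measure_preimage_emb me, Qi.preimage_image]
    rw [h1, image_add_left, measure_preimage_add, ← h2, image_image]
    simp only [← ff]
    rw [← ad]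
    exact Measure.addHaar_image_linearMap _ f S
  · intro z w
    rw [hΨa]; exact image_segment ℝ Ψa z w

noncomputable def scH (δ r : ℝ) (hr : r ≠ 0) : (ℝ × ℝ) ≃ₜ (ℝ × ℝ) where
  toFun := fun z => (δ + r * z.1, δ + r * z.2)
  invFun := fun z => ((z.1 - δ) / r, (z.2 - δ) / r)
  left_inv := fun z => by ext <;> simp <;> field_simp
  right_inv := fun z => by ext <;> simp <;> field_simp <;> ring
  continuous_toFun := by fun_prop
  continuous_invFun := by fun_prop

open scoped Pointwise in
lemma scH_vol (δ r : ℝ) (hr : r ≠ 0) (S : Set (ℝ × ℝ)) : volume (scH δ r hr '' S) = ENNReal.ofReal (r ^ 2) * volume S := by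
  have : scH δ r hr '' S = (fun p => ((δ, δ) : ℝ × ℝ) + p) '' (r • S) := by
    rw [← image_smul, image_image]; rfl
  rw [this, image_add_left, measure_preimage_add, Measure.addHaar_smul]
  simp

lemma scH_pt (δ r : ℝ) (hr : r ≠ 0) (h : r = 1 - 3 * δ) (k : Fin 3) (c : ℝ) : scH δ r hr (pt k 0 c) = pt k δ (δ + r * c) := by
  subst h
  change (_, _) = _
  fin_cases k <;> simp [pt] <;> ring

lemma rot_fst_sq (k : Fin 3) (z w : ℝ × ℝ) : ((rot (-k) z).1 - (rot (-k) w).1) ^ 2 ≤ 4 / 3 * ((z.1 - w.1) ^ 2 + (z.1 - w.1) * (z.2 - w.2) + (z.2 - w.2) ^ 2) := by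
  have : ∀ k, ((rot k z).1 - (rot k w).1) ^ 2 ≤ 4 / 3 * ((z.1 - w.1) ^ 2 + (z.1 - w.1) * (z.2 - w.2) + (z.2 - w.2) ^ 2) := by
    intro k
    have h1 := sq_nonneg ((z.1 - w.1) + 2 * (z.2 - w.2))
    have h2 := sq_nonneg (2 * (z.1 - w.1) + (z.2 - w.2))
    have h3 := sq_nonneg ((z.1 - w.1) - (z.2 - w.2))
    fin_cases k <;> simp [rot, pt] <;> nlinarith
  exact this _

lemma sides {s : ℝ × ℝ} (h : s ∈ CO \ Om) : ∃ k c, c ∈ Icc (0:ℝ) 1 ∧ s = pt k 0 c := by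
  obtain ⟨⟨h1, h2, h3⟩, h4⟩ := h
  by_cases e1 : s.1 = 0
  · exact ⟨0, s.2, ⟨h2, by linarith⟩, Prod.ext (by simp [pt, e1]) (by simp [pt])⟩
  by_cases e2 : s.2 = 0
  · exact ⟨1, 1 - s.1, ⟨by linarith, by linarith⟩, Prod.ext (by simp [pt]) (by simp [pt, e2])⟩
  · have : s.1 + s.2 = 1 := by
      by_contra e3
      exact h4 ⟨lt_of_le_of_ne h1 (Ne.symm e1), lt_of_le_of_ne h2 (Ne.symm e2), lt_of_le_of_ne h3 e3⟩
    exact ⟨2, s.1, ⟨h1, by linarith⟩, Prod.ext (by simp [pt]) (by simp [pt]; linarith)⟩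

section
variable {Ψ : (ℝ × ℝ) ≃ₜ PP} {N : Fin 3 → Set (ℝ × ℝ)} {L : ℝ}

lemma lip_aux {ρ d x q r : ℝ} (hρ : 0 ≤ ρ) (hd : 0 ≤ d) (hdq : d ^ 2 = r ^ 2 * q) (h : x ^ 2 ≤ ρ ^ 2 * (r ^ 2 * q)) : |x| ≤ ρ * d := by
  apply abs_le_of_sq_le_sq _ (by positivity)
  rw [mul_pow, hdq]; exact h

lemma lower_delta (hd : ∀ z w, dist (Ψ z) (Ψ w) ^ 2 = (z.1 - w.1) ^ 2 + (z.1 - w.1) * (z.2 - w.2) + (z.2 - w.2) ^ 2)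
    (Nop : ∀ i, IsOpen (N i)) (Ndj : ∀ i j, i ≠ j → ∀ z ∈ CO, z ∈ N i → z ∉ N j)
    (hvol : ∀ i, volume (N i ∩ CO) = ENNReal.ofReal (1/6)) (hL : 0 ≤ L)
    (hH : μH[1] (Ψ '' (Om \ ⋃ i, N i)) ≤ ENNReal.ofReal L) {η : ℝ} (hη : 0 < η) (hη2 : η < 0.0005) :
    1 - 20 * η ≤ 2 / Real.sqrt 3 * L := by
  have s3 : 0 < Real.sqrt 3 := Real.sqrt_pos.mpr (by norm_num)
  have s32 : Real.sqrt 3 ^ 2 = 3 := Real.sq_sqrt (by norm_num)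
  have hHt : μH[1] (Ψ '' (Om \ ⋃ i, N i)) ≠ ⊤ := ne_top_of_le_ne_top (by simp) hH
  -- generic delta
  let K1 : Set (ℝ × ℝ) := {z | η ≤ z.1 ∧ η ≤ z.2 ∧ z.1 + z.2 ≤ 1 - η} \ ⋃ i, N i
  have K1O : K1 ⊆ Om \ ⋃ i, N i := fun z hz => ⟨⟨by linarith [hz.1.1], by linarith [hz.1.2.1], by linarith [hz.1.2.2]⟩, hz.2⟩
  have K1c : IsCompact K1 := by
    apply compact_CO.of_isClosed_subset _ (K1O.trans (sdiff_subset.trans Om_CO))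
    have h1 : IsClosed {z : ℝ × ℝ | η ≤ z.1} := isClosed_le (by fun_prop) (by fun_prop)
    have h2 : IsClosed {z : ℝ × ℝ | η ≤ z.2} := isClosed_le (by fun_prop) (by fun_prop)
    have h3 : IsClosed {z : ℝ × ℝ | z.1 + z.2 ≤ 1 - η} := isClosed_le (by fun_prop) (by fun_prop)
    exact (h1.inter (h2.inter h3)).inter (isOpen_iUnion Nop).isClosed_compl
  have gen : ∀ k : Fin 3, ∀ᵐ c, {u | pt k c u ∈ K1}.Finite := by
    intro k
    obtain ⟨M, hM, -⟩ := sliceH Ψ K1c (ne_top_of_le_ne_top hHt (measure_mono (image_mono K1O))) (2 : NNReal) (rotH k) (L := pt k) (fun c u => rfl) (by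
      intro z w
      refine lip_aux (r := 1) (q := (z.1 - w.1) ^ 2 + (z.1 - w.1) * (z.2 - w.2) + (z.2 - w.2) ^ 2) (by positivity) dist_nonneg (by rw [hd]; ring) ?_
      have h1 := rot_fst_sq k z w
      refine h1.trans ?_
      simp only [NNReal.coe_ofNat]
      nlinarith [sq_nonneg ((z.1 - w.1) + 2 * (z.2 - w.2)), sq_nonneg (z.1 - w.1)])
    exact hM.ae_fin
  obtain ⟨δ, hδ, hδ1, hδ2⟩ := (Measure.dense_of_ae (ae_all_iff.mpr gen)).exists_between (show η < 2 * η by linarith)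
  have hδ0 : 0 < δ := hη.trans hδ1
  have hr0 : 0 < 1 - 3 * δ := by linarith
  obtain ⟨r, hr⟩ : ∃ r, r = 1 - 3 * δ := ⟨_, rfl⟩
  rw [← hr] at hr0
  have hr1 : r ≠ 0 := hr0.ne'
  set S := scH δ r hr1 with hS
  have S1 : ∀ z, S z = (δ + r * z.1, δ + r * z.2) := fun z => rfl
  have SO : ∀ z ∈ CO, S z ∈ Om ∧ (η ≤ (S z).1 ∧ η ≤ (S z).2 ∧ (S z).1 + (S z).2 ≤ 1 - η) := by
    rintro z ⟨h1, h2, h3⟩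
    have a1 := mul_nonneg hr0.le h1
    have a2 := mul_nonneg hr0.le h2
    have a3 := mul_nonneg hr0.le (sub_nonneg.mpr h3)
    simp only [Om, mem_ofPred_eq, S1]
    refine ⟨⟨?_, ?_, ?_⟩, ?_, ?_, ?_⟩ <;> nlinarith
  let Θ := S.trans Ψ
  have Θd : ∀ z w, dist (Θ z) (Θ w) ^ 2 = r ^ 2 * ((z.1 - w.1) ^ 2 + (z.1 - w.1) * (z.2 - w.2) + (z.2 - w.2) ^ 2) := by
    intro z w
    change dist (Ψ (S z)) (Ψ (S w)) ^ 2 = _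
    rw [hd, S1, S1]; ring
  let H : Fin 3 → Set (ℝ × ℝ) := fun i => S ⁻¹' N i
  have HU : ⋃ i, H i = S ⁻¹' ⋃ i, N i := by simp [H]
  have imsub : ∀ X ⊆ CO, Θ '' (X \ ⋃ i, H i) ⊆ Ψ '' (Om \ ⋃ i, N i) := by
    rintro X hX _ ⟨z, ⟨h1, h2⟩, rfl⟩
    rw [HU] at h2
    exact ⟨S z, ⟨(SO z (hX h1)).1, h2⟩, rfl⟩
  let ρ : NNReal := Real.toNNReal (2 / (Real.sqrt 3 * r))
  let ρ3 : NNReal := Real.toNNReal (2 / r)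
  have hρ : (ρ : ℝ) = 2 / (Real.sqrt 3 * r) := Real.coe_toNNReal _ (by positivity)
  have hρ3 : (ρ3 : ℝ) = 2 / r := Real.coe_toNNReal _ (by positivity)
  have vb : ∀ i, volume.real (H i ∩ Om) ≤ 1 / (6 * r ^ 2) := by
    intro i
    have h1 : ENNReal.ofReal (r ^ 2) * volume (H i ∩ Om) ≤ ENNReal.ofReal (1/6) := by
      rw [← scH_vol δ r hr1, ← hvol i]
      apply measure_mono
      rintro _ ⟨z, ⟨h1, h2⟩, rfl⟩
      exact ⟨h1, Om_CO (SO z (Om_CO h2)).1⟩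
    have h2 := ENNReal.toReal_mono (by simp) h1
    rw [ENNReal.toReal_mul, ENNReal.toReal_ofReal (by positivity), ENNReal.toReal_ofReal (by positivity)] at h2
    rw [le_div_iff₀ (by positivity)]
    simp only [Measure.real]
    linarith
  have fO : ∀ i, volume (H i ∩ Om) ≠ ⊤ := fun i => ne_top_of_le_ne_top (by rw [vol_Om]; simp) (measure_mono inter_subset_right : volume (H i ∩ Om) ≤ volume Om)
  have main := lower_step Θ ρ ρ3 (by
      intro k z w
      refine lip_aux ρ.coe_nonneg dist_nonneg (Θd z w) ((rot_fst_sq k z w).trans (le_of_eq ?_))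
      rw [hρ]
      field_simp
      rw [s32]; ring) (by
      intro z w
      refine lip_aux ρ3.coe_nonneg dist_nonneg (Θd z w) ?_
      have : (2 / r) ^ 2 * r ^ 2 = 4 := by field_simp; norm_num
      rw [hρ3]
      rw [← mul_assoc, this]
      nlinarith [sq_nonneg ((z.1 - w.1) + (z.2 - w.2))]) H
    (fun i => (Nop i).preimage S.continuous)
    (fun i j hij z hz h1 h2 => Ndj i j hij (S z) (Om_CO (SO z hz).1) h1 h2)
    (ne_top_of_le_ne_top hHt (measure_mono (imsub CO le_rfl)))
    (by
      have sub : Θ '' (CO \ Om) ⊆ ⋃ k : Fin 3, (fun c => Θ (pt k 0 c)) '' Icc (0:ℝ) 1 := by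
        rintro _ ⟨s, hs, rfl⟩
        obtain ⟨k, c, hc, rfl⟩ := sides hs
        exact mem_iUnion.mpr ⟨k, c, hc, rfl⟩
      refine ne_top_of_le_ne_top ?_ ((measure_mono sub).trans (measure_iUnion_fintype_le _ _))
      refine ENNReal.sum_ne_top.mpr fun k _ => ?_
      have lip : LipschitzWith 1 (fun c => Θ (pt k 0 c)) := LipschitzWith.of_dist_le_mul fun c d => by
        simp only [NNReal.coe_one, one_mul]
        rw [Real.dist_eq]
        apply le_trans (le_abs_self _) (sq_le_sq.mp _)
        rw [Θd]
        have : (((pt k 0 c).1 - (pt k 0 d).1) ^ 2 + ((pt k 0 c).1 - (pt k 0 d).1) * ((pt k 0 c).2 - (pt k 0 d).2) + ((pt k 0 c).2 - (pt k 0 d).2) ^ 2) = (c - d) ^ 2 := by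
          fin_cases k <;> simp [pt] <;> ring
        rw [this]
        have : r ^ 2 ≤ 1 := by nlinarith
        nlinarith [sq_nonneg (c - d)]
      have h := lip.hausdorffMeasure_image_le zero_le_one (Icc (0:ℝ) 1)
      rw [hausdorffMeasure_real] at h
      exact ne_top_of_le_ne_top (by simp) h)
    (by
      have fin : (⋃ k : Fin 3, (fun u => pt k 0 ((u - δ) / r)) '' {u | pt k δ u ∈ K1}).Finite := finite_iUnion fun k => (hδ k).image _
      refine fin.subset ?_
      rintro s ⟨hs, hs2⟩
      have hs3 := SO s hs.1
      rw [HU] at hs2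
      obtain ⟨k, c, hc, rfl⟩ := sides hs
      have e : S (pt k 0 c) = pt k δ (δ + r * c) := scH_pt δ r hr1 hr k c
      refine mem_iUnion.mpr ⟨k, δ + r * c, ?_, ?_⟩
      · rw [mem_ofPred_eq, ← e]
        exact ⟨hs3.2, hs2⟩
      · simp only; congr 1; field_simp; ring)
    (by
      intro i
      rw [show (2:ENNReal) = ENNReal.ofReal 2 by simp, ← ENNReal.ofReal_toReal (fO i), ← ENNReal.ofReal_mul (by norm_num)]
      apply ENNReal.ofReal_le_ofReal
      have := vb i
      have h2 : 1 / (6 * r ^ 2) ≤ 0.17 := by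
        rw [div_le_iff₀ (by positivity)]
        nlinarith
      simp only [Measure.real] at this
      linarith)
  have hX : ρ * (μH[1] (Θ '' (Om \ ⋃ i, H i))).toReal ≤ 2 / Real.sqrt 3 * L / r := by
    have h1 : (μH[1] (Θ '' (Om \ ⋃ i, H i))).toReal ≤ L := ENNReal.toReal_le_of_le_ofReal hL ((measure_mono (imsub Om Om_CO)).trans hH)
    have : (ρ : ℝ) = 2 / Real.sqrt 3 / r := by rw [hρ]; field_simp
    rw [this, mul_div_right_comm]
    gcongr
  rcases main with h | ⟨w, h⟩
  · have h2 := h.trans hX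
    rw [le_div_iff₀ hr0] at h2
    linarith
  · have h2 := h.trans hX
    have h3 := vb w
    rw [le_div_iff₀ hr0] at h2
    have h4 : 3 * (1/2 - 1 / (6 * r ^ 2)) * r ≤ 3 * (1 / 2 - volume.real (H w ∩ Om)) * r := by gcongr
    have h5 : 1 - 10 * δ ≤ 3 * (1/2 - 1 / (6 * r ^ 2)) * r := by
      have : 3 * (1/2 - 1 / (6 * r ^ 2)) * r = (3 * r ^ 2 - 1) / (2 * r) := by field_simp; ring
      rw [this, le_div_iff₀ (by positivity)]
      subst hr
      nlinarith
    linarith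

theorem lower (hd : ∀ z w, dist (Ψ z) (Ψ w) ^ 2 = (z.1 - w.1) ^ 2 + (z.1 - w.1) * (z.2 - w.2) + (z.2 - w.2) ^ 2)
    (Nop : ∀ i, IsOpen (N i)) (Ndj : ∀ i j, i ≠ j → ∀ z ∈ CO, z ∈ N i → z ∉ N j)
    (hvol : ∀ i, volume (N i ∩ CO) = ENNReal.ofReal (1/6)) (hL : 0 ≤ L)
    (hH : μH[1] (Ψ '' (Om \ ⋃ i, N i)) ≤ ENNReal.ofReal L) : Real.sqrt 3 / 2 ≤ L := by
  have s3 : 0 < Real.sqrt 3 := Real.sqrt_pos.mpr (by norm_num)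
  have : 1 ≤ 2 / Real.sqrt 3 * L := by
    apply le_of_forall_pos_lt_add
    intro ε hε
    have := lower_delta hd Nop Ndj hvol hL hH (η := min (ε / 40) 0.0001) (by positivity) ((min_le_right _ _).trans_lt (by norm_num))
    have := min_le_left (ε / 40) 0.0001
    linarith
  rw [div_mul_eq_mul_div, le_div_iff₀ s3] at this
  linarith
end

def BB (i : Fin 3) : Set (ℝ × ℝ) := rot i ⁻¹' {z | z.2 < z.1 ∧ 1 - z.1 - z.2 < z.1}

lemma BB_open (i : Fin 3) : IsOpen (BB i) := by
  have h1 : IsOpen {z : ℝ × ℝ | z.2 < z.1} := isOpen_lt (by fun_prop) (by fun_prop)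
  have h2 : IsOpen {z : ℝ × ℝ | 1 - z.1 - z.2 < z.1} := isOpen_lt (by fun_prop) (by fun_prop)
  exact (h1.inter h2).preimage (rotH i).continuous

lemma mem_BB0 (z : ℝ × ℝ) : z ∈ BB 0 ↔ z.2 < z.1 ∧ 1 - z.1 - z.2 < z.1 := by
  simp [BB, rot, pt]

lemma mem_BB1 (z : ℝ × ℝ) : z ∈ BB 1 ↔ z.1 < 1 - z.1 - z.2 ∧ z.2 < 1 - z.1 - z.2 := by
  simp only [BB, rot, pt, mem_preimage, mem_ofPred_eq]
  simp
  intro _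
  constructor <;> intro h <;> linarith

lemma mem_BB2 (z : ℝ × ℝ) : z ∈ BB 2 ↔ 1 - z.1 - z.2 < z.2 ∧ z.1 < z.2 := by
  simp only [BB, rot, pt, mem_preimage, mem_ofPred_eq]
  simp

lemma BB_dj (i j : Fin 3) (h : i ≠ j) : Disjoint (BB i) (BB j) := by
  rw [Set.disjoint_left]
  intro z
  fin_cases i <;> fin_cases j <;> (first | exact absurd rfl h | skip) <;> simp only [Fin.zero_eta, Fin.mk_one, Fin.reduceFinMk, mem_BB0, mem_BB1, mem_BB2] <;> (rintro ⟨h1, h2⟩ ⟨h3, h4⟩; linarith)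

lemma BB_seg : CO \ ⋃ i, BB i ⊆ segment ℝ ((1/3, 1/3) : ℝ × ℝ) (1/2, 1/2) ∪ segment ℝ ((1/3, 1/3) : ℝ × ℝ) (1/2, 0) ∪ segment ℝ ((1/3, 1/3) : ℝ × ℝ) (0, 1/2) := by
  rintro ⟨x, y⟩ ⟨⟨h1, h2, h3⟩, h⟩
  simp only [mem_iUnion, not_exists] at h
  have a0 := h 0
  have a1 := h 1
  have a2 := h 2
  rw [mem_BB0] at a0
  rw [mem_BB1] at a1
  rw [mem_BB2] at a2
  simp only at a0 a1 a2 h1 h2 h3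
  by_cases e1 : x = y ∧ 1/3 ≤ x
  · obtain ⟨e1, e2⟩ := e1
    refine Or.inl (Or.inl ⟨3 - 6 * x, 6 * x - 2, by linarith, by linarith, by ring, ?_⟩)
    ext <;> simp <;> linarith
  by_cases e2 : x = 1 - x - y ∧ 1/3 ≤ x
  · obtain ⟨e1, e2⟩ := e2
    refine Or.inl (Or.inr ⟨3 - 6 * x, 6 * x - 2, by linarith, by linarith, by ring, ?_⟩)
    ext <;> simp <;> linarith
  · refine Or.inr ⟨3 - 6 * y, 6 * y - 2, ?_, ?_, by ring, ?_⟩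
    · grind
    · grind
    · ext <;> simp <;> grind

lemma volCO : volume CO = ENNReal.ofReal (1/2) := by
  rw [← vol_Om]
  refine le_antisymm ?_ (measure_mono Om_CO)
  have h : volume (CO \ Om) = 0 := by
    apply null_of_slice (closed_CO.measurableSet.diff isOpen_Om.measurableSet)
    have : ∀ᵐ c : ℝ, c ≠ 0 := by simp [ae_iff]
    filter_upwards [this] with c hc
    refine (toFinite ({0, 1 - c} : Set ℝ)).subset ?_
    rintro u ⟨⟨h1, h2, h3⟩, h4⟩
    simp only at h1 h2 h3
    by_contra h5
    simp only [mem_insert_iff, mem_singleton_iff, not_or] at h5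
    exact h4 ⟨lt_of_le_of_ne h1 (Ne.symm hc), lt_of_le_of_ne h2 (Ne.symm h5.1), lt_of_le_of_ne h3 (fun h => h5.2 (by simp only at h; linarith))⟩
  have h2 := measure_union_le (μ := volume) Om (CO \ Om)
  rw [h, add_zero] at h2
  exact (measure_mono (fun z hz => by by_cases h : z ∈ Om; exacts [Or.inl h, Or.inr ⟨hz, h⟩])).trans h2

lemma BB_vol (i : Fin 3) : volume (BB i ∩ CO) = ENNReal.ofReal (1/6) := by
  have m : ∀ i, MeasurableSet (BB i ∩ CO) := fun i => (BB_open i).measurableSet.inter closed_CO.measurableSet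
  have e : ∀ i, volume (BB i ∩ CO) = volume (BB 0 ∩ CO) := by
    intro i
    rw [← (rot_mp i).measure_preimage (m 0).nullMeasurableSet]
    congr 1
    ext z
    have : rot i z ∈ CO ↔ z ∈ CO := ⟨fun h => by have := rot_CO (-i) h; rwa [rot_neg] at this, rot_CO i⟩
    simp only [mem_inter_iff, mem_preimage, this]
    rw [mem_BB0]; rfl
  have n : volume (CO \ ⋃ i, BB i) = 0 := by
    apply null_of_slice (closed_CO.measurableSet.diff (isOpen_iUnion BB_open).measurableSet)
    refine Eventually.of_forall fun c => (toFinite ({c, (1 - c) / 2, 1 - 2 * c} : Set ℝ)).subset ?_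
    rintro u ⟨h1, h⟩
    simp only [mem_iUnion, not_exists] at h
    have a0 := h 0
    have a1 := h 1
    have a2 := h 2
    rw [mem_BB0] at a0
    rw [mem_BB1] at a1
    rw [mem_BB2] at a2
    simp only [mem_insert_iff, mem_singleton_iff] at *
    grind
  have s : volume (⋃ i, BB i ∩ CO) = volume CO := by
    refine le_antisymm (measure_mono (iUnion_subset fun i => inter_subset_right)) ?_
    have h2 := measure_union_le (μ := volume) (⋃ i, BB i ∩ CO) (CO \ ⋃ i, BB i)
    rw [n, add_zero] at h2
    refine (measure_mono (fun z hz => ?_)).trans h2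
    by_cases h : z ∈ ⋃ i, BB i
    · obtain ⟨i, hi⟩ := mem_iUnion.mp h
      exact Or.inl (mem_iUnion.mpr ⟨i, hi, hz⟩)
    · exact Or.inr ⟨hz, h⟩
  rw [measure_iUnion (fun i j hij => (BB_dj i j hij).mono inter_subset_left inter_subset_left) m, tsum_fintype, Fin.sum_univ_three, e 1, e 2, volCO] at s
  rw [e i]
  have ft : volume (BB 0 ∩ CO) ≠ ⊤ := ne_top_of_le_ne_top (by rw [volCO]; simp) (measure_mono inter_subset_right : volume (BB 0 ∩ CO) ≤ volume CO)
  rw [← ENNReal.ofReal_toReal ft] at s ⊢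
  have p : 0 ≤ (volume (BB 0 ∩ CO)).toReal := ENNReal.toReal_nonneg
  rw [← ENNReal.ofReal_add p p, ← ENNReal.ofReal_add (by positivity) p, ENNReal.ofReal_eq_ofReal_iff (by positivity) (by norm_num)] at s
  congr 1; linarith

/-- **Theorem 3.2.** `l₃,₃ = √3/2`: the infimum of the dividing lengths over all
3-part equal-area divisions of a closed unit equilateral triangle is `√3/2`. -/
theorem stmt_11 (A B C : EuclideanSpace ℝ (Fin 2))
    (hAB : dist A B = 1) (hBC : dist B C = 1) (hCA : dist C A = 1)
    (T : Set (EuclideanSpace ℝ (Fin 2)))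
    (hT : T = convexHull ℝ ({A, B, C} : Set (EuclideanSpace ℝ (Fin 2)))) :
    sInf { L : ℝ | ∃ U : Fin 3 → Set (EuclideanSpace ℝ (Fin 2)),
        (∀ i j, i ≠ j → Disjoint (U i) (U j)) ∧
        (∀ i, ∃ V : Set (EuclideanSpace ℝ (Fin 2)), IsOpen V ∧ U i = V ∩ T) ∧
        (∀ i, volume (U i) = ENNReal.ofReal ((Real.sqrt 3 / 4) / 3)) ∧
        0 ≤ L ∧
        μH[1] ((T \ ⋃ i, U i) ∩ interior T) = ENNReal.ofReal L } =
      Real.sqrt 3 / 2 := by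
  have s3 : 0 < Real.sqrt 3 := Real.sqrt_pos.mpr (by norm_num)
  have s32 : Real.sqrt 3 ^ 2 = 3 := Real.sq_sqrt (by norm_num)
  obtain ⟨Ψ, hd, hCO, hv, hseg⟩ := exists_Psi A B C hAB hBC hCA
  rw [← hCO] at hT
  subst hT
  have key : ∃ L0 : ℝ, L0 ≤ Real.sqrt 3 / 2 ∧ ∃ U : Fin 3 → Set (EuclideanSpace ℝ (Fin 2)),
        (∀ i j, i ≠ j → Disjoint (U i) (U j)) ∧
        (∀ i, ∃ V : Set (EuclideanSpace ℝ (Fin 2)), IsOpen V ∧ U i = V ∩ (Ψ '' CO)) ∧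
        (∀ i, volume (U i) = ENNReal.ofReal ((Real.sqrt 3 / 4) / 3)) ∧
        0 ≤ L0 ∧
        μH[1] (((Ψ '' CO) \ ⋃ i, U i) ∩ interior (Ψ '' CO)) = ENNReal.ofReal L0 := by
    have bd : μH[1] (((Ψ '' CO) \ ⋃ i, Ψ '' (BB i ∩ CO)) ∩ interior (Ψ '' CO)) ≤ ENNReal.ofReal (Real.sqrt 3 / 2) := by
      have sub : ((Ψ '' CO) \ ⋃ i, Ψ '' (BB i ∩ CO)) ∩ interior (Ψ '' CO) ⊆ segment ℝ (Ψ (1/3, 1/3)) (Ψ (1/2, 1/2)) ∪ segment ℝ (Ψ (1/3, 1/3)) (Ψ (1/2, 0)) ∪ segment ℝ (Ψ (1/3, 1/3)) (Ψ (0, 1/2)) := by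
        rw [← hseg, ← hseg, ← hseg, ← image_union, ← image_union]
        rintro _ ⟨⟨⟨z, hz, rfl⟩, h2⟩, -⟩
        refine mem_image_of_mem _ (BB_seg ⟨hz, fun h => h2 ?_⟩)
        obtain ⟨i, hi⟩ := mem_iUnion.mp h
        exact mem_iUnion.mpr ⟨i, z, ⟨hi, hz⟩, rfl⟩
      have len : ∀ w : ℝ × ℝ, ((1/3:ℝ) - w.1) ^ 2 + (1/3 - w.1) * (1/3 - w.2) + (1/3 - w.2) ^ 2 = 1/12 → μH[1] (segment ℝ (Ψ (1/3, 1/3)) (Ψ w)) = ENNReal.ofReal (Real.sqrt 3 / 6) := by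
        intro w hw
        rw [hausdorffMeasure_segment, edist_dist]
        congr 1
        have := hd (1/3, 1/3) w
        simp only at this
        rw [hw] at this
        rw [← sq_eq_sq₀ dist_nonneg (by positivity), this, div_pow, s32]
        norm_num
      refine (measure_mono sub).trans ((measure_union_le _ _).trans ((add_le_add_left (measure_union_le _ _) _).trans ?_))
      rw [len _ (by norm_num), len _ (by norm_num), len _ (by norm_num), ← ENNReal.ofReal_add (by positivity) (by positivity), ← ENNReal.ofReal_add (by positivity) (by positivity)]
      apply ENNReal.ofReal_le_ofReal
      linarith
    refine ⟨(μH[1] (((Ψ '' CO) \ ⋃ i, Ψ '' (BB i ∩ CO)) ∩ interior (Ψ '' CO))).toReal, ENNReal.toReal_le_of_le_ofReal (by positivity) bd, fun i => Ψ '' (BB i ∩ CO), ?_, ?_, ?_, ENNReal.toReal_nonneg, ?_⟩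
    · intro i j hij
      exact (disjoint_image_iff Ψ.injective).mpr ((BB_dj i j hij).mono inter_subset_left inter_subset_left)
    · intro i
      exact ⟨Ψ '' BB i, Ψ.isOpenMap _ (BB_open i), image_inter Ψ.injective⟩
    · intro i
      rw [hv, BB_vol, ← ENNReal.ofReal_mul (by positivity)]
      congr 1; ring
    · rw [ENNReal.ofReal_toReal (ne_top_of_le_ne_top (by simp) bd)]
  obtain ⟨L0, hL0, hU0⟩ := key
  apply le_antisymm
  · refine le_trans (csInf_le ⟨0, ?_⟩ (show L0 ∈ _ from hU0)) hL0
    rintro L ⟨U, -, -, -, h, -⟩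
    exact h
  · refine le_csInf ⟨L0, hU0⟩ ?_
    rintro L ⟨U, dj, op, vol, hL, hH⟩
    choose V Vo UV using op
    have im : ∀ i, Ψ '' (Ψ ⁻¹' V i ∩ CO) = U i := by
      intro i
      rw [UV, image_inter Ψ.injective, image_preimage_eq _ Ψ.surjective]
    refine lower (Ψ := Ψ) (N := fun i => Ψ ⁻¹' V i) hd (fun i => (Vo i).preimage Ψ.continuous) ?_ ?_ hL (hH ▸ measure_mono ?_)
    · intro i j hij z hz h1 h2
      refine Set.disjoint_left.mp (dj i j hij) (show Ψ z ∈ U i from ?_) ?_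
      · rw [← im]; exact ⟨z, ⟨h1, hz⟩, rfl⟩
      · rw [← im]; exact ⟨z, ⟨h2, hz⟩, rfl⟩
    · intro i
      have h := hv (Ψ ⁻¹' V i ∩ CO)
      rw [im, vol, show Real.sqrt 3 / 4 / 3 = Real.sqrt 3 / 2 * (1/6) by ring, ENNReal.ofReal_mul (by positivity)] at h
      exact ((ENNReal.mul_right_inj (by simp) (by simp)).mp h).symm
    · rintro _ ⟨z, ⟨h1, h2⟩, rfl⟩
      refine ⟨⟨⟨z, Om_CO h1, rfl⟩, fun h => h2 ?_⟩, ?_⟩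
      · obtain ⟨i, hi⟩ := mem_iUnion.mp h
        rw [UV] at hi
        exact mem_iUnion.mpr ⟨i, hi.1⟩
      · exact interior_maximal (image_mono Om_CO) (Ψ.isOpenMap _ isOpen_Om) ⟨z, h1, rfl⟩
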